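/- There exists ε₁ > 0 such that for any 0 < ε₂ < 1/5 and s ≥ 20, there exist d₀ = d₀(ε₁,ε₂,s) and a constant t > 0 such that the following holds for each n ≥ d ≥ d₀ with d < log^s n: if G is an n-vertex bipartite (ε₁, ε₂·d)-expander with minimum degree δ(G) ≥ d which contains no 2-balanced subdivision TK_{d/2}^(2) of the complete graph on ⌈d/2⌉ vertices, then G contains an ℓ-balanced subdivision TK_k^(ℓ) of the complete graph with k ≥ t·d, for some ℓ ∈ ℕ. -/

import Mathlib

open Real

namespace Balanced

variable {V : Type*}

/-- The external neighbourhood of a vertex set `X` in `G`. -/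
def extNbr (G : SimpleGraph V) (X : Set V) : Set V := {v | v ∉ X ∧ ∃ u ∈ X, G.Adj u v}

/-- The Komlós–Szemerédi expansion function `ε(x, ε₁, k)`. -/
noncomputable def epsFn (ε₁ k x : ℝ) : ℝ :=
  if x < k / 5 then 0 else ε₁ / (Real.log (15 * x / k)) ^ 2

/-- `G` is an `(ε₁, k)`-expander. -/
def IsExpander (G : SimpleGraph V) (ε₁ k : ℝ) : Prop :=
  ∀ X : Set V, k / 2 ≤ (X.ncard : ℝ) → (X.ncard : ℝ) ≤ (Nat.card V : ℝ) / 2 →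
    epsFn ε₁ k (X.ncard : ℝ) * (X.ncard : ℝ) ≤ ((extNbr G X).ncard : ℝ)

/-- `G` is bipartite. -/
def IsBip (G : SimpleGraph V) : Prop := ∃ f : V → Bool, ∀ u v, G.Adj u v → f u ≠ f v

/-- The average degree `2|E(G)|/|V(G)|` of `G`. -/
noncomputable def avgDeg (G : SimpleGraph V) : ℝ :=
  2 * (Nat.card G.edgeSet : ℝ) / (Nat.card V : ℝ)

/-- The minimum degree of `G` is at least `d`. -/
def MinDegGE (G : SimpleGraph V) (d : ℝ) : Prop :=
  ∀ v : V, d ≤ ((G.neighborSet v).ncard : ℝ)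

/-- The support of a walk, as a set of vertices. -/
def suppSet {G : SimpleGraph V} {a b : V} (w : G.Walk a b) : Set V := {x | x ∈ w.support}

/-- `G` contains an `ℓ`-balanced subdivision `TK_k^(ℓ)` of the complete graph `K_k`:
there are `k` core vertices joined pairwise by internally vertex-disjoint paths of
length exactly `ℓ`, whose internal vertices avoid all core vertices. -/
def ContainsBalSub (G : SimpleGraph V) (k ℓ : ℕ) : Prop :=
  ∃ c : Fin k → V, Function.Injective c ∧
    ∃ P : ∀ i j : Fin k, i < j → G.Walk (c i) (c j),
      (∀ i j (h : i < j), (P i j h).IsPath ∧ (P i j h).length = ℓ) ∧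
      (∀ i j (h : i < j) (q : Fin k), c q ∈ (P i j h).support → q = i ∨ q = j) ∧
      (∀ i j (h : i < j) i' j' (h' : i' < j'), (i, j) ≠ (i', j') →
        ∀ x, x ∈ (P i j h).support → x ∈ (P i' j' h').support →
          (x = c i ∨ x = c j) ∧ (x = c i' ∨ x = c j'))

/-- The subgraph `F` of `G` is a `(D, m)`-expansion of the vertex `v`:
`|V(F)| = D` and every vertex of `F` is at distance at most `m` from `v` in `F`. -/
def IsExpansion (G : SimpleGraph V) (F : G.Subgraph) (v : V) (D m : ℝ) : Prop :=
  ∃ hv : v ∈ F.verts, ((F.verts.ncard : ℝ) = D ∧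
    ∀ u, ∀ hu : u ∈ F.verts, ∃ w : F.coe.Walk ⟨v, hv⟩ ⟨u, hu⟩, (w.length : ℝ) ≤ m)

/-- `G` contains a `(D, m, k)`-adjuster. -/
def HasAdjuster (G : SimpleGraph V) (D m : ℝ) (k : ℕ) : Prop :=
  ∃ (v₁ v₂ : V) (F₁ F₂ : G.Subgraph) (A : Set V),
    Disjoint A F₁.verts ∧ Disjoint A F₂.verts ∧ Disjoint F₁.verts F₂.verts ∧
    IsExpansion G F₁ v₁ D m ∧ IsExpansion G F₂ v₂ D m ∧
    (A.ncard : ℝ) ≤ 10 * m * (k : ℝ) ∧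
    ∃ ℓ : ℕ, ∀ i : ℕ, i ≤ k → ∃ w : G.Walk v₁ v₂, w.IsPath ∧
      w.length = ℓ + 2 * i ∧ ∀ x ∈ w.support, x ∈ A ∪ {v₁, v₂}

open Classical in
/-- `π(u, v, G)` for a connected bipartite graph `G`: `0` if `u = v`, `1` if `u, v`
lie in different classes of the bipartition (equivalently, are joined by an odd walk),
and `2` otherwise. -/
noncomputable def piVal (G : SimpleGraph V) (u v : V) : ℕ :=
  if u = v then 0 else if ∃ w : G.Walk u v, Odd w.length then 1 else 2

/-- The ball of radius `r` around `v` in the subgraph of `G` induced on `S`,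
viewed as a subset of `V`. -/
def ballIn (G : SimpleGraph V) (S : Set V) (v : V) (r : ℕ) : Set V :=
  {u | ∃ w : G.Walk v u, w.length ≤ r ∧ ∀ x ∈ w.support, x ∈ S}

/-- The ball of radius `r` around the set `Y` in the subgraph of `G` induced on `S`. -/
def ballSetIn (G : SimpleGraph V) (S : Set V) (Y : Set V) (r : ℕ) : Set V :=
  {u | ∃ y ∈ Y, ∃ w : G.Walk y u, w.length ≤ r ∧ ∀ x ∈ w.support, x ∈ S}

/-- `P 0, …, P (q-1)` are consecutive shortest paths from `v` in the vertex set `W`: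
each `P i` is a shortest path between its endpoints in the graph induced on
`(W \ ⋃_{j<i} V(P j)) ∪ {v}`. -/
def ConsecSP (G : SimpleGraph V) (v : V) (W : Set V) {q : ℕ}
    (P : Fin q → Σ u : V, G.Walk v u) : Prop :=
  ∀ i : Fin q,
    (∀ x ∈ suppSet (P i).2,
      x ∈ (W \ ⋃ (j : Fin q) (_ : j < i), suppSet (P j).2) ∪ {v}) ∧
    ((P i).2).IsPath ∧
    ∀ w' : G.Walk v (P i).1,
      (∀ x ∈ suppSet w',
        x ∈ (W \ ⋃ (j : Fin q) (_ : j < i), suppSet (P j).2) ∪ {v}) →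
      ((P i).2).length ≤ w'.length

/-- `v` is an end vertex of the path `p`. -/
def IsEnd (G : SimpleGraph V) (v : V) (p : Σ a b : V, G.Walk a b) : Prop :=
  v = p.1 ∨ v = p.2.1

/-- `t` is the subpath `p(v, r)` of `p` of length `r` having `v` as an end vertex. -/
def IsTrunc (G : SimpleGraph V) (r : ℕ) (p : Σ a b : V, G.Walk a b) (v : V)
    (t : Σ u : V, G.Walk v u) : Prop :=
  t.2.length = r ∧ ∃ (c : V) (w' : G.Walk t.1 c),
    (⟨v, c, t.2.append w'⟩ : Σ a b : V, G.Walk a b) = p ∨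
    (⟨v, c, t.2.append w'⟩ : Σ a b : V, G.Walk a b) = ⟨p.2.1, p.1, p.2.2.reverse⟩

section Tools
open scoped Classical
open Finset

variable {V : Type*} {G : SimpleGraph V}

/-- `b` can be reached from `a` by a walk of length at most `r` inside `S`. -/
def Reach (G : SimpleGraph V) (S : Set V) (a b : V) (r : ℕ) : Prop :=
  ∃ p : G.Walk a b, p.length ≤ r ∧ ∀ x ∈ p.support, x ∈ S

/-- There is a path of length exactly `r` from `a` to `b` inside `S`. -/
def PathIn (G : SimpleGraph V) (S : Set V) (a b : V) (r : ℕ) : Prop :=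
  ∃ p : G.Walk a b, p.IsPath ∧ p.length = r ∧ ∀ x ∈ p.support, x ∈ S

theorem Reach.refl {S : Set V} {a : V} (h : a ∈ S) (r : ℕ) : Reach G S a a r :=
  ⟨SimpleGraph.Walk.nil, by simp, by simpa using h⟩

theorem Reach.mono {S S' : Set V} {a b : V} {r r' : ℕ} (h : Reach G S a b r) (hS : S ⊆ S')
    (hr : r ≤ r') : Reach G S' a b r' := by
  obtain ⟨p, hp, hs⟩ := h
  exact ⟨p, hp.trans hr, fun x hx => hS (hs x hx)⟩

theorem Reach.trans {S : Set V} {a b c : V} {r r' : ℕ} (h : Reach G S a b r)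
    (h' : Reach G S b c r') : Reach G S a c (r + r') := by
  obtain ⟨p, hp, hs⟩ := h
  obtain ⟨q, hq, hs'⟩ := h'
  refine ⟨p.append q, by rw [SimpleGraph.Walk.length_append]; omega, fun x hx => ?_⟩
  rw [SimpleGraph.Walk.mem_support_append_iff] at hx
  exact hx.elim (hs x) (hs' x)

theorem Reach.symm {S : Set V} {a b : V} {r : ℕ} (h : Reach G S a b r) : Reach G S b a r := by
  obtain ⟨p, hp, hs⟩ := h
  exact ⟨p.reverse, by simpa using hp, fun x hx => hs x (by simpa using hx)⟩

theorem Reach.left_mem {S : Set V} {a b : V} {r : ℕ} (h : Reach G S a b r) : a ∈ S := by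
  obtain ⟨p, -, hs⟩ := h
  exact hs _ p.start_mem_support

theorem Reach.right_mem {S : Set V} {a b : V} {r : ℕ} (h : Reach G S a b r) : b ∈ S :=
  h.symm.left_mem

theorem Reach.of_adj {S : Set V} {a b : V} (h : G.Adj a b) (ha : a ∈ S) (hb : b ∈ S) :
    Reach G S a b 1 :=
  ⟨h.toWalk, by simp, by simp [SimpleGraph.Adj.toWalk, ha, hb]⟩

theorem Reach.exists_pathIn {S : Set V} {a b : V} {r : ℕ} (h : Reach G S a b r) :
    ∃ ℓ ≤ r, PathIn G S a b ℓ := by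
  obtain ⟨p, hp, hs⟩ := h
  exact ⟨_, (p.length_bypass_le_length).trans hp, p.bypass, p.bypass_isPath, rfl,
    fun x hx => hs x (p.support_bypass_subset_support hx)⟩

theorem PathIn.reach {S : Set V} {a b : V} {r : ℕ} (h : PathIn G S a b r) : Reach G S a b r := by
  obtain ⟨p, -, hp, hs⟩ := h
  exact ⟨p, hp.le, hs⟩

theorem PathIn.mono {S S' : Set V} {a b : V} {r : ℕ} (h : PathIn G S a b r) (hS : S ⊆ S') :
    PathIn G S' a b r := by
  obtain ⟨p, hp, hl, hs⟩ := h
  exact ⟨p, hp, hl, fun x hx => hS (hs x hx)⟩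

theorem PathIn.symm {S : Set V} {a b : V} {r : ℕ} (h : PathIn G S a b r) : PathIn G S b a r := by
  obtain ⟨p, hp, hl, hs⟩ := h
  exact ⟨p.reverse, hp.reverse, by simpa using hl, fun x hx => hs x (by simpa using hx)⟩

theorem PathIn.left_mem {S : Set V} {a b : V} {r : ℕ} (h : PathIn G S a b r) : a ∈ S :=
  h.reach.left_mem

theorem PathIn.right_mem {S : Set V} {a b : V} {r : ℕ} (h : PathIn G S a b r) : b ∈ S :=
  h.reach.right_mem

theorem PathIn.append {S S' : Set V} {a b c : V} {r r' : ℕ} (h : PathIn G S a b r)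
    (h' : PathIn G S' b c r') (hS : ∀ x ∈ S, x ∈ S' → x = b) :
    PathIn G (S ∪ S') a c (r + r') := by
  obtain ⟨p, hp, hl, hs⟩ := h
  obtain ⟨q, hq, hl', hs'⟩ := h'
  refine ⟨p.append q, ?_, by rw [SimpleGraph.Walk.length_append, hl, hl'], fun x hx => ?_⟩
  · rw [SimpleGraph.Walk.isPath_def, SimpleGraph.Walk.support_append, List.nodup_append']
    refine ⟨hp.support_nodup, hq.support_nodup.tail, fun x hx hx' => ?_⟩
    have hb : x = b := hS x (hs x hx) (hs' x (List.mem_of_mem_tail hx'))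
    have := hq.support_nodup
    rw [← SimpleGraph.Walk.cons_tail_support, List.nodup_cons] at this
    exact this.1 (hb ▸ hx')
  · rw [SimpleGraph.Walk.mem_support_append_iff] at hx
    exact hx.elim (fun h => Or.inl (hs x h)) (fun h => Or.inr (hs' x h))

theorem PathIn.refl {S : Set V} {a : V} (h : a ∈ S) : PathIn G S a a 0 :=
  ⟨SimpleGraph.Walk.nil, by simp, by simp, by simpa using h⟩

theorem PathIn.of_adj {a b : V} (h : G.Adj a b) : PathIn G {a, b} a b 1 :=
  ⟨h.toWalk, by simp [SimpleGraph.Adj.toWalk, h.ne], by simp, by simp [SimpleGraph.Adj.toWalk]⟩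

/-- A path can be recorded together with its finite vertex set. -/
theorem PathIn.exists_finset {S : Set V} {a b : V} {r : ℕ} (h : PathIn G S a b r) :
    ∃ P : Finset V, (P : Set V) ⊆ S ∧ P.card = r + 1 ∧ PathIn G (P : Set V) a b r := by
  obtain ⟨p, hp, hl, hs⟩ := h
  refine ⟨p.support.toFinset, fun x hx => hs x (by simpa using hx), ?_, p, hp, hl, by simp⟩
  rw [List.toFinset_card_of_nodup hp.support_nodup, SimpleGraph.Walk.length_support, hl]

variable [Fintype V]

/-- External neighbourhood. -/
noncomputable def nb (G : SimpleGraph V) (X : Finset V) : Finset V :=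
  univ.filter fun v => v ∉ X ∧ ∃ u ∈ X, G.Adj u v

/-- Ball of radius `r` around `A`, all of whose further vertices lie outside `W`. -/
noncomputable def ball (G : SimpleGraph V) (W A : Finset V) : ℕ → Finset V
  | 0 => A
  | r + 1 => ball G W A r ∪ (nb G (ball G W A r) \ W)

theorem mem_nb {X : Finset V} {v : V} : v ∈ nb G X ↔ v ∉ X ∧ ∃ u ∈ X, G.Adj u v := by
  simp [nb]

theorem ball_mono_succ (W A : Finset V) (r : ℕ) : ball G W A r ⊆ ball G W A (r + 1) :=
  subset_union_left

theorem ball_mono (W A : Finset V) : Monotone (ball G W A) :=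
  monotone_nat_of_le_succ (ball_mono_succ W A)

theorem subset_ball (W A : Finset V) (r : ℕ) : A ⊆ ball G W A r :=
  ball_mono W A (Nat.zero_le r)

theorem mem_ball_succ_of_adj {W A : Finset V} {r : ℕ} {u v : V} (hu : u ∈ ball G W A r)
    (h : G.Adj u v) (hv : v ∉ W) : v ∈ ball G W A (r + 1) := by
  by_cases hb : v ∈ ball G W A r
  · exact ball_mono_succ W A r hb
  · exact mem_union_right _ (mem_sdiff.2 ⟨mem_nb.2 ⟨hb, u, hu, h⟩, hv⟩)

theorem ball_card_succ (W A : Finset V) (r : ℕ) :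
    (ball G W A (r + 1)).card = (ball G W A r).card + (nb G (ball G W A r) \ W).card := by
  rw [ball, card_union_of_disjoint]
  rw [disjoint_left]
  intro x hx hx'
  exact (mem_nb.1 (mem_sdiff.1 hx').1).1 hx

theorem ball_reach {W A : Finset V} {r : ℕ} {v : V} (h : v ∈ ball G W A r) :
    ∃ a ∈ A, Reach G {x | (x ∈ ball G W A r) ∧ (x = a ∨ x ∉ W)} a v r := by
  induction r generalizing v with
  | zero => 
    refine ⟨v, h, Reach.refl ?_ 0⟩
    exact ⟨h, Or.inl rfl⟩
  | succ r ih =>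
    have hsub := ball_mono_succ (G := G) W A r
    rw [ball, mem_union] at h
    rcases h with h | h
    · obtain ⟨a, ha, hr⟩ := ih h
      exact ⟨a, ha, hr.mono (fun x hx => ⟨hsub hx.1, hx.2⟩) (by omega)⟩
    · rw [mem_sdiff, mem_nb] at h
      obtain ⟨⟨h1, u, hu, huv⟩, h2⟩ := h
      obtain ⟨a, ha, hr⟩ := ih hu
      have hr' : Reach G {x | (x ∈ ball G W A (r + 1)) ∧ (x = a ∨ x ∉ W)} a u r :=
        hr.mono (fun x hx => ⟨hsub hx.1, hx.2⟩) le_rfl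
      have hv : v ∈ {x | (x ∈ ball G W A (r + 1)) ∧ (x = a ∨ x ∉ W)} :=
        ⟨mem_ball_succ_of_adj hu huv h2, Or.inr h2⟩
      exact ⟨a, ha, hr'.trans (Reach.of_adj huv hr'.right_mem hv)⟩

theorem ball_reach_singleton {W : Finset V} {a : V} {r : ℕ} {v : V} (h : v ∈ ball G W {a} r) :
    Reach G (ball G W {a} r : Set V) a v r := by
  obtain ⟨b, hb, hr⟩ := ball_reach h
  obtain rfl := mem_singleton.1 hb
  exact hr.mono (fun x hx => hx.1) le_rfl

theorem ball_avoid {W : Finset V} {a : V} {r : ℕ} {v : V} (h : v ∈ ball G W {a} r) :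
    v = a ∨ v ∉ W := by
  obtain ⟨b, hb, hr⟩ := ball_reach h
  obtain rfl := mem_singleton.1 hb
  exact hr.right_mem.2

theorem walk_in_ball {W A : Finset V} {i : ℕ} {a b : V} (ha : a ∈ ball G W A i) (p : G.Walk a b)
    (h : ∀ x ∈ p.support, x ∈ A ∨ x ∉ W) : b ∈ ball G W A (i + p.length) := by
  induction p generalizing i with
  | nil => simpa using ha
  | cons hadj p ih =>
    rename_i u v w
    have hv : v ∈ ball G W A (i + 1) := by
      rcases h v (by simp) with h | h
      · exact subset_ball _ _ _ h
      · exact mem_ball_succ_of_adj ha hadj h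
    have := ih hv (fun x hx => h x (by simp [hx]))
    rw [SimpleGraph.Walk.length_cons]
    convert this using 2
    omega

theorem Reach.mem_ball {W A : Finset V} {i r : ℕ} {S : Set V} {a b : V} (ha : a ∈ ball G W A i)
    (h : Reach G S a b r) (hS : ∀ x ∈ S, x ∈ A ∨ x ∉ W) : b ∈ ball G W A (i + r) := by
  obtain ⟨p, hp, hs⟩ := h
  exact ball_mono W A (by omega) (walk_in_ball ha p fun x hx => hS x (hs x hx))

theorem ball_eq_biUnion (W A : Finset V) (r : ℕ) :
    ball G W A r = A.biUnion fun a => ball G W {a} r := by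
  ext v
  rw [mem_biUnion]
  constructor
  · intro h
    obtain ⟨a, ha, hr⟩ := ball_reach h
    refine ⟨a, ha, ?_⟩
    have := hr.mem_ball (W := W) (A := {a}) (i := 0) (mem_singleton_self a)
      (fun x hx => by simpa using hx.2)
    simpa using this
  · rintro ⟨a, ha, hv⟩
    have h := (ball_reach hv)
    obtain ⟨b, hb, hr⟩ := h
    obtain rfl := mem_singleton.1 hb
    have := hr.mem_ball (W := W) (A := A) (i := 0) ha
      (fun x hx => by rcases hx.2 with h | h; · exact Or.inl (h ▸ ha)
                      · exact Or.inr h)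
    simpa using this

theorem ball_subset_of_subset {W A A' : Finset V} (h : A ⊆ A') (r : ℕ) :
    ball G W A r ⊆ ball G W A' r := by
  rw [ball_eq_biUnion W A, ball_eq_biUnion W A']
  exact biUnion_subset_biUnion_of_subset_left _ h

theorem ball_anti {W W' A : Finset V} (h : W ⊆ W') (r : ℕ) : ball G W' A r ⊆ ball G W A r := by
  induction r with
  | zero => exact Subset.rfl
  | succ r ih =>
    rw [ball]
    refine union_subset (ih.trans (ball_mono_succ W A r)) fun v hv => ?_
    rw [mem_sdiff, mem_nb] at hv
    obtain ⟨⟨h1, u, hu, huv⟩, h2⟩ := hv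
    exact mem_ball_succ_of_adj (ih hu) huv fun hh => h2 (h hh)

theorem ball_symm {W : Finset V} {a b : V} {r : ℕ} (h : b ∈ ball G W {a} r) (ha : a ∉ W) :
    a ∈ ball G W {b} r := by
  obtain ⟨c, hc, hr⟩ := ball_reach h
  obtain rfl := mem_singleton.1 hc
  have := hr.symm.mem_ball (W := W) (A := {b}) (i := 0) (mem_singleton_self b)
      (fun x hx => by rcases hx.2 with h | h; · exact Or.inr (h ▸ ha)
                      · exact Or.inr h)
  simpa using this

theorem ball_add {W A : Finset V} (i j : ℕ) : ball G W (ball G W A i) j ⊆ ball G W A (i + j) := by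
  induction j with
  | zero => exact Subset.rfl
  | succ j ih =>
    rw [ball]
    refine union_subset (ih.trans (ball_mono W A (by omega))) fun v hv => ?_
    rw [mem_sdiff, mem_nb] at hv
    obtain ⟨⟨h1, u, hu, huv⟩, h2⟩ := hv
    exact mem_ball_succ_of_adj (ih hu) huv h2

/-- Balls around `X` decompose into balls leaving `X` for the last time. -/
theorem ball_subset_exit (W X : Finset V) (r : ℕ) :
    ball G W X r ⊆ X.biUnion fun y => ball G (W ∪ X) {y} r := by
  intro v hv
  have : v ∈ ball G (W ∪ X) X r := by
    induction r generalizing v with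
    | zero => exact hv
    | succ r ih =>
      rw [ball, mem_union] at hv
      rcases hv with hv | hv
      · exact ball_mono_succ _ _ _ (ih hv)
      · rw [mem_sdiff, mem_nb] at hv
        obtain ⟨⟨h1, u, hu, huv⟩, h2⟩ := hv
        refine mem_ball_succ_of_adj (ih hu) huv ?_
        rw [mem_union, not_or]
        exact ⟨h2, fun hX => h1 (subset_ball _ _ _ hX)⟩
  rwa [ball_eq_biUnion] at this

theorem ball_card_le {H : Finset V} {Δ : ℕ} (hΔ : ∀ v ∉ H, (nb G {v}).card ≤ Δ)
    (Y : Finset V) (hY : Disjoint Y H) (r : ℕ) :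
    (ball G H Y r).card ≤ Y.card * (Δ + 1) ^ r := by
  induction r with
  | zero => simp [ball]
  | succ r ih =>
    have hdis : ∀ v ∈ ball G H Y r, v ∉ H := by
      intro v hv
      obtain ⟨a, ha, hr⟩ := ball_reach hv
      rcases hr.right_mem.2 with h | h
      · exact h ▸ disjoint_left.1 hY ha
      · exact h
    have h1 : (nb G (ball G H Y r) \ H).card ≤ (ball G H Y r).card * Δ := by
      calc (nb G (ball G H Y r) \ H).card ≤ ((ball G H Y r).biUnion fun v => nb G {v}).card := by
            refine card_le_card fun v hv => ?_
            rw [mem_sdiff, mem_nb] at hv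
            obtain ⟨⟨h1, u, hu, huv⟩, h2⟩ := hv
            exact mem_biUnion.2 ⟨u, hu, mem_nb.2 ⟨by simpa using huv.ne', u, by simp, huv⟩⟩
        _ ≤ _ := card_biUnion_le_card_mul _ _ _ fun v hv => hΔ v (hdis v hv)
    rw [ball_card_succ, pow_succ]
    calc _ ≤ (ball G H Y r).card * (Δ + 1) := by nlinarith
      _ ≤ Y.card * (Δ + 1) ^ r * (Δ + 1) := Nat.mul_le_mul_right _ ih
      _ = _ := by ring

end Tools

section Expansion
open scoped Classical
open Finset

theorem mul_succ_pow_ge (x i : ℕ) : x ^ i * (x + i) ≤ x * (x + 1) ^ i := by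
  induction i with
  | zero => simp
  | succ i ih =>
    calc x ^ (i + 1) * (x + (i + 1)) = x ^ i * (x * (x + i + 1)) := by ring
      _ ≤ x ^ i * ((x + i) * (x + 1)) := Nat.mul_le_mul_left _ (by nlinarith)
      _ = x ^ i * (x + i) * (x + 1) := by ring
      _ ≤ x * (x + 1) ^ i * (x + 1) := Nat.mul_le_mul_right _ ih
      _ = _ := by ring

theorem two_mul_self_pow_le {x : ℕ} (hx : 0 < x) : 2 * x ^ x ≤ (x + 1) ^ x := by
  refine le_of_mul_le_mul_left ?_ hx
  calc x * (2 * x ^ x) = x ^ x * (x + x) := by ring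
    _ ≤ _ := mul_succ_pow_ge x x

/-- A monotone sequence which grows by a factor `1 + 1 / (2 * E ^ 2)` as long as it is below `K ≤ 2^E`
reaches `K` within `2 * E ^ 3` steps. -/
theorem growth {b : ℕ → ℕ} (hb : Monotone b) {ρ E K : ℕ} (h1 : 1 ≤ b ρ) (hK : K ≤ 2 ^ E)
    (h : ∀ r, ρ ≤ r → r < ρ + 2 * E ^ 3 → b r < K →
      (2 * E ^ 2 + 1) * b r ≤ 2 * E ^ 2 * b (r + 1)) : K ≤ b (ρ + 2 * E ^ 3) := by
  rcases Nat.eq_zero_or_pos E with rfl | hE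
  · simpa using hK.trans h1
  by_contra! hlt
  have key : ∀ i ≤ 2 * E ^ 3, (2 * E ^ 2 + 1) ^ i ≤ (2 * E ^ 2) ^ i * b (ρ + i) := by
    intro i
    induction i with
    | zero => simpa using h1
    | succ i ih =>
      intro hi
      have h2 := h (ρ + i) (by omega) (by omega)
        ((hb (by omega : ρ + i ≤ ρ + 2 * E ^ 3)).trans_lt hlt)
      calc (2 * E ^ 2 + 1) ^ (i + 1) = (2 * E ^ 2 + 1) ^ i * (2 * E ^ 2 + 1) := pow_succ _ _
        _ ≤ (2 * E ^ 2) ^ i * b (ρ + i) * (2 * E ^ 2 + 1) :=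
            Nat.mul_le_mul_right _ (ih (by omega))
        _ = (2 * E ^ 2) ^ i * ((2 * E ^ 2 + 1) * b (ρ + i)) := by ring
        _ ≤ (2 * E ^ 2) ^ i * (2 * E ^ 2 * b (ρ + i + 1)) := Nat.mul_le_mul_left _ h2
        _ = _ := by rw [pow_succ, add_assoc]; ring
  have h2 := key _ le_rfl
  have h3 : 2 ^ E * (2 * E ^ 2) ^ (2 * E ^ 3) ≤ (2 * E ^ 2 + 1) ^ (2 * E ^ 3) := by
    have := Nat.pow_le_pow_left (two_mul_self_pow_le (x := 2 * E ^ 2) (by positivity)) E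
    rw [mul_pow, ← pow_mul, ← pow_mul] at this
    have e : 2 * E ^ 2 * E = 2 * E ^ 3 := by ring
    rwa [e] at this
  have h4 : 2 ^ E * (2 * E ^ 2) ^ (2 * E ^ 3) ≤ b (ρ + 2 * E ^ 3) * (2 * E ^ 2) ^ (2 * E ^ 3) :=
    h3.trans (h2.trans_eq (mul_comm _ _))
  have h5 := Nat.le_of_mul_le_mul_right h4 (by positivity)
  omega

variable {V : Type*} [Fintype V] {G : SimpleGraph V} {d Kc : ℕ}

/-- The combinatorial content of the expansion hypotheses. -/
structure Good (G : SimpleGraph V) (d Kc : ℕ) : Prop where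
  pos : 0 < d
  deg : ∀ v, d ≤ (nb G {v}).card
  exp : ∀ (X : Finset V) (E : ℕ), d ≤ 2 * X.card → 2 * X.card ≤ Fintype.card V →
    X.card ≤ 2 ^ E → X.card ≤ E ^ 2 * (nb G X).card
  exp0 : ∀ X : Finset V, d ≤ 2 * X.card → 2 * X.card ≤ Fintype.card V →
    d * X.card ≤ (Kc * (nb G X).card) ^ 2

theorem ball_step (hG : Good G d Kc) {W A : Finset V} {r E : ℕ}
    (h1 : d ≤ 2 * (ball G W A r).card) (h2 : 2 * (ball G W A r).card ≤ Fintype.card V)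
    (h3 : (ball G W A r).card ≤ 2 ^ E)
    (h4 : 2 * E ^ 2 * (nb G (ball G W A r) ∩ W).card ≤ (ball G W A r).card) :
    (2 * E ^ 2 + 1) * (ball G W A r).card ≤ 2 * E ^ 2 * (ball G W A (r + 1)).card := by
  have h5 := hG.exp _ E h1 h2 h3
  have h6 := card_sdiff_add_card_inter (nb G (ball G W A r)) W
  rw [ball_card_succ]
  rw [← h6] at h5
  nlinarith

theorem ball_grow (hG : Good G d Kc) {W A : Finset V} {ρ E K : ℕ}
    (h1 : d ≤ 2 * (ball G W A ρ).card) (hK : 2 * K ≤ Fintype.card V + 2) (hKE : K ≤ 2 ^ E)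
    (h4 : ∀ r, ρ ≤ r → r < ρ + 2 * E ^ 3 → (ball G W A r).card < K →
      2 * E ^ 2 * (nb G (ball G W A r) ∩ W).card ≤ (ball G W A r).card) :
    K ≤ (ball G W A (ρ + 2 * E ^ 3)).card := by
  have hpos := hG.pos
  refine growth (b := fun r => (ball G W A r).card)
    (fun i j hij => card_le_card (ball_mono W A hij)) (by show 1 ≤ _; omega) hKE ?_
  intro r hr hr' hlt
  have hm : (ball G W A ρ).card ≤ (ball G W A r).card := card_le_card (ball_mono W A hr)
  exact ball_step hG (by omega) (by omega) (by omega) (h4 r hr hr' hlt)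

theorem big_ball (hG : Good G d Kc) {W A : Finset V} {E : ℕ} (hn : Fintype.card V ≤ 2 ^ E)
    (h1 : d ≤ 2 * A.card) (h2 : 2 * E ^ 2 * W.card ≤ A.card) :
    Fintype.card V < 2 * (ball G W A (2 * E ^ 3)).card := by
  have hpos := hG.pos
  have hAn : A.card ≤ Fintype.card V := card_le_univ A
  have := ball_grow hG (W := W) (A := A) (ρ := 0) (E := E) (K := Fintype.card V / 2 + 1)
    h1 (by omega) (by omega) (fun r _ _ _ => by
      calc _ ≤ 2 * E ^ 2 * W.card := Nat.mul_le_mul_left _ (card_le_card inter_subset_right)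
        _ ≤ _ := h2.trans (card_le_card (subset_ball _ _ _)))
  rw [Nat.zero_add] at this
  omega

theorem balls_meet {W W' A B : Finset V} {r r' : ℕ}
    (h1 : Fintype.card V < 2 * (ball G W A r).card)
    (h2 : Fintype.card V < 2 * (ball G W' B r').card) :
    ∃ a ∈ A, ∃ b ∈ B, Reach G {x | x = a ∨ x = b ∨ x ∉ W ∨ x ∉ W'} a b (r + r') := by
  have : ¬ Disjoint (ball G W A r) (ball G W' B r') := by
    intro hd
    have := card_union_of_disjoint hd
    have := card_le_univ (ball G W A r ∪ ball G W' B r')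
    omega
  obtain ⟨v, hv, hv'⟩ := not_disjoint_iff.1 this
  obtain ⟨a, ha, hra⟩ := ball_reach hv
  obtain ⟨b, hb, hrb⟩ := ball_reach hv'
  refine ⟨a, ha, b, hb, (hra.mono ?_ le_rfl).trans (hrb.symm.mono ?_ le_rfl)⟩
  · rintro x ⟨-, h | h⟩
    · exact Or.inl h
    · exact Or.inr (Or.inr (Or.inl h))
  · rintro x ⟨-, h | h⟩
    · exact Or.inr (Or.inl h)
    · exact Or.inr (Or.inr (Or.inr h))

theorem conn_sets (hG : Good G d Kc) {W A B : Finset V} {E : ℕ} (hn : Fintype.card V ≤ 2 ^ E)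
    (h1 : d ≤ 2 * A.card) (h2 : 2 * E ^ 2 * W.card ≤ A.card)
    (h3 : d ≤ 2 * B.card) (h4 : 2 * E ^ 2 * W.card ≤ B.card) :
    ∃ a ∈ A, ∃ b ∈ B, Reach G {x | x = a ∨ x = b ∨ x ∉ W} a b (4 * E ^ 3) := by
  obtain ⟨a, ha, b, hb, h⟩ := balls_meet (big_ball hG hn h1 h2) (big_ball hG hn h3 h4)
  refine ⟨a, ha, b, hb, h.mono ?_ (by omega)⟩
  rintro x (h | h | h | h)
  exacts [Or.inl h, Or.inr (Or.inl h), Or.inr (Or.inr h), Or.inr (Or.inr h)]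

theorem few_bad (hG : Good G d Kc) {W : Finset V} {E D : ℕ} (hn : Fintype.card V ≤ 2 ^ E)
    (h1 : d ≤ 2 * D) (h2 : 2 * E ^ 2 * W.card ≤ D) (h3 : 2 * D ^ 2 ≤ Fintype.card V) :
    (univ.filter fun v => (ball G W {v} (2 * E ^ 3)).card < D).card < D := by
  by_contra! hlt
  obtain ⟨A, hA, hAD⟩ := exists_subset_card_eq hlt
  have hb := big_ball hG (W := W) (A := A) hn (by omega) (by omega)
  have : (ball G W A (2 * E ^ 3)).card ≤ A.card * D := by
    rw [ball_eq_biUnion]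
    refine card_biUnion_le_card_mul _ _ _ fun v hv => ?_
    exact (mem_filter.1 (hA hv)).2.le
  rw [hAD] at this
  nlinarith

theorem exists_exit {W X : Finset V} {v : V} {D r : ℕ} (hv : v ∈ X) (hD : 0 < D)
    (h : D * X.card ≤ (ball G W {v} r).card) : ∃ y ∈ X, D ≤ (ball G (W ∪ X) {y} r).card := by
  by_contra! hlt
  have h1 : (ball G W {v} r).card ≤ X.card * (D - 1) := by
    refine (card_le_card ((ball_subset_of_subset (singleton_subset_iff.2 hv) r).trans
      (ball_subset_exit W X r))).trans (card_biUnion_le_card_mul _ _ _ fun y hy => ?_)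
    have := hlt y hy
    omega
  have h2 : 0 < X.card := card_pos.2 ⟨v, hv⟩
  obtain ⟨D, rfl⟩ : ∃ D', D = D' + 1 := ⟨D - 1, by omega⟩
  simp only [Nat.add_sub_cancel] at h1
  nlinarith

end Expansion

section Greedy
open scoped Classical
open Finset

theorem exists_robust_length {V : Type*} {P : ℕ → Finset V → Prop} {Pr : Finset V} {L w : ℕ}
    (hP : ∀ ℓ W W', W ⊆ W' → P ℓ W' → P ℓ W)
    (h : ∀ W : Finset V, Disjoint W Pr → W.card ≤ (L + 1) * w → ∃ ℓ ≤ L, P ℓ W) :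
    ∃ ℓ ≤ L, ∀ W : Finset V, Disjoint W Pr → W.card ≤ w → P ℓ W := by
  by_contra! hcon
  choose! W hW using hcon
  obtain ⟨ℓ, hℓ, hp⟩ := h ((range (L + 1)).biUnion W) (by
    rw [disjoint_biUnion_left]
    intro i hi
    exact (hW i (by rw [mem_range] at hi; omega)).1) (by
    calc _ ≤ (range (L + 1)).card * w := card_biUnion_le_card_mul _ _ _ (fun i hi =>
          (hW i (by rw [mem_range] at hi; omega)).2.1)
      _ = _ := by rw [card_range])
  exact (hW ℓ hℓ).2.2 (hP _ _ _ (subset_biUnion_of_mem W (mem_range.2 (by omega))) hp)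

theorem exists_no_rare_pair {α β : Type*} (Y : Finset β) (H : Finset α) (T : β → Finset α) {θ : ℕ}
    (hT : ∀ y ∈ Y, T y ⊆ H) (hY : H.card ^ 2 * θ < Y.card) :
    ∃ y ∈ Y, ∀ h ∈ T y, ∀ h' ∈ T y,
      θ ≤ (Y.filter fun y' => h ∈ T y' ∧ h' ∈ T y').card := by
  by_contra! hcon
  have : Y ⊆ ((H ×ˢ H).filter fun p => (Y.filter fun y' => p.1 ∈ T y' ∧ p.2 ∈ T y').card < θ).biUnion
      fun p => Y.filter fun y' => p.1 ∈ T y' ∧ p.2 ∈ T y' := by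
    intro y hy
    obtain ⟨h, hh, h', hh', hlt⟩ := hcon y hy
    simp only [mem_biUnion, mem_filter, mem_product]
    exact ⟨(h, h'), ⟨⟨hT y hy hh, hT y hy hh'⟩, hlt⟩, hy, hh, hh'⟩
  have h2 := card_le_card this
  have h3 : (((H ×ˢ H).filter fun p => (Y.filter fun y' => p.1 ∈ T y' ∧ p.2 ∈ T y').card
      < θ).biUnion fun p => Y.filter fun y' => p.1 ∈ T y' ∧ p.2 ∈ T y').card ≤
      ((H ×ˢ H).filter fun p => (Y.filter fun y' => p.1 ∈ T y' ∧ p.2 ∈ T y').card < θ).card * θ :=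
    card_biUnion_le_card_mul _ _ _ fun p hp => (mem_filter.1 hp).2.le
  have h4 := card_filter_le (H ×ˢ H) fun p => (Y.filter fun y' => p.1 ∈ T y' ∧ p.2 ∈ T y').card < θ
  rw [card_product] at h4
  nlinarith

/-- A popular value of a function with few values. -/
theorem exists_popular {α : Type*} (s : Finset α) (f : α → ℕ) {L m : ℕ} (hf : ∀ a ∈ s, f a ≤ L)
    (h : (L + 1) * m ≤ s.card) : ∃ ℓ ≤ L, m ≤ (s.filter fun a => f a = ℓ).card := by
  obtain ⟨ℓ, hℓ, hm⟩ := exists_le_card_fiber_of_mul_le_card_of_maps_to (s := s)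
    (t := range (L + 1)) (f := f) (n := m) (fun a ha => mem_range.2 (Nat.lt_succ_of_le (hf a ha)))
    ⟨0, by simp⟩ (by simpa using h)
  exact ⟨ℓ, by rw [mem_range] at hℓ; omega, hm⟩

variable {V : Type*} {G : SimpleGraph V}

theorem contains_of_paths {k ℓ : ℕ} (c : Fin k → V) (hc : Function.Injective c)
    (S : Fin k × Fin k → Finset V)
    (h1 : ∀ p : Fin k × Fin k, p.1 < p.2 → PathIn G (S p : Set V) (c p.1) (c p.2) ℓ)
    (h2 : ∀ p : Fin k × Fin k, p.1 < p.2 → ∀ q, c q ∈ S p → q = p.1 ∨ q = p.2)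
    (h3 : ∀ p p' : Fin k × Fin k, p.1 < p.2 → p'.1 < p'.2 → p ≠ p' → ∀ x ∈ S p, x ∈ S p' →
      (x = c p.1 ∨ x = c p.2)) : ContainsBalSub G k ℓ := by
  choose P hP using h1
  refine ⟨c, hc, fun i j h => P (i, j) h, fun i j h => ⟨(hP (i, j) h).1, (hP (i, j) h).2.1⟩, ?_, ?_⟩
  · intro i j h q hq
    exact h2 (i, j) h q ((hP (i, j) h).2.2 _ hq)
  · intro i j h i' j' h' hne x hx hx'
    have e := (hP (i, j) h).2.2 _ hx
    have e' := (hP (i', j') h').2.2 _ hx'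
    exact ⟨h3 (i, j) (i', j') h h' hne x e e', h3 (i', j') (i, j) h' h hne.symm x e' e⟩

theorem greedy {k ℓ : ℕ} (c : Fin k → V) (hc : Function.Injective c)
    (Inv : Finset (Fin k × Fin k) → Finset V → Prop) (U₀ : Finset V) (h0 : Inv ∅ U₀)
    (step : ∀ D U, Inv D U → ∀ p : Fin k × Fin k, p.1 < p.2 → p ∉ D →
      ∃ S : Finset V, PathIn G (S : Set V) (c p.1) (c p.2) ℓ ∧
        (∀ x ∈ S, x = c p.1 ∨ x = c p.2 ∨ (x ∉ U ∧ ∀ q, x ≠ c q)) ∧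
        ∃ U', U ⊆ U' ∧ S ⊆ U' ∧ Inv (insert p D) U') : ContainsBalSub G k ℓ := by
  have key : ∀ D : Finset (Fin k × Fin k), (∀ p ∈ D, p.1 < p.2) →
      ∃ (U : Finset V) (S : Fin k × Fin k → Finset V), Inv D U ∧ ∀ p ∈ D,
        PathIn G (S p : Set V) (c p.1) (c p.2) ℓ ∧ S p ⊆ U ∧
        (∀ q, c q ∈ S p → q = p.1 ∨ q = p.2) ∧
        ∀ p' ∈ D, p ≠ p' → ∀ x ∈ S p, x ∈ S p' → (x = c p.1 ∨ x = c p.2) := by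
    intro D
    induction D using Finset.induction_on with
    | empty => exact fun _ => ⟨U₀, fun _ => ∅, h0, by simp⟩
    | insert p D hp ih =>
      intro hD
      obtain ⟨U, S, hI, hS⟩ := ih fun q hq => hD q (mem_insert_of_mem hq)
      obtain ⟨T, hT1, hT2, U', hUU', hTU', hI'⟩ := step D U hI p (hD p (mem_insert_self _ _)) hp
      have hcore : ∀ q, c q ∈ T → q = p.1 ∨ q = p.2 := by
        intro q hq
        rcases hT2 _ hq with h | h | h
        · exact Or.inl (hc h)
        · exact Or.inr (hc h)
        · exact absurd rfl (h.2 q)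
      have hne : ∀ q ∈ D, q ≠ p := fun q hq h => hp (h ▸ hq)
      refine ⟨U', Function.update S p T, hI', fun q hq => ?_⟩
      rcases eq_or_ne q p with rfl | hqp
      · rw [Function.update_self]
        refine ⟨hT1, hTU', hcore, fun p' hp' hpp' x hx hx' => ?_⟩
        have hp'D : p' ∈ D := (mem_insert.1 hp').resolve_left (Ne.symm hpp')
        rw [Function.update_of_ne (hne p' hp'D)] at hx'
        rcases hT2 _ hx with h | h | h
        · exact Or.inl h
        · exact Or.inr h
        · exact absurd ((hS p' hp'D).2.1 hx') h.1
      · have hqD : q ∈ D := (mem_insert.1 hq).resolve_left hqp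
        rw [Function.update_of_ne hqp]
        obtain ⟨a1, a2, a3, a4⟩ := hS q hqD
        refine ⟨a1, a2.trans hUU', a3, fun p' hp' hpp' x hx hx' => ?_⟩
        rcases eq_or_ne p' p with rfl | hp'p
        · rw [Function.update_self] at hx'
          rcases hT2 _ hx' with h | h | h
          · rw [h] at hx ⊢
            rcases a3 _ hx with h | h <;> simp [h]
          · rw [h] at hx ⊢
            rcases a3 _ hx with h | h <;> simp [h]
          · exact absurd (a2 hx) h.1
        · rw [Function.update_of_ne hp'p] at hx'
          exact a4 p' ((mem_insert.1 hp').resolve_left hp'p) hpp' x hx hx'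
  obtain ⟨U, S, -, hS⟩ := key (univ.filter fun p => p.1 < p.2) (by simp)
  have hS' : ∀ p : Fin k × Fin k, p.1 < p.2 → _ := fun p hp => hS p (by simpa using hp)
  exact contains_of_paths c hc S (fun p hp => (hS' p hp).1) (fun p hp => (hS' p hp).2.2.1)
    (fun p p' hp hp' => (hS' p hp).2.2.2 p' (by simpa using hp'))

theorem robust_sub {k ℓ w : ℕ} {U : Finset V} (hU : k ≤ U.card) (hw : k + k ^ 2 * (ℓ + 1) ≤ w)
    (h : ∀ a ∈ U, ∀ b ∈ U, a ≠ b → ∀ W : Finset V, a ∉ W → b ∉ W → W.card ≤ w →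
      PathIn G {x | x ∉ W} a b ℓ) : ContainsBalSub G k ℓ := by
  obtain ⟨U, hUU, rfl⟩ := exists_subset_card_eq hU
  let c : Fin U.card → V := fun i => (U.equivFin.symm i : V)
  have hc : Function.Injective c := Subtype.val_injective.comp (Equiv.injective _)
  have hcU : ∀ i, c i ∈ U := fun i => (U.equivFin.symm i).2
  refine greedy c hc (fun D W => W.card ≤ D.card * (ℓ + 1)) ∅ (by simp) ?_
  intro D W hW p hp hpD
  have hD : D.card ≤ U.card ^ 2 := by
    have := card_le_univ D
    simpa [sq] using this
  have hcard : ((W ∪ U) \ {c p.1, c p.2}).card ≤ w := by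
    have h1 := card_le_card (sdiff_subset : (W ∪ U) \ {c p.1, c p.2} ⊆ W ∪ U)
    have h2 := card_union_le W U
    have h3 := Nat.mul_le_mul_right (ℓ + 1) hD
    omega
  have := h _ (hUU (hcU p.1)) _ (hUU (hcU p.2)) (fun e => hp.ne (hc e))
    ((W ∪ U) \ {c p.1, c p.2}) (by simp) (by simp) hcard
  obtain ⟨S, hS, hScard, hP⟩ := this.exists_finset
  refine ⟨S, hP, fun x hx => ?_, W ∪ S, subset_union_left, subset_union_right, ?_⟩
  · have := hS (mem_coe.2 hx)
    simp only [Set.mem_ofPred_eq, mem_sdiff, mem_union, mem_insert, mem_singleton, not_and,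
      not_not] at this
    by_cases hx' : x ∈ W ∨ x ∈ U
    · rcases this hx' with h | h
      · exact Or.inl h
      · exact Or.inr (Or.inl h)
    · rw [not_or] at hx'
      exact Or.inr (Or.inr ⟨hx'.1, fun q hq => hx'.2 (hq ▸ hcU q)⟩)
  · show (W ∪ S).card ≤ _
    rw [card_insert_of_notMem hpD]
    have := card_union_le W S
    linarith [add_mul D.card 1 (ℓ + 1)]

end Greedy

section HighDegree
open scoped Classical
open Finset

variable {V : Type*} [Fintype V] {G : SimpleGraph V} {d Kc : ℕ}

theorem robust_high_degree (hG : Good G d Kc) {E B : ℕ} (hn : Fintype.card V ≤ 2 ^ E)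
    (hB : 16 * E ^ 3 + 16 ≤ B) (hd : d ≤ B) {h y : V}
    (hh : B ^ 7 ≤ (nb G {h}).card) (hy : B ^ 7 ≤ (nb G {y}).card) :
    ∃ ℓ ≤ 4 * E ^ 3 + 2, ∀ W : Finset V, Disjoint W {h, y} → W.card ≤ B ^ 5 →
      PathIn G {x | x ∉ W} h y ℓ := by
  refine exists_robust_length (P := fun ℓ W => PathIn G {x | x ∉ W} h y ℓ) ?_ ?_
  · intro ℓ W W' hW hp
    exact hp.mono fun x hx hxW => hx (hW hxW)
  intro W hW hWc
  have hE : E ^ 2 ≤ E ^ 3 := by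
    rcases Nat.eq_zero_or_pos E with rfl | h
    · simp
    · exact Nat.pow_le_pow_right h (by norm_num)
  have hB1 : 16 ≤ B := by omega
  have hhW : h ∉ W := fun hx => disjoint_left.1 hW hx (by simp)
  have hyW : y ∉ W := fun hx => disjoint_left.1 hW hx (by simp)
  set W' := W ∪ {h, y} with hW'
  have hW'c : W'.card ≤ B ^ 6 := by
    have h1 : W'.card ≤ _ := card_union_le W {h, y}
    have h2 := card_le_two (a := h) (b := y)
    have h3 : (4 * E ^ 3 + 2 + 1) * B ^ 5 ≤ (B - 1) * B ^ 5 := Nat.mul_le_mul_right _ (by omega)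
    have h4 : 2 ≤ B ^ 5 := by
      calc 2 ≤ B := by omega
        _ = B ^ 1 := (pow_one B).symm
        _ ≤ B ^ 5 := Nat.pow_le_pow_right (by omega) (by norm_num)
    have h5 : (B - 1) * B ^ 5 + B ^ 5 = B ^ 6 := by
      obtain ⟨C, rfl⟩ : ∃ C, B = C + 1 := ⟨B - 1, by omega⟩
      simp only [Nat.add_sub_cancel]; ring
    omega
  have hB7 : B ^ 7 = B * B ^ 6 := by ring
  have big : ∀ z, B ^ 7 ≤ (nb G {z}).card → d ≤ 2 * (nb G {z} \ W').card ∧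
      2 * E ^ 2 * W'.card ≤ (nb G {z} \ W').card := by
    intro z hz
    have h1 := le_card_sdiff W' (nb G {z})
    have h2 : 2 * E ^ 2 * W'.card ≤ (2 * E ^ 2) * B ^ 6 := Nat.mul_le_mul_left _ hW'c
    have h3 : (2 * E ^ 2 + 2) * B ^ 6 ≤ B * B ^ 6 := Nat.mul_le_mul_right _ (by omega)
    have h4 : B ≤ B ^ 6 := by
      calc B = B ^ 1 := by simp
        _ ≤ _ := Nat.pow_le_pow_right (by omega) (by norm_num)
    rw [add_mul] at h3
    constructor <;> omega
  obtain ⟨a, ha, b, hb, hr⟩ := conn_sets hG hn (big h hh).1 (big h hh).2 (big y hy).1 (big y hy).2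
  rw [mem_sdiff, mem_nb] at ha hb
  obtain ⟨⟨-, h0, hh0, hadj⟩, haW⟩ := ha
  obtain ⟨⟨-, y0, hy0, hadj'⟩, hbW⟩ := hb
  rw [mem_singleton] at hh0 hy0
  subst hh0 hy0
  have hsub : ∀ x, x ∉ W' → x ∉ W := fun x hx hxW => hx (mem_union_left _ hxW)
  have hr' : Reach G {x | x ∉ W} a b (4 * E ^ 3) := hr.mono (by
    rintro x (rfl | rfl | hx)
    exacts [hsub _ haW, hsub _ hbW, hsub _ hx]) le_rfl
  have := ((Reach.of_adj (S := {x | x ∉ W}) hadj hhW hr'.left_mem).trans hr').trans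
    (Reach.of_adj (S := {x | x ∉ W}) hadj'.symm hr'.right_mem hyW)
  obtain ⟨ℓ, hℓ, hp⟩ := this.exists_pathIn
  exact ⟨ℓ, by omega, hp⟩

/-- Many vertices of large degree yield a balanced subdivision. -/
theorem balSub_of_high_degree (hG : Good G d Kc) {E B k : ℕ} (hn : Fintype.card V ≤ 2 ^ E)
    (hB : 16 * E ^ 3 + 16 ≤ B) (hd : d ≤ B) (hk : k ≤ B) (H : Finset V)
    (hH : ∀ v ∈ H, B ^ 7 ≤ (nb G {v}).card) (hHc : B ^ 13 ≤ H.card) :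
    ∃ ℓ, ContainsBalSub G k ℓ := by
  have hB1 : 16 ≤ B := by omega
  have hpow : ∀ i j, i < j → 16 * B ^ i ≤ B ^ j := by
    intro i j hij
    calc 16 * B ^ i ≤ B * B ^ i := Nat.mul_le_mul_right _ hB1
      _ = B ^ (i + 1) := by ring
      _ ≤ _ := Nat.pow_le_pow_right (by omega) hij
  have hpos : ∀ i, 0 < B ^ i := fun i => by positivity
  obtain ⟨H₀, hH₀, hH₀c⟩ := exists_subset_card_eq
    (show B ^ 2 ≤ H.card by have := hpow 2 13 (by norm_num); omega)
  obtain ⟨Y, hY, hYc⟩ := exists_subset_card_eq (s := H \ H₀) (n := B ^ 11) (by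
    have := le_card_sdiff H₀ H
    have := hpow 11 13 (by norm_num)
    have := hpow 2 11 (by norm_num)
    omega)
  have hdis : ∀ h ∈ H₀, ∀ y ∈ Y, h ≠ y := fun h hh y hy e => (mem_sdiff.1 (hY hy)).2 (e ▸ hh)
  have hrob : ∀ h ∈ H₀, ∀ y ∈ Y, ∃ ℓ ≤ 4 * E ^ 3 + 2, ∀ W : Finset V, Disjoint W {h, y} →
      W.card ≤ B ^ 5 → PathIn G {x | x ∉ W} h y ℓ := fun h hh y hy =>
    robust_high_degree hG hn hB hd (hH _ (hH₀ hh)) (hH _ (mem_sdiff.1 (hY hy)).1)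
  choose! ℓ hℓ hrob using hrob
  have hL : 4 * E ^ 3 + 2 + 1 ≤ B := by omega
  have hpop : ∀ y ∈ Y, ∃ m ≤ 4 * E ^ 3 + 2, B ≤ (H₀.filter fun h => ℓ h y = m).card := by
    intro y hy
    refine exists_popular H₀ (fun h => ℓ h y) (fun h hh => hℓ h hh y hy) ?_
    rw [hH₀c, sq]
    exact Nat.mul_le_mul_right _ hL
  choose! m hm hmc using hpop
  obtain ⟨M, hM, hMc⟩ := exists_popular Y m (m := B ^ 10) hm (by
    rw [hYc]
    calc _ ≤ B * B ^ 10 := Nat.mul_le_mul_right _ hL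
      _ = _ := by ring)
  obtain ⟨y, hy, hrare⟩ := exists_no_rare_pair (Y.filter fun y => m y = M) H₀
    (fun y => H₀.filter fun h => ℓ h y = m y) (θ := B ^ 5) (fun y _ => filter_subset _ _) (by
      rw [hH₀c]
      calc _ = B ^ 9 := by ring
        _ < 16 * B ^ 9 := by have := hpos 9; omega
        _ ≤ B ^ 10 := hpow 9 10 (by norm_num)
        _ ≤ _ := hMc)
  refine ⟨M + M, robust_sub (w := B ^ 4) (hk.trans (hmc y (mem_filter.1 hy).1)) ?_ ?_⟩
  · have h1 : k ^ 2 ≤ B ^ 2 := Nat.pow_le_pow_left hk 2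
    have h2 : k ^ 2 * (M + M + 1) ≤ B ^ 2 * B := Nat.mul_le_mul h1 (by omega)
    have h3 : B ^ 2 * B = B ^ 3 := by ring
    have h4 := hpow 3 4 (by norm_num)
    have h5 := hpow 1 3 (by norm_num)
    rw [pow_one] at h5
    omega
  · intro a ha b hb hab W haW hbW hW
    have hcount := hrare a ha b hb
    obtain ⟨z, hz, hzW⟩ : ∃ z ∈ ((Y.filter fun y => m y = M).filter fun y' =>
        a ∈ (H₀.filter fun h => ℓ h y' = m y') ∧ b ∈ (H₀.filter fun h => ℓ h y' = m y')), z ∉ W :=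
      exists_mem_notMem_of_card_lt_card (by
        have := hpow 4 5 (by norm_num)
        have := hpos 4
        omega)
    simp only [mem_filter] at hz
    obtain ⟨⟨hzY, hzM⟩, ⟨haH, haz⟩, hbH, hbz⟩ := hz
    have hr1 := hrob a haH z hzY
    have hr2 := hrob b hbH z hzY
    rw [haz, hzM] at hr1
    rw [hbz, hzM] at hr2
    have hpow45 := hpow 4 5 (by norm_num)
    have hpow14 := hpow 1 4 (by norm_num)
    rw [pow_one] at hpow14
    have hbz' : b ≠ z := hdis b hbH z hzY
    have haz' : a ≠ z := hdis a haH z hzY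
    have p1 := hr1 (insert b W) (by
      rw [disjoint_left]; intro x hx
      simp only [mem_insert, mem_singleton] at hx ⊢
      rintro (rfl | rfl)
      · exact hx.elim hab haW
      · exact hx.elim (fun e => hbz' e.symm) hzW) (by
      have := card_insert_le b W
      omega)
    obtain ⟨P, hPs, hPc, p1⟩ := p1.exists_finset
    have hbP : b ∉ P := fun h => hPs (mem_coe.2 h) (mem_insert_self _ _)
    have p2 := hr2 ((W ∪ P) \ {z}) (by
      rw [disjoint_left]; intro x hx
      simp only [mem_insert, mem_singleton, mem_sdiff, mem_union] at hx ⊢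
      rintro (rfl | rfl)
      · exact hx.1.elim hbW hbP
      · exact hx.2 rfl) (by
      have h1 := card_le_card (sdiff_subset : (W ∪ P) \ {z} ⊆ W ∪ P)
      have h2 := card_union_le W P
      omega)
    refine (p1.append p2.symm ?_).mono ?_
    · intro x hx hx'
      by_contra hxz
      exact hx' (mem_sdiff.2 ⟨mem_union_right _ hx, by simpa using hxz⟩)
    · rintro x (hx | hx)
      · exact fun hxW => hPs hx (mem_insert_of_mem hxW)
      · intro hxW
        refine hx (mem_sdiff.2 ⟨mem_union_left _ hxW, ?_⟩)
        rw [mem_singleton]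
        rintro rfl
        exact hzW hxW

end HighDegree

section Poles
open scoped Classical
open Finset

variable {V : Type*} [Fintype V] {G : SimpleGraph V} {d Kc : ℕ}

/-- `F` is a connected set with at least `D` and at most `D (r + 1)` vertices, all within distance
`r` of `y` inside `F`. -/
structure Pole (G : SimpleGraph V) (y : V) (F : Finset V) (D r : ℕ) : Prop where
  mem : y ∈ F
  le_card : D ≤ F.card
  card_le : F.card ≤ D * (r + 1)
  reach : ∀ f ∈ F, Reach G (F : Set V) y f r

omit [Fintype V] in
theorem exists_pole_subset {S : Finset V} {y : V} {D r : ℕ} (hD : 0 < D) (hS : D ≤ S.card)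
    (hr : ∀ v ∈ S, Reach G (S : Set V) y v r) : ∃ F ⊆ S, Pole G y F D r := by
  have : ∀ v ∈ S, ∃ P : Finset V, P ⊆ S ∧ P.card ≤ r + 1 ∧ y ∈ P ∧ v ∈ P ∧
      ∀ x ∈ P, Reach G (P : Set V) y x r := by
    intro v hv
    obtain ⟨p, hp, hs⟩ := hr v hv
    refine ⟨p.support.toFinset, fun x hx => hs x (by simpa using hx), ?_, by simp, by simp, ?_⟩
    · refine (List.toFinset_card_le _).trans ?_
      rw [SimpleGraph.Walk.length_support]; omega
    · intro x hx
      have hx' : x ∈ p.support := by simpa using hx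
      refine ⟨p.takeUntil x hx', (p.length_takeUntil_le_length hx').trans hp, fun z hz => ?_⟩
      have := p.support_takeUntil_subset_support hx' hz
      simpa using this
  choose! P hPS hPc hy hv hPr using this
  obtain ⟨S', hS', hS'c⟩ := exists_subset_card_eq hS
  have hsub : ∀ v ∈ S', P v ⊆ S'.biUnion P := fun v hv => subset_biUnion_of_mem P hv
  refine ⟨S'.biUnion P, biUnion_subset.2 fun v hv => hPS v (hS' hv), ?_, ?_, ?_, ?_⟩
  · obtain ⟨v, hv'⟩ : S'.Nonempty := card_pos.1 (by omega)
    exact hsub v hv' (hy v (hS' hv'))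
  · rw [← hS'c]
    exact card_le_card fun v hv' => hsub v hv' (hv v (hS' hv'))
  · rw [← hS'c]
    exact card_biUnion_le_card_mul _ _ _ fun v hv' => hPc v (hS' hv')
  · intro f hf
    obtain ⟨v, hv', hfv⟩ := mem_biUnion.1 hf
    exact (hPr v (hS' hv') f hfv).mono (fun x hx => mem_coe.2 (hsub v hv' (mem_coe.1 hx))) le_rfl

theorem exists_ball_pole {W : Finset V} {v : V} {D r : ℕ} (hD : 0 < D) (hv : v ∉ W)
    (h : D ≤ (ball G W {v} r).card) : ∃ F, Disjoint F W ∧ Pole G v F D r := by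
  obtain ⟨F, hF, hp⟩ := exists_pole_subset (G := G) (y := v) hD h fun x hx => ball_reach_singleton hx
  refine ⟨F, disjoint_left.2 fun x hx hxW => ?_, hp⟩
  rcases ball_avoid (hF hx) with rfl | hx'
  · exact hv hxW
  · exact hx' hxW

theorem exists_exit_pole {W X : Finset V} {v : V} {D r : ℕ} (hD : 0 < D) (hv : v ∈ X)
    (hX : Disjoint X W) (h : D * X.card ≤ (ball G W {v} r).card) :
    ∃ y ∈ X, ∃ F, Disjoint F W ∧ (∀ x ∈ X, x ∈ F → x = y) ∧ Pole G y F D r := by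
  obtain ⟨y, hy, hDy⟩ := exists_exit hv hD h
  obtain ⟨F, hF, hp⟩ := exists_pole_subset (G := G) (y := y) hD hDy
    fun x hx => ball_reach_singleton hx
  refine ⟨y, hy, F, disjoint_left.2 fun x hx hxW => ?_, fun x hxX hxF => ?_, hp⟩
  · rcases ball_avoid (hF hx) with rfl | hx'
    · exact disjoint_left.1 hX hy hxW
    · exact hx' (mem_union_left _ hxW)
  · rcases ball_avoid (hF hxF) with rfl | hx'
    · rfl
    · exact absurd (mem_union_right _ hxX) hx'

omit [Fintype V] in
theorem exists_disjoint_family {α : Type*} (P : α → Prop) (zone : α → Finset V) {N M : ℕ}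
    (W₀ : Finset V) (hne : ∀ a, P a → (zone a).Nonempty) (hM : ∀ a, P a → (zone a).card ≤ M)
    (h : ∀ W : Finset V, W₀ ⊆ W → W.card ≤ W₀.card + N * M → ∃ a, P a ∧ Disjoint (zone a) W) :
    ∃ A : Finset α, A.card = N ∧ (∀ a ∈ A, P a ∧ Disjoint (zone a) W₀) ∧
      ∀ a ∈ A, ∀ b ∈ A, a ≠ b → Disjoint (zone a) (zone b) := by
  suffices ∀ j ≤ N, ∃ A : Finset α, A.card = j ∧ (∀ a ∈ A, P a ∧ Disjoint (zone a) W₀) ∧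
      ∀ a ∈ A, ∀ b ∈ A, a ≠ b → Disjoint (zone a) (zone b) from this N le_rfl
  intro j
  induction j with
  | zero => exact fun _ => ⟨∅, by simp⟩
  | succ j ih =>
    intro hj
    obtain ⟨A, hA, hP, hd⟩ := ih (by omega)
    obtain ⟨a, ha, hdis⟩ := h (W₀ ∪ A.biUnion zone) subset_union_left (by
      have h1 := card_union_le W₀ (A.biUnion zone)
      have h2 : (A.biUnion zone).card ≤ A.card * M :=
        card_biUnion_le_card_mul _ _ _ fun a ha => hM a (hP a ha).1
      have h3 : A.card * M ≤ N * M := Nat.mul_le_mul_right _ (by omega)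
      omega)
    rw [disjoint_union_right, disjoint_biUnion_right] at hdis
    have haA : a ∉ A := fun h => by
      have := hdis.2 a h
      rw [disjoint_self] at this
      exact (hne a ha).ne_empty this
    refine ⟨insert a A, by rw [card_insert_of_notMem haA, hA], ?_, ?_⟩
    · intro b hb
      rcases mem_insert.1 hb with rfl | hb
      · exact ⟨ha, hdis.1⟩
      · exact hP b hb
    · intro b hb c hc hbc
      rcases mem_insert.1 hb with hb' | hb' <;> rcases mem_insert.1 hc with hc' | hc'
      · exact absurd (hb'.trans hc'.symm) hbc
      · exact hb' ▸ hdis.2 c hc'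
      · exact hc' ▸ (hdis.2 b hb').symm
      · exact hd b hb' c hc' hbc

omit [Fintype V] in
/-- Few members of a disjoint family meet a given set. -/
theorem exists_clean {α : Type*} {A : Finset α} {zone : α → Finset V}
    (hd : ∀ a ∈ A, ∀ b ∈ A, a ≠ b → Disjoint (zone a) (zone b)) {W : Finset V}
    (h : W.card < A.card) : ∃ a ∈ A, Disjoint (zone a) W := by
  by_contra! hcon
  have hf : ∀ a ∈ A, ∃ x ∈ zone a, x ∈ W := fun a ha => not_disjoint_iff.1 (hcon a ha)
  obtain ⟨a₀, ha₀⟩ : A.Nonempty := card_pos.1 (by omega)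
  have : Nonempty V := ⟨(hf a₀ ha₀).choose⟩
  choose! f hf hfW using hf
  have := card_le_card_of_injOn f (s := A) (t := W) hfW (by
    intro a ha b hb hab
    by_contra hne
    exact disjoint_left.1 (hd a ha b hb hne) (hf a ha) (hab ▸ hf b hb))
  omega

end Poles

section FailingSets
open scoped Classical
open Finset

variable {V : Type*} [Fintype V] {G : SimpleGraph V} {d Kc : ℕ}

/-- A connected set `X` of small radius with many neighbours in `H`. -/
structure Failing (G : SimpleGraph V) (H X : Finset V) (v : V) (ρ d κ : ℕ) : Prop where
  disj : Disjoint X H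
  mem : v ∈ X
  reach : ∀ x ∈ X, Reach G (X : Set V) v x ρ
  many : (2 * ρ + 1) * d ≤ κ * (nb G X ∩ H).card

structure Zone (V : Type*) where
  v : V
  X : Finset V
  F : Finset V
  S : Finset V
  len : ℕ

noncomputable def Zone.set (z : Zone V) : Finset V := z.X ∪ z.F

structure ZoneCore (G : SimpleGraph V) (H : Finset V) (B T : ℕ) (z : Zone V) : Prop where
  mem : z.v ∈ z.X
  disjX : Disjoint z.X H
  disjF : Disjoint z.F H
  only : ∀ x ∈ z.X, x ∈ z.F → x = z.v
  pole : Pole G z.v z.F (B ^ 21) T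

structure Hub (G : SimpleGraph V) (H : Finset V) (B T R k : ℕ) (z : Zone V) : Prop
    extends ZoneCore G H B T z where
  card_X : z.X.card ≤ B ^ 16
  card_S : k ≤ z.S.card
  S_sub : z.S ⊆ H
  path : ∀ h ∈ z.S, PathIn G (insert h (z.X : Set V)) h z.v z.len
  len_le : z.len ≤ 2 * R + 1

structure Port (G : SimpleGraph V) (H : Finset V) (B T : ℕ) (z : Zone V) : Prop
    extends ZoneCore G H B T z where
  card_X : z.X.card ≤ B ^ 19
  le_card : B ^ 18 ≤ z.X.card
  reachX : ∀ x ∈ z.X, Reach G (z.X : Set V) z.v x (2 * T)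

theorem robust_connect (hG : Good G d Kc) {E : ℕ} (hn : Fintype.card V ≤ 2 ^ E)
    {F F' Z : Finset V} {v v' : V} {r r' L w : ℕ} (hF : ∀ f ∈ F, Reach G (F : Set V) v f r)
    (hF' : ∀ f ∈ F', Reach G (F' : Set V) v' f r') (hZ : Disjoint Z (F ∪ F'))
    (hd : d ≤ 2 * F.card) (hd' : d ≤ 2 * F'.card)
    (hc : 2 * E ^ 2 * (Z.card + (L + 1) * w) ≤ F.card)
    (hc' : 2 * E ^ 2 * (Z.card + (L + 1) * w) ≤ F'.card) (hL : r + 4 * E ^ 3 + r' ≤ L) :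
    ∃ ℓ ≤ L, ∀ W : Finset V, Disjoint W (F ∪ F') → W.card ≤ w →
      PathIn G {x | x ∉ W ∧ x ∉ Z} v v' ℓ := by
  refine exists_robust_length (P := fun ℓ W => PathIn G {x | x ∉ W ∧ x ∉ Z} v v' ℓ) ?_ ?_
  · intro ℓ W W' hW hp
    exact hp.mono fun x hx => ⟨fun h => hx.1 (hW h), hx.2⟩
  intro W hW hWc
  have hcard : (W ∪ Z).card ≤ Z.card + (L + 1) * w := by
    have := card_union_le W Z
    omega
  have hm := Nat.mul_le_mul_left (2 * E ^ 2) hcard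
  obtain ⟨a, ha, b, hb, hr⟩ := conn_sets hG hn (W := W ∪ Z) hd (hm.trans hc) hd' (hm.trans hc')
  have hsub : ∀ x, x ∈ F ∪ F' → x ∉ W ∧ x ∉ Z := fun x hx =>
    ⟨fun h => disjoint_left.1 hW h hx, fun h => disjoint_left.1 hZ h hx⟩
  have h1 : Reach G {x | x ∉ W ∧ x ∉ Z} v a r := (hF a ha).mono
    (fun x hx => hsub x (mem_union_left _ (mem_coe.1 hx))) le_rfl
  have h2 : Reach G {x | x ∉ W ∧ x ∉ Z} v' b r' := (hF' b hb).mono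
    (fun x hx => hsub x (mem_union_right _ (mem_coe.1 hx))) le_rfl
  have h3 : Reach G {x | x ∉ W ∧ x ∉ Z} a b (4 * E ^ 3) := hr.mono (by
    rintro x (rfl | rfl | hx)
    · exact h1.right_mem
    · exact h2.right_mem
    · rw [mem_union, not_or] at hx; exact hx) le_rfl
  obtain ⟨ℓ, hℓ, hp⟩ := ((h1.trans h3).trans h2.symm).exists_pathIn
  exact ⟨ℓ, hℓ.trans hL, hp⟩

theorem exists_hub (hG : Good G d Kc) {E B R k κ : ℕ} (hn : Fintype.card V ≤ 2 ^ E)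
    (hB : 100 * E ^ 3 + 4 * R + 100 ≤ B) (hd : d ≤ B) (hk : κ * k ≤ d) (hκ : 0 < κ)
    (hnB : B ^ 123 ≤ Fintype.card V) {H : Finset V} {𝓕 : Finset (Finset V)}
    (h𝓕 : ∀ X ∈ 𝓕, X.card ≤ B ^ 16 ∧ ∃ v, ∃ ρ ≤ R, Failing G H X v ρ d κ)
    (hdis : ∀ X ∈ 𝓕, ∀ Y ∈ 𝓕, X ≠ Y → Disjoint X Y) (hcard : B ^ 62 ≤ 𝓕.card)
    {W : Finset V} (hHW : H ⊆ W) (hW : W.card ≤ B ^ 59) :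
    ∃ z : Zone V, Hub G H B (2 * E ^ 3) R k z ∧ Disjoint z.set W := by
  have hE : E ^ 2 ≤ E ^ 3 := by
    rcases Nat.eq_zero_or_pos E with rfl | h
    · simp
    · exact Nat.pow_le_pow_right h (by norm_num)
  have hpow : ∀ i j, i < j → 16 * B ^ i ≤ B ^ j := by
    intro i j hij
    calc 16 * B ^ i ≤ B * B ^ i := Nat.mul_le_mul_right _ (by omega)
      _ = B ^ (i + 1) := by ring
      _ ≤ _ := Nat.pow_le_pow_right (by omega) hij
  have hpos : ∀ i, 0 < B ^ i := fun i => Nat.pow_pos (by omega)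
  have hp1 := hpow 1 61 (by norm_num)
  rw [pow_one] at hp1
  have hbad := few_bad hG (W := W) (E := E) (D := B ^ 61) hn (by omega) (by
      calc 2 * E ^ 2 * W.card ≤ B * B ^ 59 := Nat.mul_le_mul (by omega) hW
        _ = B ^ 60 := by ring
        _ ≤ _ := Nat.pow_le_pow_right (by omega) (by norm_num)) (by
      calc 2 * (B ^ 61) ^ 2 = 2 * B ^ 122 := by ring
        _ ≤ 16 * B ^ 122 := Nat.mul_le_mul_right _ (by norm_num)
        _ ≤ _ := (hpow 122 123 (by norm_num)).trans hnB)
  obtain ⟨X, hX, hXW⟩ := exists_clean (zone := fun X : Finset V => X) hdis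
    (W := W ∪ univ.filter fun v => (ball G W {v} (2 * E ^ 3)).card < B ^ 61) (by
      have := card_union_le W (univ.filter fun v => (ball G W {v} (2 * E ^ 3)).card < B ^ 61)
      have := hpow 59 61 (by norm_num)
      have := hpow 61 62 (by norm_num)
      have := hpos 61
      omega)
  rw [disjoint_union_right] at hXW
  obtain ⟨hXc, v, ρ, hρ, hfail⟩ := h𝓕 X hX
  have hvgood : B ^ 61 ≤ (ball G W {v} (2 * E ^ 3)).card := by
    have := disjoint_left.1 hXW.2 hfail.mem
    simpa using this
  obtain ⟨y, hy, F, hFW, honly, hpole⟩ := exists_exit_pole (D := B ^ 21) (hpos 21) hfail.mem hXW.1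
    (le_trans (by
      calc B ^ 21 * X.card ≤ B ^ 21 * B ^ 16 := Nat.mul_le_mul_left _ hXc
        _ = B ^ 37 := by ring
        _ ≤ B ^ 61 := Nat.pow_le_pow_right (by omega) (by norm_num)) hvgood)
  have hpath : ∀ h ∈ nb G X ∩ H, ∃ ℓ ≤ 2 * ρ, PathIn G (insert h (X : Set V)) h y (ℓ + 1) := by
    intro h hh
    rw [mem_inter, mem_nb] at hh
    obtain ⟨⟨hhX, x, hx, hadj⟩, hhH⟩ := hh
    obtain ⟨ℓ, hℓ, hp⟩ := ((hfail.reach x hx).symm.trans (hfail.reach y hy)).exists_pathIn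
    refine ⟨ℓ, by omega, ?_⟩
    have := (PathIn.of_adj hadj.symm).append hp (by
      rintro z (rfl | rfl) hz
      · exact absurd hz hhX
      · rfl)
    rw [add_comm] at this
    refine this.mono ?_
    rintro z ((rfl | rfl) | hz)
    · exact Set.mem_insert _ _
    · exact Set.mem_insert_of_mem _ (mem_coe.2 hx)
    · exact Set.mem_insert_of_mem _ hz
  choose! f hf hfp using hpath
  obtain ⟨ℓ, hℓ, hm⟩ := exists_popular (nb G X ∩ H) f (m := k) hf (by
    have h1 := hfail.many
    have h2 : κ * ((2 * ρ + 1) * k) ≤ κ * (nb G X ∩ H).card := by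
      calc κ * ((2 * ρ + 1) * k) = (2 * ρ + 1) * (κ * k) := by ring
        _ ≤ (2 * ρ + 1) * d := Nat.mul_le_mul_left _ hk
        _ ≤ _ := h1
    exact le_of_mul_le_mul_left h2 hκ)
  refine ⟨⟨y, X, F, (nb G X ∩ H).filter fun h => f h = ℓ, ℓ + 1⟩, ?_, ?_⟩
  · exact
      { mem := hy
        disjX := hfail.disj
        disjF := disjoint_of_subset_right hHW hFW
        only := honly
        pole := hpole
        card_X := hXc
        card_S := hm
        S_sub := fun h hh => (mem_inter.1 (mem_filter.1 hh).1).2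
        path := fun h hh => (mem_filter.1 hh).2 ▸ hfp h (mem_filter.1 hh).1
        len_le := by show ℓ + 1 ≤ _; omega }
  · exact disjoint_union_left.2 ⟨hXW.1, hFW⟩

theorem exists_port (hG : Good G d Kc) {E B R : ℕ} (hn : Fintype.card V ≤ 2 ^ E)
    (hB : 100 * E ^ 3 + 4 * R + 100 ≤ B) (hd : d ≤ B)
    (hnB : B ^ 123 ≤ Fintype.card V) {H W : Finset V} (hHW : H ⊆ W) (hW : W.card ≤ B ^ 59) :
    ∃ z : Zone V, Port G H B (2 * E ^ 3) z ∧ Disjoint z.set W := by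
  have hE : E ^ 2 ≤ E ^ 3 := by
    rcases Nat.eq_zero_or_pos E with rfl | h
    · simp
    · exact Nat.pow_le_pow_right h (by norm_num)
  have hpow : ∀ i j, i < j → 16 * B ^ i ≤ B ^ j := by
    intro i j hij
    calc 16 * B ^ i ≤ B * B ^ i := Nat.mul_le_mul_right _ (by omega)
      _ = B ^ (i + 1) := by ring
      _ ≤ _ := Nat.pow_le_pow_right (by omega) hij
  have hpos : ∀ i, 0 < B ^ i := fun i => Nat.pow_pos (by omega)
  have hp1 := hpow 1 61 (by norm_num)
  rw [pow_one] at hp1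
  have hbad := few_bad hG (W := W) (E := E) (D := B ^ 61) hn (by omega) (by
      calc 2 * E ^ 2 * W.card ≤ B * B ^ 59 := Nat.mul_le_mul (by omega) hW
        _ = B ^ 60 := by ring
        _ ≤ _ := Nat.pow_le_pow_right (by omega) (by norm_num)) (by
      calc 2 * (B ^ 61) ^ 2 = 2 * B ^ 122 := by ring
        _ ≤ 16 * B ^ 122 := Nat.mul_le_mul_right _ (by norm_num)
        _ ≤ _ := (hpow 122 123 (by norm_num)).trans hnB)
  obtain ⟨v, -, hv⟩ := exists_mem_notMem_of_card_lt_card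
    (s := W ∪ univ.filter fun v => (ball G W {v} (2 * E ^ 3)).card < B ^ 61) (t := univ) (by
      have := card_union_le W (univ.filter fun v => (ball G W {v} (2 * E ^ 3)).card < B ^ 61)
      have := hpow 59 61 (by norm_num)
      have := hpow 61 123 (by norm_num)
      have := hpos 61
      rw [card_univ]
      omega)
  rw [mem_union, not_or] at hv
  have hvgood : B ^ 61 ≤ (ball G W {v} (2 * E ^ 3)).card := by simpa using hv.2
  obtain ⟨X, hXW, hXp⟩ := exists_ball_pole (D := B ^ 18) (hpos 18) hv.1
    ((Nat.pow_le_pow_right (by omega) (by norm_num)).trans hvgood)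
  have hXc : X.card ≤ B ^ 19 := hXp.card_le.trans (by
    calc B ^ 18 * (2 * E ^ 3 + 1) ≤ B ^ 18 * B := Nat.mul_le_mul_left _ (by omega)
      _ = B ^ 19 := by ring)
  obtain ⟨y, hy, F, hFW, honly, hpole⟩ := exists_exit_pole (D := B ^ 21) (hpos 21) hXp.mem hXW
    (le_trans (by
      calc B ^ 21 * X.card ≤ B ^ 21 * B ^ 19 := Nat.mul_le_mul_left _ hXc
        _ = B ^ 40 := by ring
        _ ≤ B ^ 61 := Nat.pow_le_pow_right (by omega) (by norm_num)) hvgood)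
  refine ⟨⟨y, X, F, ∅, 0⟩, ?_, ?_⟩
  · exact
      { mem := hy
        disjX := disjoint_of_subset_right hHW hXW
        disjF := disjoint_of_subset_right hHW hFW
        only := honly
        pole := hpole
        card_X := hXc
        le_card := hXp.le_card
        reachX := fun x hx => ((hXp.reach y hy).symm.trans (hXp.reach x hx)).mono
          subset_rfl (by omega) }
  · exact disjoint_union_left.2 ⟨hXW, hFW⟩

end FailingSets

section ManyFailing
open scoped Classical
open Finset

variable {V : Type*} [Fintype V] {G : SimpleGraph V} {d Kc : ℕ}

theorem hub_port_lengths (hG : Good G d Kc) {E B R k : ℕ} (hn : Fintype.card V ≤ 2 ^ E)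
    (hB : 100 * E ^ 3 + 4 * R + 100 ≤ B) (hd : d ≤ B) {H : Finset V} {z p : Zone V}
    (hz : Hub G H B (2 * E ^ 3) R k z) (hp : Port G H B (2 * E ^ 3) p)
    (hdis : Disjoint z.set p.set) :
    (∃ ℓ ≤ 10 * E ^ 3, ∀ W : Finset V, Disjoint W (z.F ∪ p.F) → W.card ≤ B ^ 5 →
      PathIn G {x | x ∉ W ∧ (x ∈ z.X → x = z.v) ∧ (x ∈ p.X → x = p.v)} z.v p.v ℓ) ∧
    (∃ ℓ ≤ 10 * E ^ 3, ∀ W : Finset V, Disjoint W (z.F ∪ p.X) → W.card ≤ B ^ 5 →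
      PathIn G {x | x ∉ W ∧ (x ∈ z.X → x = z.v)} z.v p.v ℓ) := by
  have hE : E ^ 2 ≤ E ^ 3 := by
    rcases Nat.eq_zero_or_pos E with rfl | h
    · simp
    · exact Nat.pow_le_pow_right h (by norm_num)
  have hpow : ∀ i j, i < j → 16 * B ^ i ≤ B ^ j := by
    intro i j hij
    calc 16 * B ^ i ≤ B * B ^ i := Nat.mul_le_mul_right _ (by omega)
      _ = B ^ (i + 1) := by ring
      _ ≤ _ := Nat.pow_le_pow_right (by omega) hij
  have hpos : ∀ i, 0 < B ^ i := fun i => Nat.pow_pos (by omega)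
  have hw : (10 * E ^ 3 + 1) * B ^ 5 ≤ B ^ 6 := by
    calc _ ≤ B * B ^ 5 := Nat.mul_le_mul_right _ (by omega)
      _ = B ^ 6 := by ring
  have hp16 := hpow 6 16 (by norm_num)
  have hp19 := hpow 6 19 (by norm_num)
  have hp1619 := hpow 16 19 (by norm_num)
  have h118 := hpow 1 18 (by norm_num)
  have h121 := hpow 1 21 (by norm_num)
  rw [pow_one] at h118 h121
  have hzF := hz.pole.le_card
  have hpF := hp.pole.le_card
  have hpX := hp.le_card
  have hzX := hz.card_X
  have hpX' := hp.card_X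
  rw [Zone.set, Zone.set, disjoint_union_left, disjoint_union_right, disjoint_union_right] at hdis
  obtain ⟨⟨dXX, dXF⟩, dFX, dFF⟩ := hdis
  constructor
  · have hZ : ((z.X \ {z.v}) ∪ (p.X \ {p.v})).card + (10 * E ^ 3 + 1) * B ^ 5 ≤ B ^ 20 := by
      have h1 := card_union_le (z.X \ {z.v}) (p.X \ {p.v})
      have h2 := card_le_card (sdiff_subset : z.X \ {z.v} ⊆ z.X)
      have h3 := card_le_card (sdiff_subset : p.X \ {p.v} ⊆ p.X)
      have h4 := hpow 19 20 (by norm_num)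
      omega
    have hZ' : 2 * E ^ 2 * (((z.X \ {z.v}) ∪ (p.X \ {p.v})).card + (10 * E ^ 3 + 1) * B ^ 5) ≤
        B ^ 21 := by
      calc _ ≤ B * B ^ 20 := Nat.mul_le_mul (by omega) hZ
        _ = _ := by ring
    obtain ⟨ℓ, hℓ, h⟩ := robust_connect hG hn (F := z.F) (F' := p.F)
      (Z := (z.X \ {z.v}) ∪ (p.X \ {p.v})) (L := 10 * E ^ 3) (w := B ^ 5) hz.pole.reach hp.pole.reach
      (by
        rw [disjoint_left]
        intro x hx hx'
        simp only [mem_union, mem_sdiff, mem_singleton] at hx hx'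
        rcases hx with ⟨hx, hxv⟩ | ⟨hx, hxv⟩ <;> rcases hx' with hx' | hx'
        · exact hxv (hz.only x hx hx')
        · exact disjoint_left.1 dXF hx hx'
        · exact disjoint_left.1 dFX hx' hx
        · exact hxv (hp.only x hx hx')) (by omega) (by omega) (hZ'.trans hzF) (hZ'.trans hpF)
      (by omega)
    refine ⟨ℓ, hℓ, fun W hW hWc => (h W hW hWc).mono ?_⟩
    rintro x ⟨hx, hx'⟩
    simp only [mem_union, mem_sdiff, mem_singleton, not_or, not_and, not_not] at hx'
    exact ⟨hx, hx'.1, hx'.2⟩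
  · have hZ : (z.X \ {z.v}).card + (10 * E ^ 3 + 1) * B ^ 5 ≤ B ^ 17 := by
      have h2 := card_le_card (sdiff_subset : z.X \ {z.v} ⊆ z.X)
      have h4 := hpow 16 17 (by norm_num)
      omega
    have hZ' : 2 * E ^ 2 * ((z.X \ {z.v}).card + (10 * E ^ 3 + 1) * B ^ 5) ≤ B ^ 18 := by
      calc _ ≤ B * B ^ 17 := Nat.mul_le_mul (by omega) hZ
        _ = _ := by ring
    have hp1821 := hpow 18 21 (by norm_num)
    obtain ⟨ℓ, hℓ, h⟩ := robust_connect hG hn (F := z.F) (F' := p.X)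
      (Z := z.X \ {z.v}) (L := 10 * E ^ 3) (w := B ^ 5) hz.pole.reach hp.reachX
      (by
        rw [disjoint_left]
        intro x hx hx'
        simp only [mem_union, mem_sdiff, mem_singleton] at hx hx'
        obtain ⟨hx, hxv⟩ := hx
        rcases hx' with hx' | hx'
        · exact hxv (hz.only x hx hx')
        · exact disjoint_left.1 dXX hx hx') (by omega) (by omega)
      (hZ'.trans (by omega)) (hZ'.trans hpX) (by omega)
    refine ⟨ℓ, hℓ, fun W hW hWc => (h W hW hWc).mono ?_⟩
    rintro x ⟨hx, hx'⟩
    simp only [mem_sdiff, mem_singleton, not_and, not_not] at hx'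
    exact ⟨hx, hx'⟩


omit [Fintype V] in
/-- The path through two hubs and a port. -/
theorem path_via_port {H : Finset V} {B T R k w : ℕ} {zi p : Zone V} {h h' : V} {W : Finset V}
    {len m₁ m₂ : ℕ}
    (hi : Hub G H B T R k zi) (hh : h ∈ zi.S) (hli : zi.len = len) (hp : Port G H B T p)
    (hne : h ≠ h') (hh'W : h' ∉ W) (hhW : h ∉ W) (hpW : Disjoint p.set W)
    (hiW : Disjoint zi.set W) (hip : Disjoint zi.set p.set) (hh'H : h' ∈ H)
    (hw : len + m₁ + W.card + 5 ≤ w)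
    (c₁ : ∀ W : Finset V, Disjoint W (zi.F ∪ p.F) → W.card ≤ w →
      PathIn G {x | x ∉ W ∧ (x ∈ zi.X → x = zi.v) ∧ (x ∈ p.X → x = p.v)} zi.v p.v m₁)
    (hj : ∀ U : Finset V, U.card ≤ w → ∃ zj, Hub G H B T R k zj ∧ h' ∈ zj.S ∧ zj.len = len ∧
      Disjoint zj.set U ∧ Disjoint zj.set p.set ∧
      (∀ W : Finset V, Disjoint W (zj.F ∪ p.X) → W.card ≤ w →
        PathIn G {x | x ∉ W ∧ (x ∈ zj.X → x = zj.v)} zj.v p.v m₂)) :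
    PathIn G {x | x ∉ W} h h' (len + m₁ + (m₂ + len)) := by
  have hhH : h ∈ H := hi.S_sub hh
  have nset : ∀ {z : Zone V}, ZoneCore G H B T z → ∀ x ∈ H, x ∉ z.X ∧ x ∉ z.F := fun hz x hx =>
    ⟨fun hx' => disjoint_left.1 hz.disjX hx' hx, fun hx' => disjoint_left.1 hz.disjF hx' hx⟩
  have hα := hi.path h hh
  rw [hli] at hα
  have hβ := c₁ (W ∪ {h, h'}) (by
    rw [disjoint_left]
    intro x hx hx'
    simp only [mem_union, mem_insert, mem_singleton] at hx hx'
    rcases hx with hx | rfl | rfl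
    · rcases hx' with hx' | hx'
      · exact disjoint_left.1 hiW (mem_union_right _ hx') hx
      · exact disjoint_left.1 hpW (mem_union_right _ hx') hx
    · exact hx'.elim (nset hi.toZoneCore _ hhH).2 (nset hp.toZoneCore _ hhH).2
    · exact hx'.elim (nset hi.toZoneCore _ hh'H).2 (nset hp.toZoneCore _ hh'H).2) (by
    have := card_union_le W {h, h'}
    have := card_le_two (a := h) (b := h')
    omega)
  have hαβ := hα.append hβ (by
    rintro x hx ⟨hx1, hx2, -⟩
    rcases hx with rfl | hx
    · exact absurd (mem_union_right _ (mem_insert_self _ _)) hx1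
    · exact hx2 hx)
  obtain ⟨P, hPs, hPc, hP⟩ := hαβ.exists_finset
  have hPW : ∀ x ∈ P, x ∉ W := by
    intro x hx hxW
    rcases hPs (mem_coe.2 hx) with (rfl | hx') | hx'
    · exact hhW hxW
    · exact disjoint_left.1 hiW (mem_union_left _ hx') hxW
    · exact hx'.1 (mem_union_left _ hxW)
  have hPh' : h' ∉ P := by
    intro hx
    rcases hPs (mem_coe.2 hx) with (hx' | hx') | hx'
    · exact hne hx'.symm
    · exact (nset hi.toZoneCore _ hh'H).1 hx'
    · exact hx'.1 (mem_union_right _ (by simp))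
  have hPX : ∀ x ∈ P, x ∈ p.X → x = p.v := by
    intro x hx hxp
    rcases hPs (mem_coe.2 hx) with (rfl | hx') | hx'
    · exact absurd hxp (nset hp.toZoneCore _ hhH).1
    · exact absurd (mem_union_left _ hxp) (disjoint_left.1 hip (mem_union_left _ hx'))
    · exact hx'.2.2 hxp
  obtain ⟨zj, hjh, hjS, hlj, hjU, hjp, c₂⟩ := hj (W ∪ P) (by
    have := card_union_le W P
    omega)
  rw [disjoint_union_right] at hjU
  have hγ := c₂ (insert h' (W ∪ (P \ {p.v}))) (by
    rw [disjoint_left]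
    intro x hx hx'
    simp only [mem_union, mem_insert, mem_singleton, mem_sdiff] at hx hx'
    rcases hx with rfl | hx | hx
    · exact hx'.elim (nset hjh.toZoneCore _ hh'H).2 (nset hp.toZoneCore _ hh'H).1
    · rcases hx' with hx' | hx'
      · exact disjoint_left.1 hjU.1 (mem_union_right _ hx') hx
      · exact disjoint_left.1 hpW (mem_union_left _ hx') hx
    · rcases hx' with hx' | hx'
      · exact disjoint_left.1 hjU.2 (mem_union_right _ hx') hx.1
      · exact hx.2 (hPX x hx.1 hx')) (by
    have h1 := card_insert_le h' (W ∪ (P \ {p.v}))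
    have h2 := card_union_le W (P \ {p.v})
    have h3 := card_le_card (sdiff_subset : P \ {p.v} ⊆ P)
    omega)
  have hδ := hjh.path h' hjS
  rw [hlj] at hδ
  have hγδ := hγ.symm.append hδ.symm (by
    rintro x ⟨hx1, hx2⟩ hx
    rcases hx with rfl | hx
    · exact absurd (mem_insert_self _ _) hx1
    · exact hx2 hx)
  refine (hP.append hγδ ?_).mono ?_
  · rintro x hx ((hx' | (hx' | hx')))
    · by_contra hxv
      refine hx'.1 (mem_insert_of_mem (mem_union_right _ (mem_sdiff.2 ⟨mem_coe.1 hx, ?_⟩)))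
      simpa using hxv
    · exact absurd (mem_coe.1 hx) (hx' ▸ hPh')
    · exact absurd (mem_coe.1 hx) (disjoint_left.1 hjU.2 (mem_union_left _ hx'))
  · rintro x (hx | (hx | (rfl | hx)))
    · exact hPW x hx
    · exact fun hxW => hx.1 (mem_insert_of_mem (mem_union_left _ hxW))
    · exact hh'W
    · exact fun hxW => disjoint_left.1 hjU.1 (mem_union_left _ hx) hxW

/-- Many disjoint failing sets yield a balanced subdivision. -/
theorem balSub_of_failing (hG : Good G d Kc) {E B R k κ : ℕ} (hn : Fintype.card V ≤ 2 ^ E)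
    (hB : 100 * E ^ 3 + 4 * R + 100 ≤ B) (hd : d ≤ B) (hk : κ * k ≤ d) (hκ : 0 < κ)
    (hnB : B ^ 123 ≤ Fintype.card V) {H : Finset V} (hH : H.card < B ^ 13)
    {𝓕 : Finset (Finset V)}
    (h𝓕 : ∀ X ∈ 𝓕, X.card ≤ B ^ 16 ∧ ∃ v, ∃ ρ ≤ R, Failing G H X v ρ d κ)
    (hdis : ∀ X ∈ 𝓕, ∀ Y ∈ 𝓕, X ≠ Y → Disjoint X Y) (hcard : B ^ 62 ≤ 𝓕.card) :
    ∃ ℓ, ContainsBalSub G k ℓ := by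
  have hpow : ∀ i j, i < j → 16 * B ^ i ≤ B ^ j := by
    intro i j hij
    calc 16 * B ^ i ≤ B * B ^ i := Nat.mul_le_mul_right _ (by omega)
      _ = B ^ (i + 1) := by ring
      _ ≤ _ := Nat.pow_le_pow_right (by omega) hij
  have hpos : ∀ i, 0 < B ^ i := fun i => Nat.pow_pos (by omega)
  have hpoleF : ∀ z : Zone V, ZoneCore G H B (2 * E ^ 3) z → z.X.card ≤ B ^ 19 →
      z.set.card ≤ B ^ 23 := by
    intro z hz hX
    have h1 : z.set.card ≤ _ := card_union_le z.X z.F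
    have h2 : z.F.card ≤ B ^ 21 * B := hz.pole.card_le.trans (Nat.mul_le_mul_left _ (by omega))
    have h3 : B ^ 21 * B = B ^ 22 := by ring
    have h4 := hpow 22 23 (by norm_num)
    have h5 := hpow 19 22 (by norm_num)
    omega
  have hne : ∀ z : Zone V, ZoneCore G H B (2 * E ^ 3) z → z.set.Nonempty := fun z hz =>
    ⟨z.v, mem_union_left _ hz.mem⟩
  obtain ⟨A, hAc, hA, hAd⟩ := exists_disjoint_family (Hub G H B (2 * E ^ 3) R k) Zone.set
    (N := B ^ 23) (M := B ^ 23) H (fun z hz => hne z hz.toZoneCore)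
    (fun z hz => hpoleF z hz.toZoneCore (hz.card_X.trans
      (Nat.pow_le_pow_right (by omega) (by norm_num)))) (fun W hHW hW => by
      refine exists_hub hG hn hB hd hk hκ hnB h𝓕 hdis hcard hHW (hW.trans ?_)
      have h1 : B ^ 23 * B ^ 23 = B ^ 46 := by ring
      have h2 := hpow 46 59 (by norm_num)
      have h3 := hpow 13 46 (by norm_num)
      omega)
  obtain ⟨len, hlen, hIc⟩ := exists_popular A Zone.len (m := B ^ 22) (L := 2 * R + 1)
    (fun z hz => (hA z hz).1.len_le) (by
      rw [hAc]
      calc _ ≤ B * B ^ 22 := Nat.mul_le_mul_right _ (by omega)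
        _ = _ := by ring)
  set I := A.filter fun z => z.len = len with hI
  have hIA : ∀ z ∈ I, z ∈ A := fun z hz => (mem_filter.1 hz).1
  have hzonesA : (A.biUnion Zone.set).card ≤ B ^ 46 := by
    calc _ ≤ A.card * B ^ 23 := card_biUnion_le_card_mul _ _ _ fun z hz =>
          hpoleF z (hA z hz).1.toZoneCore ((hA z hz).1.card_X.trans
            (Nat.pow_le_pow_right (by omega) (by norm_num)))
      _ = _ := by rw [hAc]; ring
  obtain ⟨Q, hQc, hQ, hQd⟩ := exists_disjoint_family (Port G H B (2 * E ^ 3)) Zone.set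
    (N := B ^ 35) (M := B ^ 23) (H ∪ A.biUnion Zone.set) (fun z hz => hne z hz.toZoneCore)
    (fun z hz => hpoleF z hz.toZoneCore hz.card_X) (fun W hHW hW => by
      refine exists_port (R := R) hG hn hB hd hnB (subset_union_left.trans hHW) (hW.trans ?_)
      have h1 : B ^ 35 * B ^ 23 = B ^ 58 := by ring
      have h2 := hpow 58 59 (by norm_num)
      have h3 := hpow 13 46 (by norm_num)
      have h4 := hpow 46 58 (by norm_num)
      have h5 := card_union_le H (A.biUnion Zone.set)
      omega)
  have hAQ : ∀ z ∈ A, ∀ p ∈ Q, Disjoint z.set p.set := by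
    intro z hz p hp
    have := (hQ p hp).2
    rw [disjoint_union_right, disjoint_biUnion_right] at this
    exact (this.2 z hz).symm
  have hcol := fun z hz p hp => hub_port_lengths hG hn hB hd (hA z hz).1 (hQ p hp).1 (hAQ z hz p hp)
  choose! c₁ c₂ using hcol
  choose! m₁ hm₁ c₁ using c₁
  choose! m₂ hm₂ c₂ using c₂
  have hcolours : (10 * E ^ 3 + 1) * (10 * E ^ 3 + 1) ≤ B ^ 2 := by
    rw [sq]; exact Nat.mul_le_mul (by omega) (by omega)
  have hpop : ∀ p ∈ Q, ∃ c ∈ range (10 * E ^ 3 + 1) ×ˢ range (10 * E ^ 3 + 1),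
      B ^ 20 ≤ (I.filter fun z => (m₁ z p, m₂ z p) = c).card := by
    intro p hp
    refine exists_le_card_fiber_of_mul_le_card_of_maps_to (fun z hz => ?_) ⟨(0, 0), by simp⟩ ?_
    · have := hm₁ z (hIA z hz) p hp
      have := hm₂ z (hIA z hz) p hp
      simp only [mem_product, mem_range]
      omega
    · rw [card_product, card_range]
      calc _ ≤ B ^ 2 * B ^ 20 := Nat.mul_le_mul_right _ hcolours
        _ = B ^ 22 := by ring
        _ ≤ _ := hIc
  choose! col hcolm hcolc using hpop
  obtain ⟨⟨M₁, M₂⟩, hM, hMc⟩ := exists_le_card_fiber_of_mul_le_card_of_maps_to (s := Q)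
    (t := range (10 * E ^ 3 + 1) ×ˢ range (10 * E ^ 3 + 1)) (f := col) (n := B ^ 33) hcolm
    ⟨(0, 0), by simp⟩ (by
      rw [card_product, card_range, hQc]
      calc _ ≤ B ^ 2 * B ^ 33 := Nat.mul_le_mul_right _ hcolours
        _ = _ := by ring)
  simp only [mem_product, mem_range] at hM
  let Vp : Zone V → Finset (Zone V) := fun p => I.filter fun z => (m₁ z p, m₂ z p) = col p
  let Tp : Zone V → Finset V := fun p => H.filter fun h =>
    B ^ 6 ≤ ((Vp p).filter fun z => h ∈ z.S).card
  have hTp : ∀ p ∈ Q, k ≤ (Tp p).card := by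
    intro p hp
    by_contra! hlt
    have hex : ∀ z ∈ Vp p, ∃ h ∈ H, h ∈ z.S ∧ ((Vp p).filter fun z => h ∈ z.S).card < B ^ 6 := by
      intro z hz
      have hzA := (hA z (hIA z (mem_filter.1 hz).1)).1
      obtain ⟨h, hh, hhT⟩ := exists_mem_notMem_of_card_lt_card (hlt.trans_le hzA.card_S)
      refine ⟨h, hzA.S_sub hh, hh, ?_⟩
      by_contra! hcon
      exact hhT (mem_filter.2 ⟨hzA.S_sub hh, hcon⟩)
    have hsub : Vp p ⊆ (H.filter fun h => ((Vp p).filter fun z => h ∈ z.S).card < B ^ 6).biUnion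
        fun h => (Vp p).filter fun z => h ∈ z.S := by
      intro z hz
      obtain ⟨h, hh, hhz, hc⟩ := hex z hz
      exact mem_biUnion.2 ⟨h, mem_filter.2 ⟨hh, hc⟩, mem_filter.2 ⟨hz, hhz⟩⟩
    have h1 := card_le_card hsub
    have h2 := card_biUnion_le_card_mul
      (H.filter fun h => ((Vp p).filter fun z => h ∈ z.S).card < B ^ 6)
      (fun h => (Vp p).filter fun z => h ∈ z.S) (B ^ 6) fun h hh => (mem_filter.1 hh).2.le
    have h3 := Nat.mul_le_mul_right (B ^ 6) ((card_filter_le H fun h =>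
      ((Vp p).filter fun z => h ∈ z.S).card < B ^ 6).trans hH.le)
    have h4 : B ^ 13 * B ^ 6 = B ^ 19 := by ring
    have h5 := hpow 19 20 (by norm_num)
    have h6 := hpos 19
    have h7 : B ^ 20 ≤ (Vp p).card := hcolc p hp
    omega
  obtain ⟨p₀, hp₀, hrare⟩ := exists_no_rare_pair (Q.filter fun p => col p = (M₁, M₂)) H Tp
    (θ := B ^ 6) (fun p _ => filter_subset _ _) (by
      calc H.card ^ 2 * B ^ 6 ≤ (B ^ 13) ^ 2 * B ^ 6 :=
            Nat.mul_le_mul_right _ (Nat.pow_le_pow_left hH.le 2)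
        _ = B ^ 32 := by ring
        _ < 16 * B ^ 32 := by have := hpos 32; omega
        _ ≤ B ^ 33 := hpow 32 33 (by norm_num)
        _ ≤ _ := hMc)
  have hkB : k ≤ B := by
    have : k ≤ κ * k := Nat.le_mul_of_pos_left _ hκ
    omega
  have h14 := hpow 1 4 (by norm_num)
  rw [pow_one] at h14
  have h45 := hpow 4 5 (by norm_num)
  have h56 := hpow 5 6 (by norm_num)
  have hpos5 := hpos 5
  refine ⟨len + M₁ + (M₂ + len), robust_sub (w := B ^ 4) (hTp p₀ (mem_filter.1 hp₀).1) ?_ ?_⟩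
  · have h1 : k ^ 2 * (len + M₁ + (M₂ + len) + 1) ≤ B ^ 2 * B :=
      Nat.mul_le_mul (Nat.pow_le_pow_left hkB 2) (by omega)
    have h2 : B ^ 2 * B = B ^ 3 := by ring
    have h3 := hpow 3 4 (by norm_num)
    have h4 := hpow 1 3 (by norm_num)
    rw [pow_one] at h4
    omega
  · intro h hh h' hh' hne W hhW hh'W hW
    obtain ⟨p, hp, hpW⟩ := exists_clean (zone := Zone.set)
      (A := (Q.filter fun p => col p = (M₁, M₂)).filter fun p => h ∈ Tp p ∧ h' ∈ Tp p)
      (fun a ha b hb hab => hQd a (mem_filter.1 (mem_filter.1 ha).1).1 b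
        (mem_filter.1 (mem_filter.1 hb).1).1 hab) (W := W) (by
        have := hrare h hh h' hh'
        omega)
    simp only [mem_filter] at hp
    obtain ⟨⟨hpQ, hpcol⟩, hhT, hh'T⟩ := hp
    have hclean : ∀ g ∈ Tp p, ∀ U : Finset V, U.card ≤ B ^ 5 → ∃ z ∈ A, z.len = len ∧ g ∈ z.S ∧
        m₁ z p = M₁ ∧ m₂ z p = M₂ ∧ Disjoint z.set U := by
      intro g hg U hU
      obtain ⟨z, hz, hzU⟩ := exists_clean (zone := Zone.set)
        (A := (Vp p).filter fun z => g ∈ z.S) (fun a ha b hb hab =>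
          hAd a (hIA a (mem_filter.1 (mem_filter.1 ha).1).1) b
            (hIA b (mem_filter.1 (mem_filter.1 hb).1).1) hab) (W := U) (by
          have := (mem_filter.1 hg).2
          omega)
      obtain ⟨hzV, hgz⟩ := mem_filter.1 hz
      obtain ⟨hzI, hzc⟩ := mem_filter.1 hzV
      rw [hpcol, Prod.mk.injEq] at hzc
      exact ⟨z, hIA z hzI, (mem_filter.1 hzI).2, hgz, hzc.1, hzc.2, hzU⟩
    obtain ⟨zi, hzi, hli, hhi, hi1, -, hiW⟩ := hclean h hhT W (by omega)
    refine path_via_port (hA zi hzi).1 hhi hli (hQ p hpQ).1 hne hh'W hhW hpW hiW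
      (hAQ zi hzi p hpQ) (mem_filter.1 hh'T).1 (w := B ^ 5) (by omega) (hi1 ▸ c₁ zi hzi p hpQ) ?_
    intro U hU
    obtain ⟨zj, hzj, hlj, hhj, -, hj2, hjU⟩ := hclean h' hh'T U hU
    exact ⟨zj, (hA zj hzj).1, hhj, hlj, hjU, hAQ zj hzj p hpQ, hj2 ▸ c₂ zj hzj p hpQ⟩

end ManyFailing

section Growth
open scoped Classical
open Finset

variable {V : Type*} [Fintype V] {G : SimpleGraph V} {d Kc : ℕ}

theorem ball_grow_of_half (hG : Good G d Kc) {W A : Finset V} {ρ E K : ℕ}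
    (h1 : d ≤ 2 * (ball G W A ρ).card) (hK : 2 * K ≤ Fintype.card V + 2) (hKE : K ≤ 2 ^ E)
    (h4 : ∀ r, ρ ≤ r → r < ρ + 2 * E ^ 3 → (ball G W A r).card < K →
      2 * (nb G (ball G W A r) ∩ W).card ≤ (nb G (ball G W A r)).card) :
    K ≤ (ball G W A (ρ + 2 * E ^ 3)).card := by
  have hpos := hG.pos
  refine growth (b := fun r => (ball G W A r).card)
    (fun i j hij => card_le_card (ball_mono W A hij)) (by show 1 ≤ _; omega) hKE ?_
  intro r hr hr' hlt
  have hm : (ball G W A ρ).card ≤ (ball G W A r).card := card_le_card (ball_mono W A hr)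
  have h5 := hG.exp _ E (by omega : d ≤ 2 * (ball G W A r).card) (by omega) (by omega)
  have h6 := card_sdiff_add_card_inter (nb G (ball G W A r)) W
  have h7 := h4 r hr hr' hlt
  show (2 * E ^ 2 + 1) * (ball G W A r).card ≤ 2 * E ^ 2 * (ball G W A (r + 1)).card
  rw [ball_card_succ]
  have h8 : (nb G (ball G W A r)).card ≤ 2 * (nb G (ball G W A r) \ W).card := by omega
  nlinarith [Nat.mul_le_mul_left (E ^ 2) h8]

/-- Growth from a single vertex when only few vertices are absorbed at each radius. -/
theorem ball_grow_singleton (hG : Good G d Kc) {W : Finset V} {z : V} {c κ A E K : ℕ}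
    (hKc : 0 < Kc) (hκ : 0 < κ) (hA : 6 * Kc ≤ A) (hc : 2 * A * Kc * (κ * c + 2 * d) ≤ d * κ)
    (hK : 2 * K ≤ Fintype.card V + 2) (hKE : K ≤ 2 ^ E)
    (habs : ∀ r ≤ 2 * E ^ 3, (ball G W {z} r).card < K →
      κ * (nb G (ball G W {z} r) ∩ W).card ≤ κ * c * (r + 1) + (2 * r + 1) * d) :
    K ≤ (ball G W {z} (1 + 2 * E ^ 3)).card := by
  have hpos := hG.pos
  by_contra! hlt
  have hlt' : ∀ r ≤ 1 + 2 * E ^ 3, (ball G W {z} r).card < K := fun r hr =>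
    (card_le_card (ball_mono W {z} hr)).trans_lt hlt
  have hAK : 0 < A * Kc := Nat.mul_pos (by omega) hKc
  have habs' : ∀ r ≤ 2 * E ^ 3,
      2 * (A * Kc) * (nb G (ball G W {z} r) ∩ W).card ≤ d * (r + 1) := by
    intro r hr
    have h1 := habs r hr (hlt' r (by omega))
    refine Nat.le_of_mul_le_mul_left ?_ hκ
    calc κ * (2 * (A * Kc) * (nb G (ball G W {z} r) ∩ W).card)
        = 2 * A * Kc * (κ * (nb G (ball G W {z} r) ∩ W).card) := by ring
      _ ≤ 2 * A * Kc * ((κ * c + 2 * d) * (r + 1)) := Nat.mul_le_mul_left _ (by nlinarith)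
      _ = 2 * A * Kc * (κ * c + 2 * d) * (r + 1) := by ring
      _ ≤ d * κ * (r + 1) := Nat.mul_le_mul_right _ hc
      _ = _ := by ring
  have hA36 : 36 ≤ A ^ 2 := by nlinarith
  have hb1 : 11 * d ≤ 12 * (ball G W {z} 1).card := by
    have h1 := habs' 0 (by omega)
    have h2 := hG.deg z
    have h3 := card_sdiff_add_card_inter (nb G (ball G W {z} 0)) W
    have h4 := ball_card_succ (G := G) W {z} 0
    have h5 : (nb G (ball G W {z} 0)).card = (nb G {z}).card := rfl
    have h6 : 12 * (nb G (ball G W {z} 0) ∩ W).card ≤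
        2 * (A * Kc) * (nb G (ball G W {z} 0) ∩ W).card :=
      Nat.mul_le_mul_right _ (by nlinarith)
    rw [Nat.zero_add] at h4
    omega
  have hmono1 : ∀ r, 1 ≤ r → (ball G W {z} 1).card ≤ (ball G W {z} r).card := fun r hr =>
    card_le_card (ball_mono W {z} hr)
  have key : ∀ r, 1 ≤ r → r ≤ 2 * E ^ 3 → d * (r + 1) ^ 2 ≤ A ^ 2 * (ball G W {z} r).card →
      d * (r + 1) ≤ A * Kc * (nb G (ball G W {z} r)).card ∧
      2 * (nb G (ball G W {z} r) ∩ W).card ≤ (nb G (ball G W {z} r)).card := by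
    intro r hr hr' h
    have h1 := hmono1 r hr
    have h2 := hlt' r (by omega)
    have h3 := hG.exp0 (ball G W {z} r) (by omega) (by omega)
    have h4 : (d * (r + 1)) ^ 2 ≤ (A * Kc * (nb G (ball G W {z} r)).card) ^ 2 := by
      calc (d * (r + 1)) ^ 2 = d * (d * (r + 1) ^ 2) := by ring
        _ ≤ d * (A ^ 2 * (ball G W {z} r).card) := Nat.mul_le_mul_left _ h
        _ = A ^ 2 * (d * (ball G W {z} r).card) := by ring
        _ ≤ A ^ 2 * (Kc * (nb G (ball G W {z} r)).card) ^ 2 := Nat.mul_le_mul_left _ h3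
        _ = _ := by ring
    have h5 := (Nat.pow_le_pow_iff_left two_ne_zero).1 h4
    refine ⟨h5, Nat.le_of_mul_le_mul_left ?_ hAK⟩
    have h6 := habs' r hr'
    nlinarith
  have claim : ∀ r, 1 ≤ r → r ≤ 2 * E ^ 3 → d * (r + 1) ^ 2 ≤ A ^ 2 * (ball G W {z} r).card := by
    intro r hr
    induction r, hr using Nat.le_induction with
    | base =>
      intro _
      nlinarith [Nat.mul_le_mul_right (ball G W {z} 1).card hA36]
    | succ r hr ih =>
      intro hr'
      have h1 := ih (by omega)
      obtain ⟨h2, h3⟩ := key r hr (by omega) h1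
      have h4 := card_sdiff_add_card_inter (nb G (ball G W {z} r)) W
      have h5 : (nb G (ball G W {z} r)).card ≤ 2 * (nb G (ball G W {z} r) \ W).card := by omega
      rw [ball_card_succ]
      have h6 : 3 * (d * (r + 1)) ≤ A ^ 2 * (nb G (ball G W {z} r) \ W).card := by
        calc 3 * (d * (r + 1)) ≤ 3 * (A * Kc * (nb G (ball G W {z} r)).card) :=
              Nat.mul_le_mul_left _ h2
          _ ≤ 3 * (A * Kc * (2 * (nb G (ball G W {z} r) \ W).card)) :=
              Nat.mul_le_mul_left _ (Nat.mul_le_mul_left _ h5)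
          _ = A * (6 * Kc) * (nb G (ball G W {z} r) \ W).card := by ring
          _ ≤ A * A * (nb G (ball G W {z} r) \ W).card :=
              Nat.mul_le_mul_right _ (Nat.mul_le_mul_left _ hA)
          _ = _ := by ring
      nlinarith
  have hd2 : d ≤ 2 * (ball G W {z} 1).card := by omega
  have := ball_grow_of_half hG hd2 hK hKE (fun r hr hr' _ =>
    (key r hr (by omega) (claim r hr (by omega))).2)
  omega

/-- Enlarging the avoided set does not add boundary vertices which were avoided before. -/
theorem nb_ball_inter_subset {W W' T : Finset V} (h : W ⊆ W') (hT : T ⊆ W) (z : V) (r : ℕ) :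
    nb G (ball G W' {z} r) ∩ T ⊆ nb G (ball G W {z} r) ∩ T := by
  intro x hx
  obtain ⟨hx, hxT⟩ := mem_inter.1 hx
  obtain ⟨hx1, y, hy, hyx⟩ := mem_nb.1 hx
  refine mem_inter.2 ⟨mem_nb.2 ⟨fun hxb => ?_, y, ball_anti h r hy, hyx⟩, hxT⟩
  rcases ball_avoid hxb with rfl | hxW
  · exact hx1 (subset_ball _ _ _ (mem_singleton_self _))
  · exact hxW (hT hxT)

/-- Boundary vertices outside `H` lie in the next ball. -/
theorem mem_ball_of_mem_nb {W H : Finset V} (h : H ⊆ W) {z x : V} {r : ℕ}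
    (hx : x ∈ nb G (ball G W {z} r)) (hxH : x ∉ H) : x ∈ ball G H {z} (r + 1) := by
  obtain ⟨-, y, hy, hyx⟩ := mem_nb.1 hx
  exact mem_ball_succ_of_adj (ball_anti h r hy) hyx hxH

/-- Few vertices of `W` lie on the boundary of the balls of radius at most `R` around `z`. -/
def Sparse (G : SimpleGraph V) (H : Finset V) (R : ℕ) (z : V) (W : Finset V) (c : ℕ) : Prop :=
  ∀ r ≤ R, (nb G (ball G (W ∪ H) {z} r) ∩ W).card ≤ c * (r + 1)

theorem Sparse.mono {H W : Finset V} {R : ℕ} {z : V} {c c' : ℕ} (h : Sparse G H R z W c)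
    (hc : c ≤ c') : Sparse G H R z W c' := fun r hr =>
  (h r hr).trans (Nat.mul_le_mul_right _ hc)

/-- No small set inside `T` is failing. -/
def NoFailing (G : SimpleGraph V) (H T : Finset V) (M R d κ : ℕ) : Prop :=
  ∀ X ⊆ T, X.card ≤ M → ∀ v, ∀ ρ ≤ R, ¬ Failing G H X v ρ d κ

theorem big_ball_of_sparse (hG : Good G d Kc) {W H N T : Finset V} {z : V}
    {c κ A E₁ E₂ E K₁ K₂ : ℕ}
    (hKc : 0 < Kc) (hκ : 0 < κ) (hA : 6 * Kc ≤ A) (hc : 2 * A * Kc * (κ * c + 2 * d) ≤ d * κ)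
    (hd : d ≤ 2 * K₁) (hK12 : K₁ ≤ K₂)
    (hK₁ : 2 * K₁ ≤ Fintype.card V + 2) (hK₁E : K₁ ≤ 2 ^ E₁)
    (hK₂ : 2 * K₂ ≤ Fintype.card V + 2) (hK₂E : K₂ ≤ 2 ^ E₂)
    (hn : Fintype.card V ≤ 2 ^ E)
    (hz : z ∉ H) (hW : Sparse G H (2 * E₁ ^ 3) z W c)
    (hT : ball G H {z} (2 * E₁ ^ 3) ⊆ T) (hF : NoFailing G H T K₁ (2 * E₁ ^ 3) d κ)
    (hNH : Disjoint N H)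
    (hN : Disjoint N (ball G H {z} (1 + 2 * E₁ ^ 3 + 2 * E₂ ^ 3)))
    (h2 : 2 * E₂ ^ 2 * (W.card + H.card) ≤ K₁)
    (h3 : 2 * E ^ 2 * (W ∪ H ∪ N).card ≤ K₂) :
    Fintype.card V < 2 * (ball G (W ∪ H ∪ N) {z}
      (1 + 2 * E₁ ^ 3 + 2 * E₂ ^ 3 + 2 * E ^ 3)).card := by
  have hHA : H ⊆ W ∪ H ∪ N := subset_union_right.trans subset_union_left
  have hWH : W ∪ H ⊆ W ∪ H ∪ N := subset_union_left
  have hpos := hG.pos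
  have absN : ∀ r < 1 + 2 * E₁ ^ 3 + 2 * E₂ ^ 3,
      nb G (ball G (W ∪ H ∪ N) {z} r) ∩ (W ∪ H ∪ N) ⊆
      (nb G (ball G (W ∪ H ∪ N) {z} r) ∩ W) ∪ (nb G (ball G (W ∪ H ∪ N) {z} r) ∩ H) := by
    intro r hr x hx
    obtain ⟨hx, hxA⟩ := mem_inter.1 hx
    rcases mem_union.1 hxA with h | h
    · rcases mem_union.1 h with h | h
      · exact mem_union_left _ (mem_inter.2 ⟨hx, h⟩)
      · exact mem_union_right _ (mem_inter.2 ⟨hx, h⟩)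
    · exact absurd (ball_mono H {z} (by omega : r + 1 ≤ _)
        (mem_ball_of_mem_nb hHA hx (disjoint_left.1 hNH h))) (disjoint_left.1 hN h)
  have hb1 : K₁ ≤ (ball G (W ∪ H ∪ N) {z} (1 + 2 * E₁ ^ 3)).card := by
    refine ball_grow_singleton hG hKc hκ hA hc hK₁ hK₁E fun r hr hlt => ?_
    have h4 := (card_le_card (absN r (by omega))).trans (card_union_le _ _)
    have h5 := (card_le_card (nb_ball_inter_subset (G := G) hWH subset_union_left z r)).trans
      (hW r hr)
    have h6 := hF (ball G (W ∪ H ∪ N) {z} r)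
      ((ball_anti hHA r).trans ((ball_mono H {z} hr).trans hT)) hlt.le z r hr
    have h7 : κ * (nb G (ball G (W ∪ H ∪ N) {z} r) ∩ H).card < (2 * r + 1) * d := by
      by_contra! hle
      refine h6 ⟨?_, subset_ball _ _ _ (mem_singleton_self _),
        fun x hx => ball_reach_singleton hx, hle⟩
      rw [disjoint_left]
      intro x hx hxH
      rcases ball_avoid hx with rfl | h
      · exact hz hxH
      · exact h (hHA hxH)
    calc _ ≤ κ * ((nb G (ball G (W ∪ H ∪ N) {z} r) ∩ W).card +
          (nb G (ball G (W ∪ H ∪ N) {z} r) ∩ H).card) := Nat.mul_le_mul_left _ h4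
      _ ≤ _ := by nlinarith [Nat.mul_le_mul_left κ h5]
  have hb2 : K₂ ≤ (ball G (W ∪ H ∪ N) {z} (1 + 2 * E₁ ^ 3 + 2 * E₂ ^ 3)).card := by
    refine ball_grow hG (by omega) hK₂ hK₂E fun r hr hr' _ => ?_
    have h4 := (card_le_card (absN r (by omega))).trans (card_union_le _ _)
    calc _ ≤ 2 * E₂ ^ 2 * (W.card + H.card) := Nat.mul_le_mul_left _ (h4.trans
          (Nat.add_le_add (card_le_card inter_subset_right) (card_le_card inter_subset_right)))
      _ ≤ _ := h2.trans (hb1.trans (card_le_card (ball_mono _ _ hr)))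
  have hb3 := ball_grow hG (W := W ∪ H ∪ N) (A := {z})
    (ρ := 1 + 2 * E₁ ^ 3 + 2 * E₂ ^ 3) (E := E) (K := Fintype.card V / 2 + 1)
    (by omega) (by omega)
    (by
      rcases Nat.eq_zero_or_pos (Fintype.card V / 2) with h | h
      · rw [h]; exact Nat.one_le_two_pow
      · omega)
    (fun r hr _ _ => by
      calc _ ≤ 2 * E ^ 2 * (W ∪ H ∪ N).card :=
            Nat.mul_le_mul_left _ (card_le_card inter_subset_right)
        _ ≤ _ := h3.trans (hb2.trans (card_le_card (ball_mono _ _ hr))))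
  omega

end Growth

section Connect
open scoped Classical
open Finset

variable {V : Type*} [Fintype V] {G : SimpleGraph V} {d Kc : ℕ}

omit [Fintype V] in
/-- A shortest path to `b` has at most `s` vertices reachable within `s` steps
from a vertex `a₀` which is not closer to `b` than the start of the path. -/
theorem card_near_start {S : Set V} {a a₀ b : V} {p : G.Walk a b} {s : ℕ} {X : Finset V}
    (hpath : p.IsPath) (hmin : ∀ r, Reach G S a₀ b r → p.length ≤ r)
    (hp : ∀ x ∈ p.support, x ≠ a → x ∈ S)
    (hX : ∀ x ∈ X, x ∈ p.support ∧ x ≠ a ∧ Reach G S a₀ x s) : X.card ≤ s := by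
  have hsub : X ⊆ (Icc 1 s).image p.getVert := by
    intro x hx
    obtain ⟨h1, h2, h4⟩ := hX x hx
    obtain ⟨q, r, hqr⟩ := SimpleGraph.Walk.mem_support_iff_exists_append.1 h1
    refine mem_image.2 ⟨q.length, mem_Icc.2 ⟨?_, ?_⟩, ?_⟩
    · rcases Nat.eq_zero_or_pos q.length with h | h
      · exact absurd (SimpleGraph.Walk.eq_of_length_eq_zero h).symm h2
      · exact h
    · have hra : a ∉ r.support := by
        intro hra
        rw [hqr, SimpleGraph.Walk.isPath_def, SimpleGraph.Walk.support_append,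
          List.nodup_append'] at hpath
        rw [← SimpleGraph.Walk.cons_tail_support, List.mem_cons] at hra
        rcases hra with h | h
        · exact h2 h.symm
        · exact hpath.2.2 q.start_mem_support h
      have h5 : Reach G S x b r.length := ⟨r, le_rfl, fun y hy => hp y
        (by rw [hqr, SimpleGraph.Walk.mem_support_append_iff]; exact Or.inr hy)
        (fun h => hra (h ▸ hy))⟩
      have h6 := hmin _ (h4.trans h5)
      have h7 : p.length = q.length + r.length := by
        rw [hqr, SimpleGraph.Walk.length_append]
      omega
    · rw [hqr, SimpleGraph.Walk.getVert_append]
      simp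
  exact (card_le_card hsub).trans (card_image_le.trans (by simp))

/-- Two sets, all of whose vertices expand well while avoiding `W ∪ H ∪ N`, are joined by a
short path of which few vertices are close to either of the sets. -/
theorem connect {W H N A A' : Finset V} {r R : ℕ} (hA : A ⊆ W) (hA' : A' ⊆ W)
    (hne : A.Nonempty) (hne' : A'.Nonempty) (hdis : Disjoint A A')
    (hbig : ∀ z ∈ A ∪ A', Fintype.card V < 2 * (ball G (W ∪ H ∪ N) {z} r).card)
    (hN : ∀ z ∈ A ∪ A', Disjoint N (ball G H {z} R)) :
    ∃ z ∈ A, ∃ z' ∈ A', ∃ m, 1 ≤ m ∧ m ≤ 2 * r ∧ ∃ P : Finset V, P.card = m + 1 ∧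
      PathIn G (P : Set V) z z' m ∧ (∀ x ∈ P, x = z ∨ x = z' ∨ x ∉ W ∪ H ∪ N) ∧
      ∀ z₀ ∈ A ∪ A', ∀ ρ ≤ R,
        (nb G (ball G (W ∪ P ∪ H) {z₀} ρ) ∩ (P \ W)).card ≤ ρ + 1 := by
  have hex : ∃ m, ∃ z ∈ A, ∃ z' ∈ A',
      Reach G {x | x = z ∨ x = z' ∨ x ∉ W ∪ H ∪ N} z z' m := by
    obtain ⟨z, hz⟩ := hne
    obtain ⟨z', hz'⟩ := hne'
    obtain ⟨a, ha, b, hb, h⟩ := balls_meet (hbig z (mem_union_left _ hz))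
      (hbig z' (mem_union_right _ hz'))
    obtain rfl := mem_singleton.1 ha
    obtain rfl := mem_singleton.1 hb
    refine ⟨_, a, hz, b, hz', h.mono ?_ le_rfl⟩
    rintro x (h | h | h | h)
    exacts [Or.inl h, Or.inr (Or.inl h), Or.inr (Or.inr h), Or.inr (Or.inr h)]
  have hle : Nat.find hex ≤ 2 * r := by
    obtain ⟨z, hz⟩ := hne
    obtain ⟨z', hz'⟩ := hne'
    obtain ⟨a, ha, b, hb, h⟩ := balls_meet (hbig z (mem_union_left _ hz))
      (hbig z' (mem_union_right _ hz'))
    obtain rfl := mem_singleton.1 ha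
    obtain rfl := mem_singleton.1 hb
    refine (Nat.find_min' hex ⟨a, hz, b, hz', h.mono ?_ le_rfl⟩).trans (by omega)
    rintro x (h | h | h | h)
    exacts [Or.inl h, Or.inr (Or.inl h), Or.inr (Or.inr h), Or.inr (Or.inr h)]
  have hmin : ∀ z ∈ A, ∀ z' ∈ A', ∀ m,
      Reach G {x | x = z ∨ x = z' ∨ x ∉ W ∪ H ∪ N} z z' m → Nat.find hex ≤ m :=
    fun z hz z' hz' m h => Nat.find_min' hex ⟨z, hz, z', hz', h⟩
  obtain ⟨z, hz, z', hz', hreach⟩ := Nat.find_spec hex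
  obtain ⟨ℓ, hℓ, p, hpp, hpl, hps⟩ := hreach.exists_pathIn
  have hℓm : Nat.find hex = ℓ := le_antisymm (hmin z hz z' hz' ℓ ⟨p, hpl.le, hps⟩) hℓ
  rw [hℓm] at hmin hle
  have hzz' : z ≠ z' := fun h => disjoint_left.1 hdis hz (h ▸ hz')
  have hmemP : ∀ x, x ∈ p.support.toFinset ↔ x ∈ p.support := fun x => List.mem_toFinset
  refine ⟨z, hz, z', hz', ℓ, ?_, hle, p.support.toFinset, ?_, ⟨p, hpp, hpl, ?_⟩, ?_, ?_⟩
  · rcases Nat.eq_zero_or_pos ℓ with h | h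
    · exact absurd (SimpleGraph.Walk.eq_of_length_eq_zero (hpl.trans h)) hzz'
    · exact h
  · rw [List.toFinset_card_of_nodup hpp.support_nodup, SimpleGraph.Walk.length_support, hpl]
  · intro x hx
    exact mem_coe.2 ((hmemP x).2 hx)
  · intro x hx
    exact hps x ((hmemP x).1 hx)
  · intro z₀ hz₀ ρ hρ
    set P := p.support.toFinset with hP
    -- vertices of the path met by a small ball are reachable without entering `N`
    have hreach' : ∀ x ∈ nb G (ball G (W ∪ P ∪ H) {z₀} ρ) ∩ (P \ W),
        x ∈ p.support ∧ x ≠ z ∧ x ≠ z' ∧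
          Reach G {y | y = z₀ ∨ y ∉ W ∪ H ∪ N} z₀ x (ρ + 1) := by
      intro x hx
      obtain ⟨hx1, hx2⟩ := mem_inter.1 hx
      obtain ⟨hxP, hxW⟩ := mem_sdiff.1 hx2
      have hxp := (hmemP x).1 hxP
      have hxz : x ≠ z := fun h => hxW (hA (h ▸ hz))
      have hxz' : x ≠ z' := fun h => hxW (hA' (h ▸ hz'))
      refine ⟨hxp, hxz, hxz', ?_⟩
      obtain ⟨-, y, hy, hyx⟩ := mem_nb.1 hx1
      have hball : ∀ w ∈ ball G (W ∪ P ∪ H) {z₀} ρ, w ∉ N := fun w hw hwN =>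
        disjoint_left.1 (hN z₀ hz₀) hwN
          (ball_mono H {z₀} hρ (ball_anti subset_union_right ρ hw))
      have hR : Reach G {y | y = z₀ ∨ y ∉ W ∪ H ∪ N} z₀ y ρ := by
        obtain ⟨b, hb, h⟩ := ball_reach hy
        obtain rfl := mem_singleton.1 hb
        refine h.mono ?_ le_rfl
        rintro w ⟨hw, h | h⟩
        · exact Or.inl h
        · refine Or.inr fun hw' => ?_
          rcases mem_union.1 hw' with hw' | hw'
          · rcases mem_union.1 hw' with hw' | hw'
            · exact h (mem_union_left _ (mem_union_left _ hw'))
            · exact h (mem_union_right _ hw')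
          · exact hball w hw hw'
      refine hR.trans (Reach.of_adj hyx hR.right_mem ?_)
      rcases hps x hxp with h | h | h
      · exact absurd h hxz
      · exact absurd h hxz'
      · exact Or.inr h
    rcases mem_union.1 hz₀ with h | h
    · refine card_near_start (S := {x | x = z₀ ∨ x = z' ∨ x ∉ W ∪ H ∪ N}) (a₀ := z₀) hpp
        (fun r hr => hpl.trans_le (hmin z₀ h z' hz' r hr)) ?_ ?_
      · intro x hx hxz
        exact (hps x hx).elim (fun h => absurd h hxz) Or.inr
      · intro x hx
        obtain ⟨h1, h2, -, h4⟩ := hreach' x hx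
        refine ⟨h1, h2, h4.mono ?_ le_rfl⟩
        rintro y (h | h)
        exacts [Or.inl h, Or.inr (Or.inr h)]
    · refine card_near_start (S := {x | x = z ∨ x = z₀ ∨ x ∉ W ∪ H ∪ N}) (a₀ := z₀)
        hpp.reverse (fun r hr => ?_) ?_ ?_
      · rw [SimpleGraph.Walk.length_reverse]
        exact hpl.trans_le (hmin z hz z₀ h r hr.symm)
      · intro x hx hxz
        rw [SimpleGraph.Walk.support_reverse, List.mem_reverse] at hx
        rcases hps x hx with h | h | h
        exacts [Or.inl h, absurd h hxz, Or.inr (Or.inr h)]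
      · intro x hx
        obtain ⟨h1, -, h3, h4⟩ := hreach' x hx
        refine ⟨by rwa [SimpleGraph.Walk.support_reverse, List.mem_reverse], h3, h4.mono ?_ le_rfl⟩
        rintro y (h | h)
        exacts [Or.inr (Or.inl h), Or.inr (Or.inr h)]

/-- A path with few vertices close to `z` preserves sparsity around `z`. -/
theorem Sparse.union {H W P : Finset V} {R : ℕ} {z : V} {c : ℕ} (h : Sparse G H R z W c)
    (hP : ∀ ρ ≤ R, (nb G (ball G (W ∪ P ∪ H) {z} ρ) ∩ (P \ W)).card ≤ ρ + 1) :
    Sparse G H R z (W ∪ P) (c + 1) := by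
  intro r hr
  have h1 := (card_le_card (nb_ball_inter_subset (G := G) (W := W ∪ H) (W' := W ∪ P ∪ H) (T := W)
    (by intro x hx; simp only [mem_union] at hx ⊢; tauto) subset_union_left z r)).trans (h r hr)
  have h2 : nb G (ball G (W ∪ P ∪ H) {z} r) ∩ (W ∪ P) ⊆
      (nb G (ball G (W ∪ P ∪ H) {z} r) ∩ W) ∪ (nb G (ball G (W ∪ P ∪ H) {z} r) ∩ (P \ W)) := by
    intro x
    simp only [mem_inter, mem_union, mem_sdiff]
    tauto
  have h3 := (card_le_card h2).trans (card_union_le _ _)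
  have h4 := hP r hr
  nlinarith

/-- A set far away from `z` preserves sparsity around `z`. -/
theorem Sparse.union_far {H W P : Finset V} {R : ℕ} {z : V} {c : ℕ} (h : Sparse G H R z W c)
    (hPH : Disjoint P H) (hP : Disjoint P (ball G H {z} (R + 1))) :
    Sparse G H R z (W ∪ P) c := by
  intro r hr
  refine (card_le_card ?_).trans (h r hr)
  intro x hx
  obtain ⟨hx1, hx2⟩ := mem_inter.1 hx
  have hxW : x ∈ W := by
    refine (mem_union.1 hx2).resolve_right fun hxP => ?_
    exact disjoint_left.1 hP hxP (ball_mono H {z} (by omega)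
      (mem_ball_of_mem_nb subset_union_right hx1 (disjoint_left.1 hPH hxP)))
  exact nb_ball_inter_subset (by intro x hx; simp only [mem_union] at hx ⊢; tauto)
    subset_union_left z r (mem_inter.2 ⟨hx1, hxW⟩)

end Connect

section Link
open scoped Classical
open Finset

variable {V : Type*} [Fintype V] {G : SimpleGraph V} {d Kc : ℕ}

theorem ball_disjoint {H Y : Finset V} (h : Disjoint Y H) (r : ℕ) : Disjoint (ball G H Y r) H := by
  rw [disjoint_left]
  intro x hx hxH
  rw [ball_eq_biUnion, mem_biUnion] at hx
  obtain ⟨y, hy, hx⟩ := hx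
  rcases ball_avoid hx with rfl | hx
  exacts [disjoint_left.1 h hy hxH, hx hxH]

/-- Numerical parameters for three successive stages of expansion. -/
structure Scale where
  (κ A c w E₁ E₂ E K₁ K₂ : ℕ)

/-- The radius of the first stage. -/
def Scale.R (s : Scale) : ℕ := 2 * s.E₁ ^ 3

/-- The radius of the first two stages. -/
def Scale.T (s : Scale) : ℕ := 1 + 2 * s.E₁ ^ 3 + 2 * s.E₂ ^ 3

/-- The length of the connecting paths. -/
def Scale.L (s : Scale) : ℕ := 2 * (s.T + 2 * s.E ^ 3)

theorem Scale.R_succ_le (s : Scale) : s.R + 1 ≤ s.T := by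
  unfold Scale.R Scale.T; omega

/-- The numerical conditions under which sparse vertices expand. -/
structure Scale.Valid (s : Scale) (d Kc n : ℕ) : Prop where
  Kc_pos : 0 < Kc
  κ_pos : 0 < s.κ
  le_A : 6 * Kc ≤ s.A
  le_dκ : 2 * s.A * Kc * (s.κ * s.c + 2 * d) ≤ d * s.κ
  le_K₁ : d ≤ 2 * s.K₁
  K₁_le : s.K₁ ≤ s.K₂
  K₂_le : 2 * s.K₂ ≤ n + 2
  K₁_le_pow : s.K₁ ≤ 2 ^ s.E₁
  K₂_le_pow : s.K₂ ≤ 2 ^ s.E₂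
  le_pow : n ≤ 2 ^ s.E

/-- A family of pairwise distant sets, none of which is close to a failing set. -/
structure Field (G : SimpleGraph V) (H : Finset V) (s : Scale) (d : ℕ)
    (𝒪 : Finset (Finset V)) : Prop where
  disj : ∀ O ∈ 𝒪, Disjoint O H
  far : ∀ O ∈ 𝒪, ∀ O' ∈ 𝒪, O ≠ O' → Disjoint (ball G H O s.T) (ball G H O' s.T)
  noFailing : ∀ O ∈ 𝒪, NoFailing G H (ball G H O s.T) s.K₁ s.R d s.κ
  card₁ : 2 * s.E₂ ^ 2 * (s.w + H.card) ≤ s.K₁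
  card₂ : 2 * s.E ^ 2 *
    (s.w + H.card + (𝒪.biUnion fun O => ball G H O (s.R + 1)).card) ≤ s.K₂

theorem Field.link (hG : Good G d Kc) {s : Scale} (hs : s.Valid d Kc (Fintype.card V))
    {H : Finset V} {𝒪 : Finset (Finset V)} (hF : Field G H s d 𝒪) {O O' W A A' : Finset V}
    (hO : O ∈ 𝒪) (hO' : O' ∈ 𝒪) (hOO' : O ≠ O') (hW : ∀ O ∈ 𝒪, O ⊆ W) (hWc : W.card ≤ s.w)
    (hA : A ⊆ O) (hA' : A' ⊆ O') (hne : A.Nonempty) (hne' : A'.Nonempty)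
    (hS : ∀ z ∈ A ∪ A', Sparse G H s.R z W s.c) :
    ∃ z ∈ A, ∃ z' ∈ A', ∃ m, 1 ≤ m ∧ m ≤ s.L ∧ ∃ P : Finset V, P.card = m + 1 ∧
      PathIn G (P : Set V) z z' m ∧ (∀ x ∈ P, x = z ∨ x = z' ∨ x ∉ W) ∧
      (∀ z₀ ∈ A ∪ A', ∀ c, Sparse G H s.R z₀ W c → Sparse G H s.R z₀ (W ∪ P) (c + 1)) ∧
      ∀ O'' ∈ 𝒪, O'' ≠ O → O'' ≠ O' → ∀ z ∈ O'', ∀ c,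
        Sparse G H s.R z W c → Sparse G H s.R z (W ∪ P) c := by
  set N : Finset V := ((𝒪.erase O).erase O').biUnion fun O => ball G H O (s.R + 1) with hNdef
  have hmemN : ∀ x, x ∈ N ↔ ∃ O'' ∈ 𝒪, O'' ≠ O ∧ O'' ≠ O' ∧ x ∈ ball G H O'' (s.R + 1) := by
    intro x
    simp only [hNdef, mem_biUnion, mem_erase]
    constructor
    · rintro ⟨a, ⟨h1, h2, h3⟩, h4⟩; exact ⟨a, h3, h2, h1, h4⟩
    · rintro ⟨a, h3, h2, h1, h4⟩; exact ⟨a, ⟨h1, h2, h3⟩, h4⟩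
  have hNH : Disjoint N H := by
    rw [disjoint_left]
    intro x hx
    obtain ⟨O'', h, -, -, hx⟩ := (hmemN x).1 hx
    exact disjoint_left.1 (ball_disjoint (hF.disj O'' h) _) hx
  have hobj : ∀ z ∈ A ∪ A', ∃ Q ∈ 𝒪, z ∈ Q ∧ (Q = O ∨ Q = O') := by
    intro z hz
    rcases mem_union.1 hz with h | h
    · exact ⟨O, hO, hA h, Or.inl rfl⟩
    · exact ⟨O', hO', hA' h, Or.inr rfl⟩
  have hNz : ∀ z ∈ A ∪ A', Disjoint N (ball G H {z} s.T) := by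
    intro z hz
    obtain ⟨Q, hQ, hzQ, hQO⟩ := hobj z hz
    rw [disjoint_left]
    intro x hx hx'
    obtain ⟨O'', h, h1, h2, hx⟩ := (hmemN x).1 hx
    have hne : O'' ≠ Q := by rintro rfl; exact hQO.elim h1 h2
    exact disjoint_left.1 (hF.far O'' h Q hQ hne) (ball_mono H _ s.R_succ_le hx)
      (ball_subset_of_subset (singleton_subset_iff.2 hzQ) _ hx')
  have hcard : (W ∪ H ∪ N).card ≤
      s.w + H.card + (𝒪.biUnion fun O => ball G H O (s.R + 1)).card := by
    have h1 := card_union_le (W ∪ H) N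
    have h2 := card_union_le W H
    have h3 : N.card ≤ (𝒪.biUnion fun O => ball G H O (s.R + 1)).card :=
      card_le_card (biUnion_subset_biUnion_of_subset_left _
        ((erase_subset _ _).trans (erase_subset _ _)))
    omega
  have hbig : ∀ z ∈ A ∪ A', Fintype.card V <
      2 * (ball G (W ∪ H ∪ N) {z} (s.T + 2 * s.E ^ 3)).card := by
    intro z hz
    obtain ⟨Q, hQ, hzQ, -⟩ := hobj z hz
    have hK := hs.K₁_le
    have hK' := hs.K₂_le
    exact big_ball_of_sparse hG hs.Kc_pos hs.κ_pos hs.le_A hs.le_dκ hs.le_K₁ hs.K₁_le (by omega)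
      hs.K₁_le_pow hs.K₂_le hs.K₂_le_pow hs.le_pow (disjoint_left.1 (hF.disj Q hQ) hzQ) (hS z hz)
      ((ball_mono H _ (by have := s.R_succ_le; unfold Scale.R at this; omega)).trans
        (ball_subset_of_subset (singleton_subset_iff.2 hzQ) _))
      (hF.noFailing Q hQ) hNH (hNz z hz)
      ((Nat.mul_le_mul_left _ (by omega)).trans hF.card₁)
      ((Nat.mul_le_mul_left _ hcard).trans hF.card₂)
  have hdis : Disjoint A A' := by
    rw [disjoint_left]
    intro x hx hx'
    exact disjoint_left.1 (hF.far O hO O' hO' hOO') (subset_ball _ _ _ (hA hx))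
      (subset_ball _ _ _ (hA' hx'))
  obtain ⟨z, hz, z', hz', m, hm1, hm2, P, hPc, hP, hPav, hPnear⟩ :=
    connect (hA.trans (hW O hO)) (hA'.trans (hW O' hO')) hne hne' hdis hbig hNz
  refine ⟨z, hz, z', hz', m, hm1, hm2, P, hPc, hP, ?_, ?_, ?_⟩
  · intro x hx
    rcases hPav x hx with h | h | h
    exacts [Or.inl h, Or.inr (Or.inl h),
      Or.inr (Or.inr fun hxW => h (mem_union_left _ (mem_union_left _ hxW)))]
  · intro z₀ hz₀ c hc
    exact hc.union fun ρ hρ => hPnear z₀ hz₀ ρ (by have := s.R_succ_le; omega)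
  · intro O'' hO'' h1 h2 y hy c hc
    refine hc.union_far ?_ ?_
    · rw [disjoint_left]
      intro x hx hxH
      rcases hPav x hx with rfl | rfl | h
      · exact disjoint_left.1 (hF.disj O hO) (hA hz) hxH
      · exact disjoint_left.1 (hF.disj O' hO') (hA' hz') hxH
      · exact h (mem_union_left _ (mem_union_right _ hxH))
    · rw [disjoint_left]
      intro x hx hxb
      have hxb' := ball_subset_of_subset (singleton_subset_iff.2 hy) _ hxb
      rcases hPav x hx with rfl | rfl | h
      · exact disjoint_left.1 (hF.far O hO O'' hO'' h1.symm) (subset_ball _ _ _ (hA hz))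
          (ball_mono H _ s.R_succ_le hxb')
      · exact disjoint_left.1 (hF.far O' hO' O'' hO'' h2.symm) (subset_ball _ _ _ (hA' hz'))
          (ball_mono H _ s.R_succ_le hxb')
      · exact h (mem_union_right _ ((hmemN x).2 ⟨O'', hO'', h1, h2, hxb'⟩))

end Link

section Chain
open scoped Classical
open Finset

variable {V : Type*} [Fintype V] {G : SimpleGraph V} {d Kc : ℕ}

/-- Unused members `𝒰` of a family `𝒪` of objects, sparse with respect to the set `W` of occupied
vertices and disjoint from the set `U` of used vertices. -/
structure Pool (G : SimpleGraph V) (H : Finset V) (s : Scale) (𝒪 : Finset (Finset V)) (c₀ : ℕ)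
    (U W : Finset V) (𝒰 : Finset (Finset V)) : Prop where
  used : U ⊆ W
  objects : ∀ O ∈ 𝒪, O ⊆ W
  sub : 𝒰 ⊆ 𝒪
  disj : ∀ C ∈ 𝒰, Disjoint C U
  sparse : ∀ C ∈ 𝒰, ∀ z ∈ C, Sparse G H s.R z W c₀

/-- `C` carries two paths with the same ends whose lengths differ by two. -/
def Adjusting (G : SimpleGraph V) (C : Finset V) (M : ℕ) : Prop :=
  ∃ v₁ v₂ b, 1 ≤ b ∧ b ≤ M ∧ PathIn G (C : Set V) v₁ v₂ b ∧ PathIn G (C : Set V) v₁ v₂ (b + 2)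

omit [Fintype V] in
theorem Adjusting.exists_ends {C : Finset V} {M : ℕ} (h : Adjusting G C M) :
    ∃ v₁ v₂ b, 1 ≤ b ∧ b ≤ M ∧ v₁ ∈ C ∧ v₂ ∈ C ∧
      ∀ z ∈ ({v₁, v₂} : Finset V), ∃ z' ∈ ({v₁, v₂} : Finset V),
        PathIn G (C : Set V) z z' b ∧ PathIn G (C : Set V) z z' (b + 2) := by
  obtain ⟨v₁, v₂, b, h1, h2, h3, h4⟩ := h
  refine ⟨v₁, v₂, b, h1, h2, h3.left_mem, h3.right_mem, fun z hz => ?_⟩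
  rcases mem_insert.1 hz with rfl | hz
  · exact ⟨v₂, by simp, h3, h4⟩
  · obtain rfl := mem_singleton.1 hz
    exact ⟨v₁, by simp, h3.symm, h4.symm⟩

/-- A chain of `f` adjusters starting at the core vertex `x₀` and ending at `e`. -/
structure Chain (G : SimpleGraph V) (H : Finset V) (s : Scale) (𝒪 : Finset (Finset V))
    (c₀ q s₀ Lb : ℕ) (Q : Finset V) (x₀ : V) (U₀ W₀ : Finset V) (𝒰₀ : Finset (Finset V))
    (j f b : ℕ) (S : Finset V) (e : V) (O U W : Finset V) (𝒰 : Finset (Finset V)) : Prop where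
  pool : Pool G H s 𝒪 c₀ U W 𝒰
  f_le : f ≤ j
  b_le : b ≤ f * s₀
  b_le' : b ≤ Lb + s₀
  progress : j ≤ b ∨ Lb ≤ b
  flex : ∀ i ≤ f, PathIn G (S : Set V) x₀ e (b + 2 * i)
  U_mono : U₀ ⊆ U
  S_sub : S ⊆ U
  avoid : ∀ x ∈ S, x = x₀ ∨ (x ∉ U₀ ∧ x ∉ Q)
  O_mem : O ∈ 𝒪
  e_mem : e ∈ O
  O_not_mem : O ∉ 𝒰
  O_eq : O = {x₀} ∨ O ∈ 𝒰₀
  e_sparse : Sparse G H s.R e W q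
  sub : 𝒰 ⊆ 𝒰₀
  card : 𝒰₀.card ≤ 𝒰.card + j
  start_sparse : Sparse G H s.R x₀ W (q + 1)
  cores : ∀ y ∈ Q, y ≠ x₀ → ∀ c, Sparse G H s.R y W₀ c → Sparse G H s.R y W c
  W_mono : W₀ ⊆ W
  W_card : W.card ≤ W₀.card + j * s₀

theorem Chain.step (hG : Good G d Kc) {s : Scale} (hs : s.Valid d Kc (Fintype.card V))
    {H : Finset V} {𝒪 : Finset (Finset V)} (hF : Field G H s d 𝒪)
    {c₀ q s₀ Lb M : ℕ} {Q : Finset V} {x₀ : V} {U₀ W₀ : Finset V} {𝒰₀ : Finset (Finset V)}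
    {j f b : ℕ} {S : Finset V} {e : V} {O U W : Finset V} {𝒰 : Finset (Finset V)}
    (hQ : ∀ x ∈ Q, {x} ∈ 𝒪 ∧ {x} ∉ 𝒰₀) (hx₀ : x₀ ∈ Q) (hU₀ : ∀ C ∈ 𝒰₀, Adjusting G C M)
    (hc₀ : c₀ + 1 ≤ q) (hq : q ≤ s.c) (hs₀ : s.L + M ≤ s₀)
    (hj : W₀.card + j * s₀ ≤ s.w) (hcard : j < 𝒰₀.card)
    (h : Chain G H s 𝒪 c₀ q s₀ Lb Q x₀ U₀ W₀ 𝒰₀ j f b S e O U W 𝒰) :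
    ∃ f b S e O U W 𝒰, Chain G H s 𝒪 c₀ q s₀ Lb Q x₀ U₀ W₀ 𝒰₀ (j + 1) f b S e O U W 𝒰 := by
  by_cases hb : Lb ≤ b
  · exact ⟨f, b, S, e, O, U, W, 𝒰, { h with
      f_le := h.f_le.trans (Nat.le_succ j)
      progress := Or.inr hb
      card := by have := h.card; omega
      W_card := h.W_card.trans (by rw [Nat.succ_mul]; omega) }⟩
  obtain ⟨C, hC⟩ : 𝒰.Nonempty := card_pos.1 (by have := h.card; omega)
  obtain ⟨v₁, v₂, b', hb1, hb2, hv₁, hv₂, hends⟩ := (hU₀ C (h.sub hC)).exists_ends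
  have hC𝒪 := h.pool.sub hC
  have hOC : O ≠ C := fun hOC => h.O_not_mem (hOC ▸ hC)
  have hsub : ({v₁, v₂} : Finset V) ⊆ C := by
    intro x hx
    rcases mem_insert.1 hx with rfl | hx
    · exact hv₁
    · rwa [mem_singleton.1 hx]
  obtain ⟨z, hz, v, hv, m, hm1, hm2, P, hPc, hP, hPav, hPnear, hPfar⟩ :=
    hF.link hG hs h.O_mem hC𝒪 hOC h.pool.objects (h.W_card.trans hj)
      (singleton_subset_iff.2 h.e_mem) hsub (singleton_nonempty e) ⟨v₁, mem_insert_self _ _⟩ (by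
        intro z hz
        rcases mem_union.1 hz with hz | hz
        · rw [mem_singleton.1 hz]; exact h.e_sparse.mono hq
        · exact (h.pool.sparse C hC z (hsub hz)).mono (by omega))
  obtain rfl := mem_singleton.1 hz
  obtain ⟨v', hv', hpath, hpath'⟩ := hends v hv
  have hSW : S ⊆ W := h.S_sub.trans h.pool.used
  have hCW := h.pool.objects C hC𝒪
  have hCU := disjoint_left.1 (h.pool.disj C hC)
  have hSP : ∀ x ∈ S, x ∈ P → x = z := by
    intro x hxS hxP
    rcases hPav x hxP with h1 | rfl | h1
    exacts [h1, absurd (h.S_sub hxS) (hCU (hsub hv)), absurd (hSW hxS) h1]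
  have hzC : z ∉ C := fun hzC => disjoint_left.1 (hF.far O h.O_mem C hC𝒪 hOC)
    (subset_ball _ _ _ h.e_mem) (subset_ball _ _ _ hzC)
  have hSPC : ∀ x ∈ S ∪ P, x ∈ C → x = v := by
    intro x hx hxC
    rcases mem_union.1 hx with hx | hx
    · exact absurd (h.S_sub hx) (hCU hxC)
    · rcases hPav x hx with rfl | h1 | h1
      exacts [absurd hxC hzC, h1, absurd (hCW hxC) h1]
  have hCQ : ∀ x ∈ C, x ∉ Q := by
    intro x hxC hxQ
    refine disjoint_left.1 (hF.far C hC𝒪 {x} (hQ x hxQ).1 ?_)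
      (subset_ball _ _ _ hxC) (subset_ball _ _ _ (mem_singleton_self x))
    rintro rfl
    exact (hQ x hxQ).2 (h.sub hC)
  have hQW : Q ⊆ W := fun x hx => h.pool.objects _ (hQ x hx).1 (mem_singleton_self x)
  have hPL : m + b' ≤ s₀ := by omega
  have hfar' : ∀ C' ∈ 𝒪, C' ≠ O → C' ≠ C → ∀ z ∈ C', ∀ c,
      Sparse G H s.R z W c → Sparse G H s.R z (W ∪ P) c := hPfar
  refine ⟨f + 1, b + m + b', (S ∪ P) ∪ C, v', C, (U ∪ P) ∪ C, W ∪ P, 𝒰.erase C, ?_⟩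
  refine
    { pool := ?_, f_le := Nat.succ_le_succ h.f_le, b_le := ?_, b_le' := by omega, progress := ?_,
      flex := ?_, U_mono := ?_, S_sub := ?_, avoid := ?_, O_mem := hC𝒪, e_mem := hsub hv',
      O_not_mem := notMem_erase C 𝒰, O_eq := Or.inr (h.sub hC), e_sparse := ?_,
      sub := (erase_subset _ _).trans h.sub, card := ?_, start_sparse := ?_, cores := ?_,
      W_mono := h.W_mono.trans subset_union_left, W_card := ?_ }
  · refine ⟨?_, fun O hO => (h.pool.objects O hO).trans subset_union_left,
      (erase_subset _ _).trans h.pool.sub, ?_, ?_⟩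
    · exact union_subset (union_subset_union_left h.pool.used) (hCW.trans subset_union_left)
    · intro C' hC'
      obtain ⟨hne, hC'⟩ := mem_erase.1 hC'
      have hC'𝒪 := h.pool.sub hC'
      have hCC' := hF.far C hC𝒪 C' hC'𝒪 hne.symm
      rw [disjoint_left]
      intro x hx hx'
      rcases mem_union.1 hx' with hx' | hx'
      · rcases mem_union.1 hx' with hx' | hx'
        · exact disjoint_left.1 (h.pool.disj C' hC') hx hx'
        · rcases hPav x hx' with rfl | rfl | h1
          · refine disjoint_left.1 (hF.far O h.O_mem C' hC'𝒪 ?_)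
              (subset_ball _ _ _ h.e_mem) (subset_ball _ _ _ hx)
            rintro rfl
            exact h.O_not_mem hC'
          · exact disjoint_left.1 hCC' (subset_ball _ _ _ (hsub hv)) (subset_ball _ _ _ hx)
          · exact h1 (h.pool.objects C' hC'𝒪 hx)
      · exact disjoint_left.1 hCC' (subset_ball _ _ _ hx') (subset_ball _ _ _ hx)
    · intro C' hC' y hy
      obtain ⟨hne, hC'⟩ := mem_erase.1 hC'
      exact hPfar C' (h.pool.sub hC') (fun hCO => h.O_not_mem (hCO ▸ hC')) hne y hy _
        (h.pool.sparse C' hC' y hy)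
  · have := h.b_le
    rw [Nat.succ_mul]; omega
  · rcases h.progress with h1 | h1
    · left; omega
    · right; omega
  · intro i hi
    have hadj : ∃ i' ≤ f, PathIn G (C : Set V) v v' (b' + 2 * (i - i')) ∧ i' ≤ i := by
      rcases Nat.lt_or_ge f i with h1 | h1
      · refine ⟨f, le_rfl, ?_, h1.le⟩
        have : i - f = 1 := by omega
        rw [this]; exact hpath'
      · exact ⟨i, h1, by simpa using hpath, le_rfl⟩
    obtain ⟨i', hi', hp, hii⟩ := hadj
    have h1 := ((h.flex i' hi').append hP (fun x hx hx' => hSP x (mem_coe.1 hx) (mem_coe.1 hx')))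
    have h2 := h1.append hp (fun x hx hx' => hSPC x
      (by rw [← mem_coe, coe_union]; exact hx) (mem_coe.1 hx'))
    have e1 : b + 2 * i' + m + (b' + 2 * (i - i')) = b + m + b' + 2 * i := by omega
    rw [e1] at h2
    rw [coe_union, coe_union]
    exact h2
  · exact h.U_mono.trans (subset_union_left.trans subset_union_left)
  · exact union_subset_union_left (union_subset_union_left h.S_sub)
  · intro x hx
    rcases mem_union.1 hx with hx | hx
    · rcases mem_union.1 hx with hx | hx
      · exact h.avoid x hx
      · rcases hPav x hx with rfl | rfl | h1
        · exact h.avoid x (h.flex 0 (Nat.zero_le _)).right_mem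
        · exact Or.inr ⟨fun hxU => hCU (hsub hv) (h.U_mono hxU), hCQ x (hsub hv)⟩
        · exact Or.inr ⟨fun hxU => h1 (h.pool.used (h.U_mono hxU)), fun hxQ => h1 (hQW hxQ)⟩
    · exact Or.inr ⟨fun hxU => hCU hx (h.U_mono hxU), hCQ x hx⟩
  · exact (hPnear v' (mem_union_right _ hv') _ (h.pool.sparse C hC v' (hsub hv'))).mono hc₀
  · have h1 := h.card
    have h2 := card_erase_add_one hC
    omega
  · by_cases hO : O = {x₀}
    · have hzx : z = x₀ := by have := h.e_mem; rw [hO] at this; exact mem_singleton.1 this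
      have := hPnear z (mem_union_left _ (mem_singleton_self z)) _ h.e_sparse
      rwa [hzx] at this
    · refine hPfar {x₀} (hQ x₀ hx₀).1 (fun h => hO h.symm) ?_ x₀ (mem_singleton_self _) _
        h.start_sparse
      rintro rfl
      exact (hQ x₀ hx₀).2 (h.sub hC)
  · intro y hy hyx c hc
    refine hPfar {y} (hQ y hy).1 ?_ ?_ y (mem_singleton_self _) _ (h.cores y hy hyx c hc)
    · rintro rfl
      rcases h.O_eq with h1 | h1
      · exact hyx (singleton_injective h1)
      · exact (hQ y hy).2 h1
    · rintro rfl
      exact (hQ y hy).2 (h.sub hC)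
  · have h1 := card_union_le W P
    have h2 := h.W_card
    rw [Nat.succ_mul]; omega

theorem Chain.exists_chain (hG : Good G d Kc) {s : Scale} (hs : s.Valid d Kc (Fintype.card V))
    {H : Finset V} {𝒪 : Finset (Finset V)} (hF : Field G H s d 𝒪)
    {c₀ q s₀ Lb M : ℕ} {Q : Finset V} {x₀ : V} {U₀ W₀ : Finset V} {𝒰₀ : Finset (Finset V)}
    (hQ : ∀ x ∈ Q, {x} ∈ 𝒪 ∧ {x} ∉ 𝒰₀) (hx₀ : x₀ ∈ Q) (hU₀ : ∀ C ∈ 𝒰₀, Adjusting G C M)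
    (hc₀ : c₀ + 1 ≤ q) (hq : q ≤ s.c) (hs₀ : s.L + M ≤ s₀)
    (hpool : Pool G H s 𝒪 c₀ U₀ W₀ 𝒰₀) (hx : Sparse G H s.R x₀ W₀ q) (j : ℕ)
    (hj : W₀.card + j * s₀ ≤ s.w) (hcard : j ≤ 𝒰₀.card) :
    ∃ f b S e O U W 𝒰, Chain G H s 𝒪 c₀ q s₀ Lb Q x₀ U₀ W₀ 𝒰₀ j f b S e O U W 𝒰 := by
  induction j with
  | zero =>
    have hxC : ∀ C ∈ 𝒰₀, x₀ ∉ C := by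
      intro C hC hxC
      refine disjoint_left.1 (hF.far C (hpool.sub hC) {x₀} (hQ x₀ hx₀).1 ?_)
        (subset_ball _ _ _ hxC) (subset_ball _ _ _ (mem_singleton_self x₀))
      rintro rfl
      exact (hQ x₀ hx₀).2 hC
    refine ⟨0, 0, {x₀}, x₀, {x₀}, insert x₀ U₀, W₀, 𝒰₀, ?_⟩
    exact
      { pool := ⟨insert_subset (hpool.objects _ (hQ x₀ hx₀).1 (mem_singleton_self _)) hpool.used,
          hpool.objects, hpool.sub,
          fun C hC => disjoint_insert_right.2 ⟨hxC C hC, hpool.disj C hC⟩, hpool.sparse⟩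
        f_le := le_rfl
        b_le := Nat.zero_le _
        b_le' := Nat.zero_le _
        progress := Or.inl (Nat.zero_le _)
        flex := fun i hi => by
          obtain rfl := Nat.le_zero.1 hi
          exact PathIn.refl (by simp)
        U_mono := subset_insert _ _
        S_sub := singleton_subset_iff.2 (mem_insert_self _ _)
        avoid := fun x hx => Or.inl (mem_singleton.1 hx)
        O_mem := (hQ x₀ hx₀).1
        e_mem := mem_singleton_self _
        O_not_mem := (hQ x₀ hx₀).2
        O_eq := Or.inl rfl
        e_sparse := hx
        sub := Subset.rfl
        card := le_rfl
        start_sparse := hx.mono (Nat.le_succ _)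
        cores := fun _ _ _ _ h => h
        W_mono := Subset.rfl
        W_card := by omega }
  | succ j ih =>
    rw [Nat.succ_mul] at hj
    obtain ⟨f, b, S, e, O, U, W, 𝒰, h⟩ := ih (by omega) (by omega)
    exact h.step hG hs hF hQ hx₀ hU₀ hc₀ hq hs₀ (by omega) (by omega)

end Chain

section Assembly
open scoped Classical
open Finset

variable {V : Type*} [Fintype V] {G : SimpleGraph V} {d Kc : ℕ}

omit [Fintype V] in
theorem even_of_pathIn {f : V → Bool} (hf : ∀ u v, G.Adj u v → f u ≠ f v) {S : Set V} {a b : V}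
    {r : ℕ} (h : PathIn G S a b r) (hab : f a = f b) : Even r := by
  obtain ⟨p, -, rfl, -⟩ := h
  have := (SimpleGraph.Coloring.even_length_iff_congr
    (SimpleGraph.Coloring.mk f (fun {u v} h => hf u v h)) p).2
  exact this (by
    show (f a = true) ↔ (f b = true)
    rw [hab])

theorem Chain.finish (hG : Good G d Kc) {s : Scale} (hs : s.Valid d Kc (Fintype.card V))
    {H : Finset V} {𝒪 : Finset (Finset V)} (hF : Field G H s d 𝒪)
    {f : V → Bool} (hf : ∀ u v, G.Adj u v → f u ≠ f v)
    {c₀ q s₀ : ℕ} {Q : Finset V} {x₀ y₀ : V} {U₀ W₀ : Finset V} {𝒰₀ : Finset (Finset V)}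
    {fl b : ℕ} {S : Finset V} {e : V} {O U W : Finset V} {𝒰 : Finset (Finset V)}
    (hQ : ∀ x ∈ Q, {x} ∈ 𝒪 ∧ {x} ∉ 𝒰₀) (hx₀ : x₀ ∈ Q) (hy₀ : y₀ ∈ Q) (hxy : x₀ ≠ y₀)
    (hcol : f x₀ = f y₀) (hq : q ≤ s.c) (hs₀ : s.L + 1 ≤ s₀) (heven : Even s₀)
    (hj : W₀.card + s₀ ^ 2 * s₀ ≤ s.w) {q' : ℕ} (hy : Sparse G H s.R y₀ W₀ q') (hq' : q' ≤ s.c)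
    (h : Chain G H s 𝒪 c₀ q s₀ (s₀ ^ 2) Q x₀ U₀ W₀ 𝒰₀ (s₀ ^ 2) fl b S e O U W 𝒰) :
    ∃ S : Finset V, PathIn G (S : Set V) x₀ y₀ (s₀ ^ 2 + 2 * s₀) ∧
      (∀ x ∈ S, x = x₀ ∨ x = y₀ ∨ (x ∉ U₀ ∧ x ∉ Q)) ∧
      ∃ U W 𝒰, U₀ ⊆ U ∧ S ⊆ U ∧ Pool G H s 𝒪 c₀ U W 𝒰 ∧ 𝒰 ⊆ 𝒰₀ ∧ 𝒰₀.card ≤ 𝒰.card + s₀ ^ 2 ∧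
        W.card ≤ W₀.card + (s₀ ^ 2 + 1) * s₀ ∧ Sparse G H s.R x₀ W (q + 1) ∧
        Sparse G H s.R y₀ W (q' + 1) ∧
        ∀ y ∈ Q, y ≠ x₀ → y ≠ y₀ → ∀ c, Sparse G H s.R y W₀ c → Sparse G H s.R y W c := by
  have hOy : O ≠ {y₀} := by
    rintro rfl
    rcases h.O_eq with h1 | h1
    · exact hxy (singleton_injective h1).symm
    · exact (hQ y₀ hy₀).2 h1
  have hyW := h.cores y₀ hy₀ hxy.symm _ hy
  obtain ⟨z, hz, v, hv, m, hm1, hm2, P, hPc, hP, hPav, hPnear, hPfar⟩ :=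
    hF.link hG hs h.O_mem (hQ y₀ hy₀).1 hOy h.pool.objects (h.W_card.trans hj)
      (singleton_subset_iff.2 h.e_mem) Subset.rfl (singleton_nonempty e) (singleton_nonempty y₀) (by
        intro z hz
        rcases mem_union.1 hz with hz | hz
        · rw [mem_singleton.1 hz]; exact h.e_sparse.mono hq
        · rw [mem_singleton.1 hz]; exact hyW.mono hq')
  obtain rfl := mem_singleton.1 hz
  obtain rfl := mem_singleton.1 hv
  have hSW : S ⊆ W := h.S_sub.trans h.pool.used
  have hQW : Q ⊆ W := fun x hx => h.pool.objects _ (hQ x hx).1 (mem_singleton_self x)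
  have hSP : ∀ x ∈ S, x ∈ P → x = z := by
    intro x hxS hxP
    rcases hPav x hxP with h1 | rfl | h1
    · exact h1
    · rcases h.avoid x hxS with h2 | h2
      exacts [absurd h2.symm hxy, absurd hy₀ h2.2]
    · exact absurd (hSW hxS) h1
  have hb : s₀ ^ 2 ≤ b := h.progress.elim id id
  have hfl : s₀ ≤ fl := by
    have h1 : s₀ * s₀ ≤ fl * s₀ := by rw [← sq]; exact hb.trans h.b_le
    exact Nat.le_of_mul_le_mul_right h1 (by omega)
  have hbm : Even (b + m) := even_of_pathIn hf
    (((h.flex 0 (Nat.zero_le _)).append hP (fun x hx hx' =>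
      hSP x (mem_coe.1 hx) (mem_coe.1 hx')))) hcol
  have hb' := h.b_le'
  obtain ⟨i, hi⟩ : ∃ i, s₀ ^ 2 + 2 * s₀ = b + m + 2 * i := by
    obtain ⟨t, ht⟩ := hbm
    have h1 : Even (s₀ ^ 2) := heven.pow_of_ne_zero two_ne_zero
    obtain ⟨t', ht'⟩ := h1
    exact ⟨t' + s₀ - t, by omega⟩
  have hil : i ≤ fl := by omega
  refine ⟨S ∪ P, ?_, ?_, U ∪ P, W ∪ P, 𝒰, ?_, ?_, ?_, h.sub, h.card, ?_, ?_, ?_, ?_⟩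
  · have h1 := (h.flex i hil).append hP (fun x hx hx' => hSP x (mem_coe.1 hx) (mem_coe.1 hx'))
    have e1 : b + 2 * i + m = s₀ ^ 2 + 2 * s₀ := by omega
    rw [e1] at h1
    rw [coe_union]
    exact h1
  · intro x hx
    rcases mem_union.1 hx with hx | hx
    · exact (h.avoid x hx).elim Or.inl fun h1 => Or.inr (Or.inr h1)
    · rcases hPav x hx with rfl | rfl | h1
      · exact (h.avoid x (h.flex 0 (Nat.zero_le _)).right_mem).elim Or.inl
          fun h1 => Or.inr (Or.inr h1)
      · exact Or.inr (Or.inl rfl)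
      · exact Or.inr (Or.inr ⟨fun hxU => h1 (h.pool.used (h.U_mono hxU)), fun hxQ => h1 (hQW hxQ)⟩)
  · exact h.U_mono.trans subset_union_left
  · exact union_subset_union_left h.S_sub
  · refine ⟨union_subset_union_left h.pool.used,
      fun O hO => (h.pool.objects O hO).trans subset_union_left, h.pool.sub, ?_, ?_⟩
    · intro C hC
      have hC𝒪 := h.pool.sub hC
      rw [disjoint_left]
      intro x hx hx'
      rcases mem_union.1 hx' with hx' | hx'
      · exact disjoint_left.1 (h.pool.disj C hC) hx hx'
      · rcases hPav x hx' with rfl | rfl | h1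
        · refine disjoint_left.1 (hF.far O h.O_mem C hC𝒪 ?_)
            (subset_ball _ _ _ h.e_mem) (subset_ball _ _ _ hx)
          rintro rfl
          exact h.O_not_mem hC
        · refine disjoint_left.1 (hF.far {x} (hQ x hy₀).1 C hC𝒪 ?_)
            (subset_ball _ _ _ (mem_singleton_self x)) (subset_ball _ _ _ hx)
          rintro rfl
          exact (hQ x hy₀).2 (h.sub hC)
        · exact h1 (h.pool.objects C hC𝒪 hx)
    · intro C hC y hy
      refine hPfar C (h.pool.sub hC) (fun hCO => h.O_not_mem (hCO ▸ hC)) ?_ y hy _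
        (h.pool.sparse C hC y hy)
      rintro rfl
      exact (hQ v hy₀).2 (h.sub hC)
  · have h1 := card_union_le W P
    have h2 := h.W_card
    rw [Nat.succ_mul]; omega
  · by_cases hO : O = {x₀}
    · have hzx : z = x₀ := by have := h.e_mem; rw [hO] at this; exact mem_singleton.1 this
      have := hPnear z (mem_union_left _ (mem_singleton_self z)) _ h.e_sparse
      rwa [hzx] at this
    · exact hPfar {x₀} (hQ x₀ hx₀).1 (fun h => hO h.symm) (fun h => hxy (singleton_injective h)) x₀
        (mem_singleton_self _) _ h.start_sparse
  · exact hPnear v (mem_union_right _ (mem_singleton_self v)) _ hyW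
  · intro y hy hyx hyy c hc
    refine hPfar {y} (hQ y hy).1 ?_ (fun h => hyy (singleton_injective h)) y (mem_singleton_self _) _
      (h.cores y hy hyx c hc)
    rintro rfl
    rcases h.O_eq with h1 | h1
    · exact hyx (singleton_injective h1)
    · exact (hQ y hy).2 h1

theorem card_incident_le {k : ℕ} (D : Finset (Fin k × Fin k)) (i : Fin k) :
    (D.filter fun p => p.1 = i ∨ p.2 = i).card ≤ 2 * k := by
  have h : (D.filter fun p => p.1 = i ∨ p.2 = i) ⊆
      (univ.image fun j : Fin k => (i, j)) ∪ univ.image fun j : Fin k => (j, i) := by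
    rintro ⟨a, b⟩ hp
    rcases (mem_filter.1 hp).2 with h | h
    · exact mem_union_left _ (mem_image.2 ⟨b, mem_univ _, by simp at h; rw [h]⟩)
    · exact mem_union_right _ (mem_image.2 ⟨a, mem_univ _, by simp at h; rw [h]⟩)
  refine (card_le_card h).trans ((card_union_le _ _).trans ?_)
  have h1 : (univ.image fun j : Fin k => (i, j)).card ≤ k := card_image_le.trans (by simp)
  have h2 : (univ.image fun j : Fin k => (j, i)).card ≤ k := card_image_le.trans (by simp)
  omega

theorem balSub_of_field (hG : Good G d Kc) {s : Scale} (hs : s.Valid d Kc (Fintype.card V))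
    {H : Finset V} {𝒪 : Finset (Finset V)} (hF : Field G H s d 𝒪)
    {f : V → Bool} (hf : ∀ u v, G.Adj u v → f u ≠ f v)
    {c₀ s₀ M k : ℕ} {𝒜 : Finset (Finset V)} (c : Fin k → V) (hc : Function.Injective c)
    (hcol : ∀ i j, f (c i) = f (c j)) (hc𝒪 : ∀ i, {c i} ∈ 𝒪 ∧ {c i} ∉ 𝒜) (h𝒜 : 𝒜 ⊆ 𝒪)
    (hadj : ∀ C ∈ 𝒜, Adjusting G C M) (hs₀ : s.L + M + 1 ≤ s₀) (heven : Even s₀)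
    (hsp : ∀ O ∈ 𝒪, ∀ z ∈ O, Sparse G H s.R z (𝒪.biUnion id) c₀)
    (hsc : c₀ + 1 + 2 * k ≤ s.c) (hcard : k ^ 2 * s₀ ^ 2 ≤ 𝒜.card)
    (hw : (𝒪.biUnion id).card + k ^ 2 * ((s₀ ^ 2 + 1) * s₀) ≤ s.w) :
    ContainsBalSub G k (s₀ ^ 2 + 2 * s₀) := by
  have hQ : ∀ 𝒰 ⊆ 𝒜, ∀ x ∈ univ.image c, {x} ∈ 𝒪 ∧ {x} ∉ 𝒰 := by
    intro 𝒰 h𝒰 x hx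
    obtain ⟨i, -, rfl⟩ := mem_image.1 hx
    exact ⟨(hc𝒪 i).1, fun h => (hc𝒪 i).2 (h𝒰 h)⟩
  have hcQ : ∀ i, c i ∈ univ.image c := fun i => mem_image_of_mem c (mem_univ i)
  refine greedy c hc (fun D U => ∃ W 𝒰, Pool G H s 𝒪 c₀ U W 𝒰 ∧ 𝒰 ⊆ 𝒜 ∧
    𝒜.card ≤ 𝒰.card + D.card * s₀ ^ 2 ∧
    W.card ≤ (𝒪.biUnion id).card + D.card * ((s₀ ^ 2 + 1) * s₀) ∧
    ∀ i, Sparse G H s.R (c i) W (c₀ + 1 + (D.filter fun p => p.1 = i ∨ p.2 = i).card)) ∅ ?_ ?_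
  · refine ⟨𝒪.biUnion id, 𝒜, ⟨empty_subset _, fun O hO => subset_biUnion_of_mem id hO, h𝒜,
      fun C _ => disjoint_empty_right C, fun C hC => hsp C (h𝒜 hC)⟩, Subset.rfl, by simp, by simp,
      fun i => ?_⟩
    exact (hsp _ (hc𝒪 i).1 _ (mem_singleton_self _)).mono (by omega)
  · rintro D U ⟨W, 𝒰, hpool, h𝒰, h1, h2, h3⟩ p hp hpD
    have hDk : D.card + 1 ≤ k ^ 2 := by
      have := card_le_univ (insert p D)
      rw [card_insert_of_notMem hpD] at this
      simpa [sq] using this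
    have hD1 : (D.card + 1) * s₀ ^ 2 ≤ k ^ 2 * s₀ ^ 2 := Nat.mul_le_mul_right _ hDk
    have hD2 : (D.card + 1) * ((s₀ ^ 2 + 1) * s₀) ≤ k ^ 2 * ((s₀ ^ 2 + 1) * s₀) :=
      Nat.mul_le_mul_right _ hDk
    rw [Nat.succ_mul] at hD1 hD2
    have e1 : (s₀ ^ 2 + 1) * s₀ = s₀ ^ 2 * s₀ + s₀ := Nat.succ_mul _ _
    have hi := card_incident_le D p.1
    have hj := card_incident_le D p.2
    obtain ⟨fl, b, S, e, O, U', W', 𝒰', hch⟩ := Chain.exists_chain hG hs hF (Lb := s₀ ^ 2) (M := M) (s₀ := s₀)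
      (hQ 𝒰 h𝒰) (hcQ p.1) (fun C hC => hadj C (h𝒰 hC)) (by omega) (by omega) (by omega)
      hpool (h3 p.1) (s₀ ^ 2) (by omega) (by omega)
    obtain ⟨S, hS1, hS2, U'', W'', 𝒰'', hU, hSU, hpool', h𝒰', h4, h5, h6, h7, h8⟩ :=
      hch.finish hG hs hF hf (hQ 𝒰 h𝒰) (hcQ p.1) (hcQ p.2) (fun h => hp.ne (hc h)) (hcol _ _)
        (by omega) (by omega) heven (by omega) (h3 p.2) (by omega)
    refine ⟨S, hS1, fun x hx => ?_, U'', hU, hSU, W'', 𝒰'', hpool', h𝒰'.trans h𝒰, ?_, ?_, ?_⟩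
    · rcases hS2 x hx with h | h | h
      exacts [Or.inl h, Or.inr (Or.inl h),
        Or.inr (Or.inr ⟨h.1, fun q hq => h.2 (hq ▸ hcQ q)⟩)]
    · rw [card_insert_of_notMem hpD, Nat.succ_mul]; omega
    · rw [card_insert_of_notMem hpD, Nat.succ_mul]; omega
    · intro i
      rw [filter_insert]
      by_cases hpi : p.1 = i ∨ p.2 = i
      · rw [if_pos hpi, card_insert_of_notMem fun h => hpD (mem_filter.1 h).1]
        rcases hpi with rfl | rfl
        exacts [h6, h7]
      · rw [if_neg hpi]
        exact h8 (c i) (hcQ i) (fun h => hpi (Or.inl (hc h).symm))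
          (fun h => hpi (Or.inr (hc h).symm)) _ (h3 i)

end Assembly

section Cycles
open scoped Classical
open Finset

variable {V : Type*} {G : SimpleGraph V}

/-- There is a cycle of length `r` inside `S`. -/
def CycleIn (G : SimpleGraph V) (S : Set V) (r : ℕ) : Prop :=
  ∃ w, ∃ c : G.Walk w w, c.IsCycle ∧ c.length = r ∧ ∀ x ∈ c.support, x ∈ S

theorem CycleIn.mono {S S' : Set V} {r : ℕ} (h : CycleIn G S r) (hS : S ⊆ S') : CycleIn G S' r := by
  obtain ⟨w, c, h1, h2, h3⟩ := h
  exact ⟨w, c, h1, h2, fun x hx => hS (h3 x hx)⟩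

theorem cycleIn_of_ne {S : Set V} {a b : V} {p q : G.Walk a b} (hp : p.IsPath) (hq : q.IsPath)
    (hne : p ≠ q) (hpS : ∀ x ∈ p.support, x ∈ S) (hqS : ∀ x ∈ q.support, x ∈ S) :
    ∃ r ≤ p.length + q.length, CycleIn G S r := by
  obtain ⟨w, -, -, c, hc, hs⟩ := hp.exists_isCycle_sublist_of_ne hq hne
  refine ⟨c.length, ?_, w, c, hc, rfl, fun x hx => ?_⟩
  · have := hs.length_le
    simp only [List.length_append, List.length_tail, List.length_reverse,
      SimpleGraph.Walk.length_support] at this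
    omega
  · have := hs.subset hx
    rcases List.mem_append.1 this with h | h
    · exact hpS x h
    · exact hqS x (List.mem_reverse.1 (List.mem_of_mem_tail h))

theorem getVert_near_of_shortest {S : Set V} {γ : ℕ} (hγ : ∀ r, CycleIn G S r → γ ≤ r) {z q : V}
    {c : G.Walk z z} (hc : c.IsCycle) (hcS : ∀ x ∈ c.support, x ∈ S) (hL : 2 * c.length ≤ 3 * γ)
    {ρ i : ℕ} (hi : i ≤ c.length) (hq : c.getVert i = q) (h : Reach G S z q ρ) :
    i ≤ ρ ∨ c.length ≤ i + ρ ∨ c.length ≤ 6 * ρ := by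
  subst hq
  obtain ⟨p, hp, hpS⟩ := h
  by_contra! hcon
  have hb := p.length_bypass_le_length
  have hbS : ∀ x ∈ p.bypass.support, x ∈ S := fun x hx => hpS x (p.support_bypass_subset_support hx)
  have h1 : (c.take i).length = i := by rw [SimpleGraph.Walk.take_length]; omega
  have h2 : (c.drop i).reverse.length = c.length - i := by simp
  obtain ⟨r, hr, hrc⟩ := cycleIn_of_ne (S := S) p.bypass_isPath (hc.isPath_take (n := i) (by omega))
    (by intro h; rw [h] at hb; omega) hbS
    (fun x hx => hcS x ((SimpleGraph.Walk.isSubwalk_take c i).support_subset hx))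
  obtain ⟨r', hr', hrc'⟩ := cycleIn_of_ne (S := S) p.bypass_isPath
    (hc.isPath_drop (n := i) (by omega)).reverse
    (by intro h; rw [h] at hb; omega) hbS
    (fun x hx => hcS x ((SimpleGraph.Walk.isSubwalk_drop c i).support_subset (by simpa using hx)))
  have := hγ _ hrc
  have := hγ _ hrc'
  omega

theorem adjusting_of_cycle {S : Finset V} {M : ℕ} {w : V} {c : G.Walk w w} (hc : c.IsCycle)
    (hcS : ∀ x ∈ c.support, x ∈ S) (heven : Even c.length) (hM : c.length ≤ M) :
    Adjusting G S M := by
  obtain ⟨r, hr⟩ := heven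
  have h3 := hc.three_le_length
  refine ⟨w, c.getVert (r - 1), r - 1, by omega, by omega,
    ⟨c.take (r - 1), hc.isPath_take (by omega), ?_, ?_⟩,
    ⟨(c.drop (r - 1)).reverse, (hc.isPath_drop (by omega)).reverse, ?_, ?_⟩⟩
  · rw [SimpleGraph.Walk.take_length]; omega
  · exact fun x hx => hcS x ((SimpleGraph.Walk.isSubwalk_take c _).support_subset hx)
  · rw [SimpleGraph.Walk.length_reverse, SimpleGraph.Walk.drop_length]; omega
  · exact fun x hx => hcS x ((SimpleGraph.Walk.isSubwalk_drop c _).support_subset (by simpa using hx))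

theorem exists_slow_step {g : ℕ → ℕ} {J M : ℕ} (h0 : 0 < g 0) (hJ : g J ≤ M)
    (hM : 2 ^ J * M < 3 ^ J) : ∃ j < J, 2 * g (j + 1) ≤ 3 * g j := by
  by_contra! hcon
  have : ∀ j ≤ J, 3 ^ j ≤ 2 ^ j * g j := by
    intro j
    induction j with
    | zero => intro _; simpa using Nat.succ_le_of_lt h0
    | succ j ih =>
      intro hj
      have h1 := ih (by omega)
      have h2 := hcon j (by omega)
      calc 3 ^ (j + 1) = 3 ^ j * 3 := by ring
        _ ≤ 2 ^ j * g j * 3 := Nat.mul_le_mul_right _ h1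
        _ = 2 ^ j * (3 * g j) := by ring
        _ ≤ 2 ^ j * (2 * g (j + 1)) := Nat.mul_le_mul_left _ h2.le
        _ = _ := by ring
  have h1 := this J le_rfl
  have h2 : 2 ^ J * g J ≤ 2 ^ J * M := Nat.mul_le_mul_left _ hJ
  omega

variable [Fintype V] {d Kc : ℕ}

theorem exists_short_cycle (hG : Good G d Kc) {W : Finset V} {E Δ D : ℕ}
    (hn : Fintype.card V ≤ 2 ^ E) (hΔ : ∀ v ∉ W, (nb G {v}).card ≤ Δ)
    (hD : 2 * E ^ 2 * (W.card + 1) + d + 1 ≤ D)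
    (hV : 2 * ((Δ * D + 1) * (D * (2 * E ^ 3 + 1))) ^ 2 ≤ Fintype.card V) :
    ∃ r ≤ 10 * E ^ 3 + 1, CycleIn G {x | x ∉ W} r := by
  have hdpos := hG.pos
  set D₁ := Δ * D + 1 with hD₁
  set T := 2 * E ^ 3 with hT
  set F := D₁ * (D * (T + 1)) with hF
  have hEpos : 0 < E := by
    rcases Nat.eq_zero_or_pos E with h | h
    · exfalso
      subst h
      have h1 : 1 ≤ F := by
        have : 0 < F := by rw [hF]; exact Nat.mul_pos (by omega) (Nat.mul_pos (by omega) (by omega))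
        omega
      have h2 : 1 ≤ F ^ 2 := Nat.one_le_pow _ _ h1
      simp at hn
      omega
    · exact h
  have hDF : D * (T + 1) ≤ F := Nat.le_mul_of_pos_left _ (by omega)
  have hDF' : D ≤ D * (T + 1) := Nat.le_mul_of_pos_right _ (by omega)
  have hWE : 2 * (W.card + 1) ≤ 2 * E ^ 2 * (W.card + 1) := by
    have : 1 ≤ E ^ 2 := Nat.one_le_pow _ _ hEpos
    nlinarith
  have hWE' : 2 * E ^ 2 * W.card ≤ 2 * E ^ 2 * (W.card + 1) := Nat.mul_le_mul_left _ (by omega)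
  have hfew := few_bad hG (W := W) (D := F) hn (by omega) (by omega) hV
  obtain ⟨v, hvW, hv⟩ : ∃ v, v ∉ W ∧ F ≤ (ball G W {v} T).card := by
    by_contra! hcon
    have h1 : (univ : Finset V) ⊆ W ∪ univ.filter fun v => (ball G W {v} T).card < F := by
      intro v _
      by_cases hvW : v ∈ W
      · exact mem_union_left _ hvW
      · exact mem_union_right _ (mem_filter.2 ⟨mem_univ _, hcon v hvW⟩)
    have h2 := (card_le_card h1).trans (card_union_le _ _)
    rw [card_univ] at h2
    rw [← hT] at hfew
    have h3 : F ≤ F ^ 2 := Nat.le_self_pow (by norm_num) _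
    omega
  obtain ⟨X, hXW, hX⟩ := exists_ball_pole (G := G) (D := D) (r := T) (by omega) hvW (by omega)
  have hXF : D₁ * X.card ≤ (ball G W {v} T).card :=
    (Nat.mul_le_mul_left _ hX.card_le).trans hv
  obtain ⟨y, hyX, hy⟩ := exists_exit hX.mem (by omega) hXF
  have hyW : y ∉ W := fun h => disjoint_left.1 hXW hyX h
  -- some neighbour of `y` outside `W ∪ X` has a large ball
  obtain ⟨s, hsN, hs⟩ : ∃ s ∈ nb G {y} \ (W ∪ X), D ≤ (ball G (W ∪ X) {s} T).card := by
    by_contra! hcon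
    have h1 : ball G (W ∪ X) {y} T ⊆
        {y} ∪ (nb G {y} \ (W ∪ X)).biUnion fun s => ball G (W ∪ X) {s} T := by
      intro x hx
      have hx' := ball_add (G := G) (W := W ∪ X) (A := {y}) 1 T
      have hx1 : x ∈ ball G (W ∪ X) (ball G (W ∪ X) {y} 1) T :=
        ball_subset_of_subset (subset_ball _ _ _) _ hx
      rw [ball_eq_biUnion, mem_biUnion] at hx1
      obtain ⟨s, hs, hx1⟩ := hx1
      rw [ball, ball, mem_union] at hs
      rcases hs with hs | hs
      · obtain rfl := mem_singleton.1 hs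
        by_cases hxs : x = s
        · exact mem_union_left _ (by simpa using hxs)
        obtain ⟨a, ha, p, hp, hps⟩ := ball_reach hx
        obtain rfl := mem_singleton.1 ha
        have hbp := p.bypass_isPath
        have hbl := p.length_bypass_le_length
        have hbs : ∀ z ∈ p.bypass.support, z = a ∨ z ∉ W ∪ X := fun z hz =>
          (hps z (p.support_bypass_subset_support hz)).2
        generalize p.bypass = p' at hbp hbl hbs
        cases p' with
        | nil => exact absurd rfl hxs
        | cons hadj p'' =>
          rename_i s
          rw [SimpleGraph.Walk.cons_isPath_iff] at hbp
          have hsup : ∀ z ∈ p''.support, z ∉ W ∪ X := by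
            intro z hz
            rcases hbs z (by simp [hz]) with rfl | h
            · exact absurd hz hbp.2
            · exact h
          refine mem_union_right _ (mem_biUnion.2 ⟨s, mem_sdiff.2 ⟨mem_nb.2 ⟨?_, a, by simp, hadj⟩,
            hsup _ p''.start_mem_support⟩, ?_⟩)
          · simpa using hadj.ne'
          · have := walk_in_ball (W := W ∪ X) (A := {s}) (i := 0) (mem_singleton_self s) p''
              (fun z hz => Or.inr (hsup z hz))
            refine ball_mono _ _ ?_ this
            rw [SimpleGraph.Walk.length_cons] at hbl
            omega
      · exact mem_union_right _ (mem_biUnion.2 ⟨s, hs, hx1⟩)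
    have h2 := (card_le_card h1).trans (card_union_le _ _)
    rw [card_singleton] at h2
    have h3 : ((nb G {y} \ (W ∪ X)).biUnion fun s => ball G (W ∪ X) {s} T).card ≤
        (nb G {y} \ (W ∪ X)).card * (D - 1) :=
      card_biUnion_le_card_mul _ _ _ fun s hs => by have := hcon s hs; omega
    have h4 : (nb G {y} \ (W ∪ X)).card ≤ Δ := (card_le_card sdiff_subset).trans (hΔ y hyW)
    have h5 : (nb G {y} \ (W ∪ X)).card * (D - 1) ≤ Δ * (D - 1) := Nat.mul_le_mul_right _ h4
    have h6 : Δ * D = Δ * (D - 1) + Δ := by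
      obtain ⟨D', hD'⟩ : ∃ D', D = D' + 1 := ⟨D - 1, by omega⟩
      rw [hD']; simp; ring
    rcases Nat.eq_zero_or_pos Δ with h7 | h7
    · -- then `y` has no neighbours although its degree is positive
      have := hG.deg y
      have := hΔ y hyW
      omega
    · omega
  rw [mem_sdiff, mem_nb, mem_union, not_or] at hsN
  obtain ⟨⟨hsy, y', hy', hadj⟩, hsW, hsX⟩ := hsN
  obtain rfl := mem_singleton.1 hy'
  have hBc : (X.erase y').card = X.card - 1 := card_erase_of_mem hyX
  have hXc := hX.le_card
  have hWy : (insert y' W).card = W.card + 1 := card_insert_of_notMem hyW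
  obtain ⟨a, ha, b, hb, hab⟩ := conn_sets hG (W := insert y' W)
    (A := ball G (W ∪ X) {s} T) (B := X.erase y') hn (by omega) (by rw [hWy]; omega) (by omega)
    (by rw [hWy]; omega)
  have hav : ∀ x ∈ ball G (W ∪ X) {s} T, x ∉ W ∧ x ∉ X := by
    intro x hx
    rcases ball_avoid hx with rfl | h
    · exact ⟨hsW, hsX⟩
    · simpa [not_or] using h
  have hbX := mem_of_mem_erase hb
  have hr1 : Reach G {x | x ≠ y' ∧ x ∉ W} s a T :=
    (ball_reach_singleton ha).mono (fun x hx => ⟨by rintro rfl; exact (hav _ hx).2 hyX,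
      (hav x hx).1⟩) le_rfl
  have hr2 : Reach G {x | x ≠ y' ∧ x ∉ W} a b (4 * E ^ 3) := by
    refine hab.mono ?_ le_rfl
    rintro x (rfl | rfl | h)
    · exact ⟨by rintro rfl; exact (hav _ ha).2 hyX, (hav x ha).1⟩
    · exact ⟨(mem_erase.1 hb).1, disjoint_left.1 hXW hbX⟩
    · simp only [mem_insert, not_or] at h
      exact h
  obtain ⟨ℓ, hℓ, q, hqp, hql, hqs⟩ := (hr1.trans hr2).exists_pathIn
  have hr3 : Reach G (X : Set V) y' b (2 * T) :=
    ((hX.reach y' hyX).symm.trans (hX.reach b hbX)).mono Set.Subset.rfl (by omega)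
  obtain ⟨ℓ', hℓ', p, hpp, hpl, hps⟩ := hr3.exists_pathIn
  obtain ⟨r, hr, hc⟩ := cycleIn_of_ne (S := {x | x ∉ W}) (p := SimpleGraph.Walk.cons hadj q) (q := p)
    (by
      rw [SimpleGraph.Walk.cons_isPath_iff]
      exact ⟨hqp, fun h => (hqs _ h).1 rfl⟩) hpp
    (by
      intro h
      have : s ∈ p.support := by rw [← h]; simp
      exact hsX (hps s this))
    (by
      intro x hx
      rw [SimpleGraph.Walk.support_cons, List.mem_cons] at hx
      rcases hx with rfl | hx
      · exact hyW
      · exact (hqs x hx).2)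
    (fun x hx => disjoint_left.1 hXW (hps x hx))
  refine ⟨r, ?_, hc⟩
  rw [SimpleGraph.Walk.length_cons] at hr
  omega

theorem exists_adjuster (hG : Good G d Kc) {f : V → Bool} (hf : ∀ u v, G.Adj u v → f u ≠ f v)
    {H Y : Finset V} {E Δ D R J M : ℕ}
    (hn : Fintype.card V ≤ 2 ^ E) (hΔ : ∀ v ∉ H, (nb G {v}).card ≤ Δ)
    (hM : 10 * E ^ 3 + 1 ≤ M) (hJ : 2 ^ J * M < 3 ^ J)
    (hD : 2 * E ^ 2 * (H.card + Y.card * (Δ + 1) ^ (J * R) + 1) + d + 1 ≤ D)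
    (hV : 2 * ((Δ * D + 1) * (D * (2 * E ^ 3 + 1))) ^ 2 ≤ Fintype.card V) :
    ∃ C : Finset V, C.Nonempty ∧ C.card ≤ M ∧ Disjoint C H ∧ Disjoint C (ball G H (Y \ H) R) ∧
      Adjusting G C M ∧ ∀ z ∈ C, ∀ ρ ≤ R, (C ∩ ball G H {z} ρ).card ≤ 6 * (ρ + 1) := by
  set W : ℕ → Finset V := fun j => H ∪ ball G H (Y \ H) (j * R) with hW
  have hWmono : ∀ j, W j ⊆ W (j + 1) := fun j =>
    union_subset_union_right (ball_mono H _ (Nat.mul_le_mul_right _ (by omega)))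
  have hcyc : ∀ j ≤ J, ∃ r ≤ 10 * E ^ 3 + 1, CycleIn G {x | x ∉ W j} r := by
    intro j hj
    refine exists_short_cycle hG (Δ := Δ) (D := D) hn
      (fun v hv => hΔ v fun h => hv (mem_union_left _ h)) ?_ hV
    have h1 : (W j).card ≤ H.card + Y.card * (Δ + 1) ^ (J * R) := by
      refine (card_union_le _ _).trans (Nat.add_le_add_left ?_ _)
      refine (ball_card_le hΔ _ sdiff_disjoint _).trans ?_
      exact Nat.mul_le_mul (card_le_card sdiff_subset)
        (Nat.pow_le_pow_right (by omega) (Nat.mul_le_mul_right _ hj))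
    have h2 : 2 * E ^ 2 * ((W j).card + 1) ≤
        2 * E ^ 2 * (H.card + Y.card * (Δ + 1) ^ (J * R) + 1) :=
      Nat.mul_le_mul_left _ (by omega)
    omega
  set g : ℕ → ℕ := fun j => sInf {r | CycleIn G {x | x ∉ W j} r} with hg
  have hgle : ∀ j r, CycleIn G {x | x ∉ W j} r → g j ≤ r := fun j r h => Nat.sInf_le h
  have hgmem : ∀ j ≤ J, CycleIn G {x | x ∉ W j} (g j) := by
    intro j hj
    obtain ⟨r, -, hr⟩ := hcyc j hj
    exact Nat.sInf_mem (s := {r | CycleIn G {x | x ∉ W j} r}) ⟨r, hr⟩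
  have hgM : ∀ j ≤ J, g j ≤ M := by
    intro j hj
    obtain ⟨r, hr, hr'⟩ := hcyc j hj
    exact (hgle j r hr').trans (hr.trans hM)
  obtain ⟨j, hjJ, hj⟩ := exists_slow_step (g := g) (J := J) (M := M) (by
    obtain ⟨w, c, hc, hl, -⟩ := hgmem 0 (by omega)
    have := hc.three_le_length
    omega) (hgM J le_rfl) hJ
  obtain ⟨w, c, hc, hl, hcW⟩ := hgmem (j + 1) (by omega)
  have heven : Even c.length :=
    (SimpleGraph.Coloring.even_length_iff_congr
      (SimpleGraph.Coloring.mk f (fun {u v} h => hf u v h)) c).2 Iff.rfl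
  have hCc : c.support.toFinset.card ≤ c.length := by
    have : c.support.toFinset ⊆ c.support.tail.toFinset := by
      intro x hx
      rw [List.mem_toFinset] at hx ⊢
      rw [← SimpleGraph.Walk.cons_tail_support, List.mem_cons] at hx
      rcases hx with rfl | hx
      · exact SimpleGraph.Walk.end_mem_tail_support hc.not_nil
      · exact hx
    refine (card_le_card this).trans ((List.toFinset_card_le _).trans ?_)
    simp
  have hCM := hgM (j + 1) (by omega)
  have hCH : Disjoint c.support.toFinset H := by
    rw [disjoint_left]
    intro x hx hxH
    exact hcW x (by simpa using hx) (mem_union_left _ hxH)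
  refine ⟨c.support.toFinset, ⟨w, by simp⟩, by omega, hCH, ?_, ?_, ?_⟩
  · rw [disjoint_left]
    intro x hx hxY
    exact hcW x (by simpa using hx)
      (mem_union_right _ (ball_mono H _ (Nat.le_mul_of_pos_left _ (by omega)) hxY))
  · exact adjusting_of_cycle hc (by simp) heven (by omega)
  intro z hz ρ hρ
  have hzc : z ∈ c.support := by simpa using hz
  have hzH : z ∉ H := disjoint_left.1 hCH hz
  have hballW : ∀ x ∈ ball G H {z} ρ, x ∉ W j := by
    intro x hx hxW
    rcases mem_union.1 hxW with h | h
    · exact disjoint_left.1 (ball_disjoint (by simpa using hzH) ρ) hx h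
    · refine hcW z hzc (mem_union_right _ ?_)
      have h1 := ball_symm hx hzH
      have h2 := ball_subset_of_subset (G := G) (W := H) (singleton_subset_iff.2 h) ρ h1
      refine ball_mono H _ ?_ (ball_add _ _ h2)
      rw [Nat.add_mul, one_mul]
      omega
  have hrc := hc.rotate hzc
  have hrl : (c.rotate z hzc).length = c.length := SimpleGraph.Walk.length_rotate _ _ _
  have key : ∀ q ∈ c.support.toFinset ∩ ball G H {z} ρ, c.length ≤ 6 * ρ ∨
      q ∈ (range (ρ + 1)).image (c.rotate z hzc).getVert ∪
        (range (ρ + 1)).image (fun i => (c.rotate z hzc).getVert (c.length - i)) := by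
    intro q hq
    rw [mem_inter, List.mem_toFinset] at hq
    have hq' : q ∈ (c.rotate z hzc).support := by
      rw [SimpleGraph.Walk.mem_support_rotate_iff]; exact hq.1
    obtain ⟨i, hi, hiL⟩ := SimpleGraph.Walk.mem_support_iff_exists_getVert.1 hq'
    rcases getVert_near_of_shortest (S := {x | x ∉ W j}) (γ := g j) (hgle j) hrc
      (fun x hx => by
        rw [SimpleGraph.Walk.mem_support_rotate_iff] at hx
        exact fun h => hcW x hx (hWmono j h)) (by omega) hiL hi
      ((ball_reach_singleton hq.2).mono (fun x hx => hballW x hx) le_rfl) with h | h | h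
    · exact Or.inr (mem_union_left _ (mem_image.2 ⟨i, by rw [mem_range]; omega, hi⟩))
    · refine Or.inr (mem_union_right _ (mem_image.2 ⟨c.length - i, by rw [mem_range]; omega, ?_⟩))
      show (c.rotate z hzc).getVert _ = q
      rw [← hi]; congr 1; omega
    · left; omega
  by_cases h6 : c.length ≤ 6 * ρ
  · have := card_le_card (inter_subset_left (s₁ := c.support.toFinset) (s₂ := ball G H {z} ρ))
    omega
  · refine (card_le_card fun q hq => (key q hq).resolve_left h6).trans
      ((card_union_le _ _).trans ?_)
    have h1 := card_image_le (s := range (ρ + 1)) (f := (c.rotate z hzc).getVert)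
    have h2 := card_image_le (s := range (ρ + 1))
      (f := fun i => (c.rotate z hzc).getVert (c.length - i))
    rw [card_range] at h1 h2
    omega

end Cycles

section LowDegree
open scoped Classical
open Finset

variable {V : Type*} [Fintype V] {G : SimpleGraph V} {d Kc : ℕ}

theorem disjoint_ball_comm {H A W : Finset V} {r : ℕ} (hA : Disjoint A H)
    (h : Disjoint A (ball G H (W \ H) r)) : Disjoint (ball G H A r) W := by
  rw [disjoint_left]
  intro x hx hxW
  have hxH := disjoint_left.1 (ball_disjoint hA r) hx
  rw [ball_eq_biUnion, mem_biUnion] at hx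
  obtain ⟨a, ha, hx⟩ := hx
  refine disjoint_left.1 h ha ?_
  exact ball_subset_of_subset (singleton_subset_iff.2 (mem_sdiff.2 ⟨hxW, hxH⟩)) _
    (ball_symm hx (disjoint_left.1 hA ha))

theorem exists_monochromatic {α : Type*} (f : α → Bool) {X : Finset α} {k : ℕ}
    (h : 2 * k ≤ X.card) : ∃ c : Fin k → α, Function.Injective c ∧ (∀ i, c i ∈ X) ∧
      ∀ i j, f (c i) = f (c j) := by
  have h1 := card_filter_add_card_filter_not (s := X) (fun x => f x = true)
  obtain ⟨b, hb⟩ : ∃ b, k ≤ (X.filter fun x => f x = b).card := by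
    by_contra! hcon
    have h2 := hcon true
    have h3 := hcon false
    simp only [Bool.not_eq_true] at h1
    omega
  obtain ⟨S, hS, hSc⟩ := exists_subset_card_eq hb
  refine ⟨fun i => ((S.equivFinOfCardEq hSc).symm i : α), ?_, fun i => ?_, fun i j => ?_⟩
  · exact Subtype.val_injective.comp (Equiv.injective _)
  · exact (mem_filter.1 (hS ((S.equivFinOfCardEq hSc).symm i).2)).1
  · rw [(mem_filter.1 (hS ((S.equivFinOfCardEq hSc).symm i).2)).2,
      (mem_filter.1 (hS ((S.equivFinOfCardEq hSc).symm j).2)).2]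

theorem balSub_of_noFailing (hG : Good G d Kc) {s : Scale} (hs : s.Valid d Kc (Fintype.card V))
    {f : V → Bool} (hf : ∀ u v, G.Adj u v → f u ≠ f v)
    {H Z : Finset V} {Δ D J M s₀ k W₁ : ℕ} (hΔ : ∀ v ∉ H, (nb G {v}).card ≤ Δ)
    (hZ : ∀ X, Disjoint X Z → X.card ≤ s.K₁ → ∀ v, ∀ ρ ≤ s.R, ¬ Failing G H X v ρ d s.κ)
    (hM : 10 * s.E ^ 3 + 1 ≤ M) (hJ : 2 ^ J * M < 3 ^ J)
    (hW₁ : Z.card + k ^ 2 * s₀ ^ 2 * (M * (Δ + 1) ^ s.T) ≤ W₁)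
    (hD : 2 * s.E ^ 2 * (H.card + W₁ * (Δ + 1) ^ (J * s.T) + 1) + d + 1 ≤ D)
    (hV : 2 * ((Δ * D + 1) * (D * (2 * s.E ^ 3 + 1))) ^ 2 ≤ Fintype.card V)
    (hcore : H.card + (W₁ + 2 * k * (Δ + 1) ^ s.T) * (Δ + 1) ^ s.T < Fintype.card V)
    (hs₀ : s.L + M + 1 ≤ s₀) (heven : Even s₀) (hsc : 13 + 2 * k ≤ s.c)
    (hw : k ^ 2 * s₀ ^ 2 * M + k + k ^ 2 * ((s₀ ^ 2 + 1) * s₀) ≤ s.w)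
    (hcard₁ : 2 * s.E₂ ^ 2 * (s.w + H.card) ≤ s.K₁)
    (hcard₂ : 2 * s.E ^ 2 * (s.w + H.card + (k ^ 2 * s₀ ^ 2 * M + k) * (Δ + 1) ^ (s.R + 1)) ≤
      s.K₂) :
    ContainsBalSub G k (s₀ ^ 2 + 2 * s₀) := by
  set N := k ^ 2 * s₀ ^ 2 with hN
  -- adjusters
  obtain ⟨𝒜, h𝒜c, h𝒜, h𝒜d⟩ := exists_disjoint_family
    (fun C : Finset V => C.Nonempty ∧ C.card ≤ M ∧ Disjoint C H ∧ Adjusting G C M ∧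
      ∀ z ∈ C, ∀ ρ ≤ s.T, (C ∩ ball G H {z} ρ).card ≤ 6 * (ρ + 1))
    (fun C => ball G H C s.T) (N := N) (M := M * (Δ + 1) ^ s.T) Z
    (fun C hC => hC.1.mono (subset_ball _ _ _))
    (fun C hC => (ball_card_le hΔ C hC.2.2.1 _).trans (Nat.mul_le_mul_right _ hC.2.1)) (by
      intro W hZW hW
      obtain ⟨C, h1, h2, h3, h4, h5, h6⟩ := exists_adjuster hG hf (H := H) (Y := W) (E := s.E)
        (Δ := Δ) (D := D) (R := s.T) (J := J) (M := M) hs.le_pow hΔ hM hJ (by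
          have : W.card * (Δ + 1) ^ (J * s.T) ≤ W₁ * (Δ + 1) ^ (J * s.T) :=
            Nat.mul_le_mul_right _ (by omega)
          have h2 : 2 * s.E ^ 2 * (H.card + W.card * (Δ + 1) ^ (J * s.T) + 1) ≤
            2 * s.E ^ 2 * (H.card + W₁ * (Δ + 1) ^ (J * s.T) + 1) :=
            Nat.mul_le_mul_left _ (by omega)
          omega) hV
      exact ⟨C, ⟨h1, h2, h3, h5, h6⟩, disjoint_ball_comm h3 h4⟩)
  set Y := Z ∪ 𝒜.biUnion fun C => ball G H C s.T with hY
  have hYc : Y.card ≤ W₁ := by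
    refine (card_union_le _ _).trans ((Nat.add_le_add_left ?_ _).trans hW₁)
    rw [← h𝒜c]
    exact card_biUnion_le_card_mul _ _ _ fun C hC =>
      (ball_card_le hΔ C (h𝒜 C hC).1.2.2.1 _).trans (Nat.mul_le_mul_right _ (h𝒜 C hC).1.2.1)
  -- core vertices
  obtain ⟨X, hXc, hX, hXd⟩ := exists_disjoint_family (fun x : V => x ∉ H)
    (fun x => ball G H {x} s.T) (N := 2 * k) (M := (Δ + 1) ^ s.T) Y
    (fun x _ => ⟨x, subset_ball _ _ _ (mem_singleton_self x)⟩)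
    (fun x hx => by simpa using ball_card_le hΔ {x} (by simpa using hx) s.T) (by
      intro W hYW hW
      obtain ⟨x, hx⟩ : ∃ x, x ∉ H ∪ ball G H (W \ H) s.T := by
        by_contra! hcon
        have h1 : (univ : Finset V) ⊆ H ∪ ball G H (W \ H) s.T := fun x _ => hcon x
        have h2 := (card_le_card h1).trans (card_union_le _ _)
        rw [card_univ] at h2
        have h3 := ball_card_le hΔ (W \ H) sdiff_disjoint s.T
        have h4 : (W \ H).card * (Δ + 1) ^ s.T ≤
            (W₁ + 2 * k * (Δ + 1) ^ s.T) * (Δ + 1) ^ s.T :=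
          Nat.mul_le_mul_right _ ((card_le_card sdiff_subset).trans (by omega))
        omega
      rw [mem_union, not_or] at hx
      exact ⟨x, hx.1, disjoint_ball_comm (by simpa using hx.1) (by simpa using hx.2)⟩)
  obtain ⟨c, hc, hcX, hcf⟩ := exists_monochromatic f hXc.ge
  set 𝒪 := 𝒜 ∪ univ.image fun i => ({c i} : Finset V) with h𝒪
  have hmem : ∀ O ∈ 𝒪, O ∈ 𝒜 ∨ ∃ i, O = {c i} := by
    intro O hO
    rcases mem_union.1 hO with h | h
    · exact Or.inl h
    · obtain ⟨i, -, rfl⟩ := mem_image.1 h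
      exact Or.inr ⟨i, rfl⟩
  have hcH : ∀ i, Disjoint {c i} H := fun i => by simpa using (hX _ (hcX i)).1
  have hdisj : ∀ O ∈ 𝒪, Disjoint O H := by
    intro O hO
    rcases hmem O hO with h | ⟨i, rfl⟩
    exacts [(h𝒜 O h).1.2.2.1, hcH i]
  have hc𝒜 : ∀ i, ∀ C ∈ 𝒜, Disjoint (ball G H {c i} s.T) (ball G H C s.T) := fun i C hC =>
    (hX _ (hcX i)).2.mono_right
      ((subset_biUnion_of_mem (fun C => ball G H C s.T) hC).trans subset_union_right)
  have hfar : ∀ O ∈ 𝒪, ∀ O' ∈ 𝒪, O ≠ O' → Disjoint (ball G H O s.T) (ball G H O' s.T) := by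
    intro O hO O' hO' hne
    rcases hmem O hO with h | ⟨i, rfl⟩ <;> rcases hmem O' hO' with h' | ⟨j, rfl⟩
    · exact h𝒜d O h O' h' hne
    · exact (hc𝒜 j O h).symm
    · exact hc𝒜 i O' h'
    · exact hXd _ (hcX i) _ (hcX j) fun h => hne (by rw [h])
  have hZ' : ∀ O ∈ 𝒪, Disjoint (ball G H O s.T) Z := by
    intro O hO
    rcases hmem O hO with h | ⟨i, rfl⟩
    exacts [(h𝒜 O h).2, (hX _ (hcX i)).2.mono_right subset_union_left]
  have hspread : ∀ O ∈ 𝒪, ∀ z ∈ O, ∀ ρ ≤ s.T, (O ∩ ball G H {z} ρ).card ≤ 6 * (ρ + 1) := by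
    intro O hO
    rcases hmem O hO with h | ⟨i, rfl⟩
    · exact (h𝒜 O h).1.2.2.2.2
    · intro z _ ρ _
      refine (card_le_card inter_subset_left).trans ?_
      rw [card_singleton]; omega
  have hsum : ∀ g : Finset V → Finset V, ∀ Q, (∀ C ∈ 𝒜, (g C).card ≤ M * Q) →
      (∀ i, (g {c i}).card ≤ Q) → (𝒪.biUnion g).card ≤ (N * M + k) * Q := by
    intro g Q h1 h2
    rw [h𝒪, union_biUnion, ← h𝒜c]
    refine (card_union_le _ _).trans ?_
    have h3 := card_biUnion_le_card_mul _ _ _ h1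
    have h4 := card_biUnion_le_card_mul (univ.image fun i => ({c i} : Finset V)) g Q (by
      intro O hO
      obtain ⟨i, -, rfl⟩ := mem_image.1 hO
      exact h2 i)
    have h5 : (univ.image fun i => ({c i} : Finset V)).card ≤ k := by
      simpa using card_image_le (s := univ) (f := fun i => ({c i} : Finset V))
    calc _ ≤ 𝒜.card * (M * Q) + k * Q := Nat.add_le_add h3 (h4.trans (Nat.mul_le_mul_right _ h5))
      _ = _ := by ring
  have hF : Field G H s d 𝒪 := by
    refine ⟨hdisj, hfar, ?_, hcard₁, le_trans (Nat.mul_le_mul_left _ (Nat.add_le_add_left ?_ _))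
      hcard₂⟩
    · intro O hO X hX hXc v ρ hρ
      exact hZ X ((hZ' O hO).mono_left hX) hXc v ρ hρ
    · refine hsum _ _ (fun C hC => ?_) fun i => ?_
      · exact (ball_card_le hΔ C (h𝒜 C hC).1.2.2.1 _).trans
          (Nat.mul_le_mul_right _ (h𝒜 C hC).1.2.1)
      · simpa using ball_card_le hΔ {c i} (hcH i) (s.R + 1)
  refine balSub_of_field hG hs hF hf (c₀ := 12) (M := M) (𝒜 := 𝒜) c hc hcf ?_ subset_union_left
    (fun C hC => (h𝒜 C hC).1.2.2.2.1) hs₀ heven ?_ (by omega) (by rw [h𝒜c]) ?_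
  · refine fun i => ⟨mem_union_right _ (mem_image_of_mem _ (mem_univ i)), fun h => ?_⟩
    have hb : c i ∈ ball G H {c i} s.T := subset_ball _ _ _ (mem_singleton_self _)
    exact disjoint_left.1 (hc𝒜 i _ h) hb hb
  · intro O hO z hz r hr
    have hrT : r + 1 ≤ s.T := (Nat.succ_le_succ hr).trans s.R_succ_le
    have : nb G (ball G (𝒪.biUnion id ∪ H) {z} r) ∩ 𝒪.biUnion id ⊆ O ∩ ball G H {z} (r + 1) := by
      intro x hx
      rw [mem_inter, mem_biUnion] at hx
      obtain ⟨hx, O', hO', hxO'⟩ := hx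
      have hxO' : x ∈ O' := hxO'
      have hxb := mem_ball_of_mem_nb subset_union_right hx (disjoint_left.1 (hdisj O' hO') hxO')
      refine mem_inter.2 ⟨?_, hxb⟩
      by_cases hOO' : O = O'
      · exact hOO' ▸ hxO'
      · exact absurd (subset_ball _ _ _ hxO') (disjoint_left.1 (hfar O hO O' hO' hOO')
          (ball_subset_of_subset (singleton_subset_iff.2 hz) _ (ball_mono _ _ hrT hxb)))
    refine (card_le_card this).trans ((hspread O hO z hz _ hrT).trans (by omega))
  · have := hsum id 1 (fun C hC => by simpa using (h𝒜 C hC).1.2.1) (fun i => by simp)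
    omega

end LowDegree

section Numerics
open scoped Classical
open Finset

theorem add_le_two_pow {x y a b c : ℕ} (hx : x ≤ 2 ^ a) (hy : y ≤ 2 ^ b) (ha : a + 1 ≤ c)
    (hb : b + 1 ≤ c) : x + y ≤ 2 ^ c := by
  obtain ⟨c, rfl⟩ : ∃ c', c = c' + 1 := ⟨c - 1, by omega⟩
  have h1 : 2 ^ a ≤ 2 ^ c := Nat.pow_le_pow_right (by omega) (by omega)
  have h2 : 2 ^ b ≤ 2 ^ c := Nat.pow_le_pow_right (by omega) (by omega)
  rw [pow_succ]
  omega

theorem mul_le_two_pow {x y a b c : ℕ} (hx : x ≤ 2 ^ a) (hy : y ≤ 2 ^ b) (h : a + b ≤ c) :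
    x * y ≤ 2 ^ c := by
  refine (Nat.mul_le_mul hx hy).trans ?_
  rw [← pow_add]
  exact Nat.pow_le_pow_right (by omega) h

theorem pow_le_two_pow {x a m c : ℕ} (hx : x ≤ 2 ^ a) (h : a * m ≤ c) : x ^ m ≤ 2 ^ c := by
  refine (Nat.pow_le_pow_left hx m).trans ?_
  rw [← pow_mul]
  exact Nat.pow_le_pow_right (by omega) h

variable {V : Type*} [Fintype V] {G : SimpleGraph V} {d Kc : ℕ}

theorem exists_balSub_of_good (hG : Good G d Kc) {f : V → Bool} (hf : ∀ u v, G.Adj u v → f u ≠ f v)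
    {u k : ℕ} (hu : 2 ^ 20 ≤ u) (hP : 2 ^ 20 * u ^ 200 ≤ 2 ^ u)
    (hn : 2 ^ u ^ 50 ≤ Fintype.card V) (hn' : Fintype.card V ≤ 2 ^ u ^ 51) (hd : d ≤ 2 ^ u)
    (hKc : 0 < Kc) (hKd : 10000 * Kc ^ 2 ≤ d) (hk : 100 * Kc ^ 2 * k ≤ d) :
    ∃ ℓ, ContainsBalSub G k ℓ := by
  have hp : ∀ a b, a < b → 2 ^ 20 * u ^ a ≤ u ^ b := by
    intro a b hab
    calc 2 ^ 20 * u ^ a ≤ u * u ^ a := Nat.mul_le_mul_right _ hu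
      _ = u ^ (a + 1) := by ring
      _ ≤ u ^ b := Nat.pow_le_pow_right (by omega) hab
  have hKc2 : 1 ≤ Kc ^ 2 := Nat.one_le_pow _ _ hKc
  have hkd : 100 * k ≤ d := by nlinarith
  have hk2 : k ≤ 2 ^ u := by omega
  have p1 := hp 0 1 (by omega)
  rw [pow_zero, pow_one] at p1
  have hBpow : ∀ i, (2 ^ u) ^ i = 2 ^ (i * u) := fun i => by rw [← pow_mul, mul_comm]
  have hpow : ∀ i, i * u + 1 ≤ u ^ 50 → (2 ^ u) ^ i < Fintype.card V := fun i hi => by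
    rw [hBpow]
    exact (Nat.pow_lt_pow_right (by omega) (by omega)).trans_le hn
  set κ := 48 * Kc ^ 2 with hκ
  set s : Scale := ⟨κ, 6 * Kc, d / (24 * Kc ^ 2), 2 ^ (8 * u), 16 * u, u ^ 8, u ^ 51, 2 ^ (16 * u),
    2 ^ u ^ 8⟩ with hs
  have hE3 : (u ^ 51) ^ 3 = u ^ 153 := by rw [← pow_mul]
  have hE2 : (u ^ 51) ^ 2 = u ^ 102 := by rw [← pow_mul]
  have hE8 : (u ^ 8) ^ 3 = u ^ 24 := by rw [← pow_mul]
  have hE8' : (u ^ 8) ^ 2 = u ^ 16 := by rw [← pow_mul]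
  have hu3 : (16 * u) ^ 3 = 4096 * u ^ 3 := by rw [mul_pow]; norm_num
  have hR : s.R = 8192 * u ^ 3 := by simp only [Scale.R, hs, hu3]; ring
  have hT : s.T = 1 + 8192 * u ^ 3 + 2 * u ^ 24 := by
    simp only [Scale.T, hs, hu3, hE8]; ring
  have q3 := hp 3 200 (by omega)
  have q24 := hp 24 200 (by omega)
  have q153 := hp 153 200 (by omega)
  have q102 := hp 102 200 (by omega)
  have q16 := hp 16 200 (by omega)
  have q0 := hp 0 200 (by omega)
  rw [pow_zero] at q0
  have hL : s.L = 2 * (s.T + 2 * u ^ 153) := by simp only [Scale.L, hs, hE3]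
  have p50 := hp 1 50 (by omega)
  rw [pow_one] at p50
  have hkc : κ * k ≤ d := by
    have : κ * k ≤ 100 * Kc ^ 2 * k := Nat.mul_le_mul_right _ (by omega)
    omega
  set H := univ.filter fun v => (2 ^ u) ^ 7 ≤ (nb G {v}).card with hH
  by_cases hHc : (2 ^ u) ^ 13 ≤ H.card
  · refine balSub_of_high_degree hG hn' (B := 2 ^ u) ?_ hd hk2 H (fun v hv => (mem_filter.1 hv).2)
      hHc
    rw [hE3]; omega
  rw [not_le] at hHc
  by_cases hfam : ∀ W : Finset V, ∅ ⊆ W → W.card ≤ (∅ : Finset V).card + (2 ^ u) ^ 62 * (2 ^ u) ^ 16 →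
      ∃ X : Finset V, (X.card ≤ (2 ^ u) ^ 16 ∧ ∃ v, ∃ ρ ≤ s.R, Failing G H X v ρ d κ) ∧
        Disjoint (id X) W
  · obtain ⟨𝓕, h𝓕c, h𝓕, h𝓕d⟩ := exists_disjoint_family
      (fun X : Finset V => X.card ≤ (2 ^ u) ^ 16 ∧ ∃ v, ∃ ρ ≤ s.R, Failing G H X v ρ d κ) id ∅
      (fun X hX => by
        obtain ⟨-, v, ρ, -, h⟩ := hX
        exact ⟨v, h.mem⟩) (fun X hX => hX.1) hfam
    refine balSub_of_failing hG hn' (B := 2 ^ u) (R := s.R) ?_ hd hkc (by omega)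
      (hpow 123 (by omega)).le hHc (fun X hX => (h𝓕 X hX).1) h𝓕d h𝓕c.ge
    rw [hE3, hR]; omega
  push Not at hfam
  obtain ⟨Z, -, hZc, hZ⟩ := hfam
  rw [card_empty, zero_add] at hZc
  have hΔ : ∀ v ∉ H, (nb G {v}).card ≤ (2 ^ u) ^ 7 := by
    intro v hv
    simp only [hH, mem_filter, mem_univ, true_and, not_le] at hv
    exact hv.le
  have hHc' : H.card ≤ 2 ^ (13 * u) := by rw [← hBpow]; exact hHc.le
  have hvalid : s.Valid d Kc (Fintype.card V) := by
    have h2 : Kc ^ 2 = Kc * Kc := sq Kc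
    refine ⟨hKc, by show 0 < κ; omega, le_rfl, ?_, ?_, ?_, ?_, le_rfl, le_rfl, hn'⟩
    · show 2 * (6 * Kc) * Kc * (κ * (d / (24 * Kc ^ 2)) + 2 * d) ≤ d * κ
      have h1 : d / (24 * Kc ^ 2) * (24 * Kc ^ 2) ≤ d := Nat.div_mul_le_self _ _
      calc _ = κ * (d / (24 * Kc ^ 2) * (24 * Kc ^ 2)) / 2 + 24 * Kc ^ 2 * d := by
            have : 2 * (6 * Kc) * Kc * (κ * (d / (24 * Kc ^ 2)) + 2 * d) =
              12 * Kc ^ 2 * (κ * (d / (24 * Kc ^ 2))) + 24 * Kc ^ 2 * d := by ring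
            rw [this]
            congr 1
            have : κ * (d / (24 * Kc ^ 2) * (24 * Kc ^ 2)) =
              2 * (12 * Kc ^ 2 * (κ * (d / (24 * Kc ^ 2)))) := by ring
            rw [this]; omega
        _ ≤ κ * d / 2 + 24 * Kc ^ 2 * d :=
            Nat.add_le_add_right (Nat.div_le_div_right (Nat.mul_le_mul_left _ h1)) _
        _ = d * κ := by
            have : κ * d = 2 * (24 * Kc ^ 2 * d) := by rw [hκ]; ring
            rw [mul_comm d κ]
            omega
    · show d ≤ 2 * 2 ^ (16 * u)
      have : 2 ^ u ≤ 2 ^ (16 * u) := Nat.pow_le_pow_right (by omega) (by omega)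
      omega
    · have := hp 1 8 (by omega)
      rw [pow_one] at this
      exact Nat.pow_le_pow_right (by omega) (by omega)
    · show 2 * 2 ^ u ^ 8 ≤ _
      have h3 := hp 8 50 (by omega)
      have h4 : 2 ^ (u ^ 8 + 1) ≤ 2 ^ u ^ 50 := Nat.pow_le_pow_right (by omega) (by omega)
      rw [pow_succ] at h4
      omega
  have hc : 13 + 2 * k ≤ s.c := by
    show 13 + 2 * k ≤ d / (24 * Kc ^ 2)
    rw [Nat.le_div_iff_mul_le (by omega)]
    have : (13 + 2 * k) * (24 * Kc ^ 2) = 312 * Kc ^ 2 + 48 * (Kc ^ 2 * k) := by ring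
    have h2 : 100 * Kc ^ 2 * k = 100 * (Kc ^ 2 * k) := by ring
    omega
  have p6 := hp 1 6 (by omega)
  have p8 := hp 6 8 (by omega)
  have p4 := hp 4 6 (by omega)
  have p4' := hp 1 4 (by omega)
  have p3 := hp 0 3 (by omega)
  rw [pow_zero] at p3
  have p25 := hp 24 25 (by omega)
  have p25' := hp 3 24 (by omega)
  have p26 := hp 26 27 (by omega)
  have p27 := hp 27 28 (by omega)
  have p27' := hp 1 27 (by omega)
  have p28 := hp 28 30 (by omega)
  have p30 := hp 30 50 (by omega)
  rw [pow_one] at p6 p4' p27'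
  have hT' : s.T ≤ u ^ 25 := by omega
  have hB1 : (2 ^ u) ^ 7 + 1 ≤ 2 ^ (8 * u) := by
    rw [hBpow]
    exact add_le_two_pow (b := 0) le_rfl le_rfl (by omega) (by omega)
  have hΓ : ((2 ^ u) ^ 7 + 1) ^ s.T ≤ 2 ^ u ^ 27 := by
    refine pow_le_two_pow hB1 ?_
    calc 8 * u * s.T ≤ 8 * u * u ^ 25 := Nat.mul_le_mul_left _ hT'
      _ = 8 * u ^ 26 := by ring
      _ ≤ _ := by omega
  have hΓJ : ((2 ^ u) ^ 7 + 1) ^ (2 * u * s.T) ≤ 2 ^ u ^ 28 := by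
    refine pow_le_two_pow hB1 ?_
    calc 8 * u * (2 * u * s.T) ≤ 8 * u * (2 * u * u ^ 25) := by gcongr
      _ = 16 * u ^ 27 := by ring
      _ ≤ _ := by omega
  have hΓR : ((2 ^ u) ^ 7 + 1) ^ (s.R + 1) ≤ 2 ^ u ^ 6 := by
    refine pow_le_two_pow hB1 ?_
    rw [hR]
    calc 8 * u * (8192 * u ^ 3 + 1) = 65536 * u ^ 4 + 8 * u := by ring
      _ ≤ _ := by omega
  have hkk : k ^ 2 ≤ 2 ^ (2 * u) := pow_le_two_pow hk2 (by omega)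
  have hs₀ : (2 ^ (u + 1)) ^ 2 = 2 ^ (2 * u + 2) := by rw [← pow_mul]; congr 1; ring
  have hN : k ^ 2 * (2 ^ (u + 1)) ^ 2 ≤ 2 ^ (4 * u + 2) :=
    mul_le_two_pow hkk hs₀.le (by omega)
  have hNM : k ^ 2 * (2 ^ (u + 1)) ^ 2 * 2 ^ u ≤ 2 ^ (5 * u + 2) :=
    mul_le_two_pow hN le_rfl (by omega)
  have hE51 : 2 * (u ^ 51) ^ 2 ≤ 2 ^ u := by rw [hE2]; omega
  refine ⟨_, balSub_of_noFailing hG hvalid hf (H := H) (Z := Z) (Δ := (2 ^ u) ^ 7)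
    (D := 2 ^ u ^ 30) (J := 2 * u) (M := 2 ^ u) (s₀ := 2 ^ (u + 1)) (k := k) (W₁ := 2 ^ u ^ 28)
    hΔ ?_ ?_ ?_ ?_ ?_ ?_ ?_ ?_ ?_ hc ?_ ?_ ?_⟩
  · intro X hX hXc v ρ hρ hF
    refine hZ X ⟨?_, v, ρ, hρ, hF⟩ hX
    rw [hBpow]; exact hXc
  · show 10 * (u ^ 51) ^ 3 + 1 ≤ 2 ^ u
    rw [hE3]; omega
  · calc 2 ^ (2 * u) * 2 ^ u = 8 ^ u := by
          rw [← pow_add, show 2 * u + u = 3 * u by ring, pow_mul]; norm_num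
      _ < 9 ^ u := Nat.pow_lt_pow_left (by norm_num) (by omega)
      _ = 3 ^ (2 * u) := by rw [pow_mul]; norm_num
  · refine add_le_two_pow (a := 78 * u) (b := 5 * u + 2 + u ^ 27) ?_ ?_ (by omega) (by omega)
    · rw [← pow_add, hBpow] at hZc; exact hZc
    · rw [← mul_assoc]
      exact mul_le_two_pow hNM hΓ le_rfl
  · show 2 * (u ^ 51) ^ 2 * _ + d + 1 ≤ _
    have h1 : 2 ^ u ^ 28 * ((2 ^ u) ^ 7 + 1) ^ (2 * u * s.T) ≤ 2 ^ (u ^ 28 + u ^ 28) :=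
      mul_le_two_pow le_rfl hΓJ le_rfl
    have h2 := add_le_two_pow (c := u ^ 28 + u ^ 28 + 1) hHc' h1 (by omega) (by omega)
    have h3 := add_le_two_pow (b := 0) (c := u ^ 28 + u ^ 28 + 2) h2 le_rfl (by omega) (by omega)
    have h4 := mul_le_two_pow hE51 h3 le_rfl
    have h5 := add_le_two_pow (c := u + (u ^ 28 + u ^ 28 + 2) + 1) h4 hd (by omega) (by omega)
    exact add_le_two_pow (b := 0) h5 le_rfl (by omega) (by omega)
  · show 2 * (_ * (_ * (2 * (u ^ 51) ^ 3 + 1))) ^ 2 ≤ _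
    refine le_trans ?_ hn
    have h0 : (2 ^ u) ^ 7 * 2 ^ u ^ 30 ≤ 2 ^ (8 * u + u ^ 30) :=
      mul_le_two_pow ((Nat.le_succ _).trans hB1) le_rfl le_rfl
    have h1 := add_le_two_pow (b := 0) (y := 1) (c := 8 * u + u ^ 30 + 1) h0 le_rfl (by omega)
      (by omega)
    have h2 : 2 * (u ^ 51) ^ 3 + 1 ≤ 2 ^ u := by rw [hE3]; omega
    have h3 : 2 ^ u ^ 30 * (2 * (u ^ 51) ^ 3 + 1) ≤ 2 ^ (u ^ 30 + u) := mul_le_two_pow le_rfl h2 le_rfl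
    have h4 := pow_le_two_pow (m := 2) (mul_le_two_pow h1 h3 le_rfl) le_rfl
    exact mul_le_two_pow (x := 2) (a := 1) (by norm_num) h4 (by omega)
  · refine lt_of_lt_of_le ?_ hn
    have h1 : 2 * k * ((2 ^ u) ^ 7 + 1) ^ s.T ≤ 2 ^ (u + 1 + u ^ 27) :=
      mul_le_two_pow (by rw [pow_succ]; omega) hΓ le_rfl
    have h2 := add_le_two_pow (a := u ^ 28) (c := u ^ 28 + 1) le_rfl h1 (by omega) (by omega)
    have h3 := mul_le_two_pow h2 hΓ le_rfl
    have h4 := add_le_two_pow (c := u ^ 30) hHc' h3 (by omega) (by omega)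
    exact h4.trans_lt (Nat.pow_lt_pow_right (by omega) (by omega))
  · rw [hL, hT, pow_succ 2 u]; omega
  · exact ⟨2 ^ u, by rw [pow_succ]; ring⟩
  · show _ ≤ 2 ^ (8 * u)
    have h1 := add_le_two_pow (c := 5 * u + 3) hNM hk2 (by omega) (by omega)
    have h2 := add_le_two_pow (y := 1) (b := 0) (c := 2 * u + 3) hs₀.le le_rfl (by omega) (by omega)
    have h3 := mul_le_two_pow hkk (mul_le_two_pow h2 (le_refl (2 ^ (u + 1))) le_rfl) le_rfl
    exact add_le_two_pow h1 h3 (by omega) (by omega)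
  · show 2 * (u ^ 8) ^ 2 * (2 ^ (8 * u) + H.card) ≤ 2 ^ (16 * u)
    have h1 := add_le_two_pow (a := 8 * u) (c := 13 * u + 1) le_rfl hHc' (by omega) (by omega)
    refine mul_le_two_pow (a := u) ?_ h1 (by omega)
    rw [hE8']; omega
  · show 2 * (u ^ 51) ^ 2 * (2 ^ (8 * u) + H.card + _) ≤ 2 ^ u ^ 8
    have h1 := add_le_two_pow (a := 8 * u) (c := 13 * u + 1) le_rfl hHc' (by omega) (by omega)
    have h2 := add_le_two_pow (c := 5 * u + 3) hNM hk2 (by omega) (by omega)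
    have h3 := mul_le_two_pow h2 hΓR le_rfl
    have h4 := add_le_two_pow (c := 13 * u + 3 + u ^ 6) h1 h3 (by omega) (by omega)
    exact mul_le_two_pow hE51 h4 (by omega)

end Numerics

section Reduction
open scoped Classical
open Finset

theorem log_pow_four_le {y : ℝ} (hy : 1 ≤ y) : Real.log y ^ 4 ≤ 256 * y := by
  have hL := Real.log_nonneg hy
  have h1 : Real.log y / 4 ≤ Real.exp (Real.log y / 4) := by
    linarith [Real.add_one_le_exp (Real.log y / 4)]
  have h2 : (Real.log y / 4) ^ 4 ≤ Real.exp (Real.log y / 4) ^ 4 :=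
    pow_le_pow_left₀ (by positivity) h1 4
  rw [← Real.exp_nat_mul] at h2
  have h3 : ((4 : ℕ) : ℝ) * (Real.log y / 4) = Real.log y := by push_cast; ring
  rw [h3, Real.exp_log (by linarith)] at h2
  have h4 : (Real.log y / 4) ^ 4 = Real.log y ^ 4 / 256 := by ring
  linarith

theorem log_le_of_le_two_pow {x : ℝ} {E : ℕ} (hx : 0 < x) (h : x ≤ 2 ^ E) : Real.log x ≤ E := by
  have h1 := Real.log_le_log hx h
  rw [Real.log_pow] at h1
  have h2 : Real.log 2 ≤ 1 := by linarith [Real.log_two_lt_d9]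
  have h3 : (E : ℝ) * Real.log 2 ≤ E * 1 := mul_le_mul_of_nonneg_left h2 (Nat.cast_nonneg E)
  linarith

theorem exists_eventually_pow_le (m : ℕ) : ∃ u₀ : ℕ, ∀ u, u₀ ≤ u → u ^ m ≤ 2 ^ u := by
  have h := tendsto_pow_const_div_const_pow_of_one_lt m (r := (2 : ℝ)) (by norm_num)
  have h1 := h.eventually (gt_mem_nhds (show (0 : ℝ) < 1 by norm_num))
  obtain ⟨u₀, hu₀⟩ := Filter.eventually_atTop.1 h1
  refine ⟨u₀, fun u hu => ?_⟩
  have h2 := hu₀ u hu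
  rw [div_lt_one (by positivity)] at h2
  exact_mod_cast h2.le

variable {V : Type*} [Fintype V] {G : SimpleGraph V}

theorem extNbr_coe (X : Finset V) : extNbr G (X : Set V) = (nb G X : Set V) := by
  ext v
  simp only [extNbr, mem_coe, mem_nb]
  rfl

theorem IsExpander.good {ε₂ d : ℝ} (hε : 0 < ε₂) (hε' : ε₂ < 1 / 5) (hd : 1 ≤ d)
    (hd' : 15 / ε₂ ≤ d) (hexp : IsExpander G 1 (ε₂ * d)) (hdeg : MinDegGE G d) :
    Good G ⌈d⌉₊ ⌈7680 / ε₂⌉₊ := by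
  have hd0 : 0 < d := by linarith
  have hεd : 0 < ε₂ * d := by positivity
  rw [div_le_iff₀ hε] at hd'
  have key : ∀ X : Finset V, ⌈d⌉₊ ≤ 2 * X.card → 2 * X.card ≤ Fintype.card V →
      1 ≤ 15 * (X.card : ℝ) / (ε₂ * d) ∧
      (X.card : ℝ) ≤ Real.log (15 * X.card / (ε₂ * d)) ^ 2 * (nb G X).card := by
    intro X h1 h2
    have h1' : d ≤ 2 * (X.card : ℝ) := by
      refine (Nat.le_ceil d).trans ?_
      exact_mod_cast h1
    have h2' : 2 * (X.card : ℝ) ≤ Fintype.card V := by exact_mod_cast h2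
    have h3 := hexp (X : Set V)
    rw [Set.ncard_coe_finset, extNbr_coe, Set.ncard_coe_finset, Nat.card_eq_fintype_card] at h3
    have h4 := h3 (by nlinarith) (by linarith)
    have h5 : ¬ ((X.card : ℝ) < ε₂ * d / 5) := by
      rw [not_lt]; nlinarith
    have h6 : 2 ≤ 15 * (X.card : ℝ) / (ε₂ * d) := by
      rw [le_div_iff₀ hεd]; nlinarith
    have h7 : 0 < Real.log (15 * X.card / (ε₂ * d)) := Real.log_pos (by linarith)
    rw [epsFn, if_neg h5, div_mul_eq_mul_div, one_mul, div_le_iff₀ (by positivity)] at h4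
    exact ⟨by linarith, by linarith⟩
  refine ⟨Nat.ceil_pos.2 hd0, fun v => ?_, fun X E h1 h2 h3 => ?_, fun X h1 h2 => ?_⟩
  · rw [Nat.ceil_le]
    refine (hdeg v).trans ?_
    have : G.neighborSet v = (nb G {v} : Set V) := by
      ext w
      simp only [SimpleGraph.mem_neighborSet, mem_coe, mem_nb, mem_singleton, exists_eq_left]
      exact ⟨fun h => ⟨h.ne', h⟩, fun h => h.2⟩
    rw [this, Set.ncard_coe_finset]
  · obtain ⟨h4, h5⟩ := key X h1 h2
    have hX : (0 : ℝ) < X.card := by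
      have := Nat.ceil_pos.2 hd0
      exact_mod_cast (show 0 < X.card by omega)
    have h6 : Real.log (15 * X.card / (ε₂ * d)) ≤ E := by
      refine log_le_of_le_two_pow (by linarith) (le_trans ?_ (show (X.card : ℝ) ≤ 2 ^ E by
        exact_mod_cast h3))
      rw [div_le_iff₀ hεd]
      nlinarith
    have h7 : Real.log (15 * X.card / (ε₂ * d)) ^ 2 ≤ (E : ℝ) ^ 2 :=
      pow_le_pow_left₀ (Real.log_nonneg h4) h6 2
    have h8 : (X.card : ℝ) ≤ (E : ℝ) ^ 2 * (nb G X).card :=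
      h5.trans (mul_le_mul_of_nonneg_right h7 (Nat.cast_nonneg _))
    exact_mod_cast h8
  · obtain ⟨h4, h5⟩ := key X h1 h2
    have hX : (0 : ℝ) < X.card := by
      have := Nat.ceil_pos.2 hd0
      exact_mod_cast (show 0 < X.card by omega)
    set x : ℝ := (X.card : ℝ) with hx
    set N : ℝ := ((nb G X).card : ℝ) with hN
    set L := Real.log (15 * x / (ε₂ * d)) with hL
    have h6 : L ^ 4 ≤ 256 * (15 * x / (ε₂ * d)) := log_pow_four_le h4
    have h7 : x ^ 2 ≤ L ^ 4 * N ^ 2 := by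
      calc x ^ 2 ≤ (L ^ 2 * N) ^ 2 := pow_le_pow_left₀ hX.le h5 2
        _ = _ := by ring
    have hN2 : 0 ≤ N ^ 2 := by positivity
    have h8 : x ^ 2 ≤ 256 * (15 * x / (ε₂ * d)) * N ^ 2 :=
      h7.trans (mul_le_mul_of_nonneg_right h6 hN2)
    have h9 : d * x ≤ 3840 / ε₂ * N ^ 2 := by
      have : 256 * (15 * x / (ε₂ * d)) * N ^ 2 = x * (3840 / ε₂ * N ^ 2) / d := by
        field_simp; ring
      rw [this, le_div_iff₀ hd0] at h8
      have : x * (d * x) ≤ x * (3840 / ε₂ * N ^ 2) := by nlinarith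
      exact le_of_mul_le_mul_left this hX
    have h10 : (⌈d⌉₊ : ℝ) ≤ 2 * d := by
      have := (Nat.ceil_lt_add_one hd0.le).le
      linarith
    set K : ℝ := (⌈7680 / ε₂⌉₊ : ℝ) with hK
    have h11 : 7680 / ε₂ ≤ K := Nat.le_ceil _
    have h12 : 1 ≤ K := by
      have : 0 < ⌈7680 / ε₂⌉₊ := Nat.ceil_pos.2 (by positivity)
      rw [hK]
      exact_mod_cast this
    have h13 : K ≤ K ^ 2 := by nlinarith
    have h14 : (⌈d⌉₊ : ℝ) * x ≤ (K * N) ^ 2 := by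
      calc (⌈d⌉₊ : ℝ) * x ≤ 2 * d * x := mul_le_mul_of_nonneg_right h10 hX.le
        _ ≤ 7680 / ε₂ * N ^ 2 := by
            have : 7680 / ε₂ * N ^ 2 = 2 * (3840 / ε₂ * N ^ 2) := by ring
            linarith
        _ ≤ K ^ 2 * N ^ 2 := mul_le_mul_of_nonneg_right (h11.trans h13) hN2
        _ = _ := by ring
    rw [hx, hN, hK] at h14
    exact_mod_cast h14

theorem exists_scale {n : ℕ} {u₀ : ℕ} (h : 2 ^ u₀ ^ 50 ≤ n) :
    ∃ u, u₀ ≤ u ∧ 2 ^ u ^ 50 ≤ n ∧ n < 2 ^ (u + 1) ^ 50 := by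
  have hb : ∀ u, 2 ^ u ^ 50 ≤ n → u ≤ n := fun u hu =>
    ((Nat.le_self_pow (by norm_num) u).trans Nat.lt_two_pow_self.le).trans hu
  refine ⟨Nat.findGreatest (fun u => 2 ^ u ^ 50 ≤ n) n, Nat.le_findGreatest (hb _ h) h,
    Nat.findGreatest_spec (P := fun u => 2 ^ u ^ 50 ≤ n) (hb _ h) h, ?_⟩
  by_contra! hcon
  have := Nat.le_findGreatest (P := fun u => 2 ^ u ^ 50 ≤ n) (hb _ hcon) hcon
  omega

end Reduction

/-- the sparse case (Lemma 4.1). -/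
theorem statement6 :
    ∃ ε₁ : ℝ, 0 < ε₁ ∧
      ∀ ε₂ : ℝ, 0 < ε₂ → ε₂ < 1 / 5 → ∀ s : ℝ, 20 ≤ s →
        ∃ (d₀ t : ℝ), 0 < t ∧
          ∀ (n : ℕ) (d : ℝ), d₀ ≤ d → d ≤ n → d < Real.log n ^ s →
            ∀ (V : Type) [Fintype V] (G : SimpleGraph V), Nat.card V = n →
              IsBip G → IsExpander G ε₁ (ε₂ * d) → MinDegGE G d →
                ¬ ContainsBalSub G ⌈d / 2⌉₊ 2 →
                ∃ (k ℓ : ℕ), t * d ≤ (k : ℝ) ∧ ContainsBalSub G k ℓ := by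
  refine ⟨1, one_pos, fun ε₂ hε hε' s hs => ?_⟩
  set Kc := ⌈7680 / ε₂⌉₊ with hKc
  have hKpos : 0 < Kc := Nat.ceil_pos.2 (by positivity)
  have hKpos' : (0 : ℝ) < Kc := by exact_mod_cast hKpos
  obtain ⟨u₁, hu₁⟩ := exists_eventually_pow_le (51 * ⌈s⌉₊ + 1)
  obtain ⟨u₂, hu₂⟩ := exists_eventually_pow_le 201
  set u₀ := u₁ + u₂ + 2 ^ 50 with hu₀
  have hx0 : (0 : ℝ) ≤ ((u₀ : ℝ) ^ 50) ^ s := by positivity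
  have hx1 : (0 : ℝ) < 15 / ε₂ := by positivity
  have hx2 : (0 : ℝ) ≤ 10000 * (Kc : ℝ) ^ 2 := by positivity
  refine ⟨1 + 15 / ε₂ + 10000 * (Kc : ℝ) ^ 2 + ((u₀ : ℝ) ^ 50) ^ s, 1 / (200 * (Kc : ℝ) ^ 2),
    by positivity, ?_⟩
  intro n d hd hdn hds V _ G hV hbip hexp hdeg _
  have hd0 : 0 < d := by linarith
  have hn : 0 < n := by
    have : (0 : ℝ) < n := by linarith
    exact_mod_cast this
  have hn1 : (1 : ℝ) ≤ n := by exact_mod_cast hn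
  have hG := hexp.good hε hε' (by linarith) (by linarith) hdeg
  rw [Nat.card_eq_fintype_card] at hV
  have hs0 : 0 ≤ s := by linarith
  obtain ⟨u, hu, hun, hun'⟩ := exists_scale (u₀ := u₀) (by
    by_contra! hcon
    have h1 : Real.log n ≤ ((u₀ ^ 50 : ℕ) : ℝ) :=
      log_le_of_le_two_pow (by linarith) (by exact_mod_cast hcon.le)
    have h2 : Real.log n ^ s ≤ ((u₀ : ℝ) ^ 50) ^ s := by
      refine Real.rpow_le_rpow (Real.log_nonneg hn1) ?_ hs0
      exact_mod_cast h1
    linarith)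
  have hu51 : (u + 1) ^ 50 ≤ u ^ 51 := by
    calc (u + 1) ^ 50 ≤ (2 * u) ^ 50 := Nat.pow_le_pow_left (by omega) _
      _ = 2 ^ 50 * u ^ 50 := by rw [mul_pow]
      _ ≤ u * u ^ 50 := Nat.mul_le_mul_right _ (by omega)
      _ = u ^ 51 := by ring
  have hn51 : n ≤ 2 ^ u ^ 51 := hun'.le.trans (Nat.pow_le_pow_right (by omega) hu51)
  have hu200 : 2 ^ 20 * u ^ 200 ≤ 2 ^ u := by
    calc 2 ^ 20 * u ^ 200 ≤ u * u ^ 200 := Nat.mul_le_mul_right _ (by omega)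
      _ = u ^ 201 := by ring
      _ ≤ 2 ^ u := hu₂ u (by omega)
  have hd2 : ⌈d⌉₊ ≤ 2 ^ u := by
    have h1 : Real.log n ≤ ((u ^ 51 : ℕ) : ℝ) :=
      log_le_of_le_two_pow (by linarith) (by exact_mod_cast hn51)
    have h3 : (1 : ℝ) ≤ ((u ^ 51 : ℕ) : ℝ) := by
      exact_mod_cast Nat.one_le_pow _ _ (by omega)
    have h2 : Real.log n ^ s ≤ ((u ^ 51 : ℕ) : ℝ) ^ ⌈s⌉₊ := by
      rw [← Real.rpow_natCast]
      exact (Real.rpow_le_rpow (Real.log_nonneg hn1) h1 hs0).trans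
        (Real.rpow_le_rpow_of_exponent_le h3 (Nat.le_ceil s))
    rw [Nat.ceil_le]
    calc d ≤ ((u ^ 51 : ℕ) : ℝ) ^ ⌈s⌉₊ := hds.le.trans h2
      _ = ((u ^ (51 * ⌈s⌉₊) : ℕ) : ℝ) := by push_cast; rw [pow_mul]
      _ ≤ ((2 ^ u : ℕ) : ℝ) := by
          have h4 : u ^ (51 * ⌈s⌉₊) ≤ 2 ^ u :=
            (Nat.pow_le_pow_right (by omega) (by omega)).trans (hu₁ u (by omega))
          exact_mod_cast h4
  have hKd : 10000 * Kc ^ 2 ≤ ⌈d⌉₊ := by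
    have h1 : (10000 * (Kc : ℝ) ^ 2) ≤ ⌈d⌉₊ := le_trans (by linarith) (Nat.le_ceil d)
    exact_mod_cast h1
  obtain ⟨f, hf⟩ := hbip
  set k := ⌈d⌉₊ / (100 * Kc ^ 2) with hk
  have hK2 : 0 < 100 * Kc ^ 2 := by positivity
  obtain ⟨ℓ, hℓ⟩ := exists_balSub_of_good hG hf (u := u) (k := k) (by omega) hu200
    (by rw [hV]; exact hun) (by rw [hV]; exact hn51) hd2 hKpos hKd (Nat.mul_div_le _ _)
  refine ⟨k, ℓ, ?_, hℓ⟩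
  have h1 : ⌈d⌉₊ < 100 * Kc ^ 2 * (k + 1) := Nat.lt_mul_div_succ _ hK2
  have h2 : 1 ≤ k := (Nat.one_le_div_iff hK2).2 (by omega)
  have h3 : ⌈d⌉₊ ≤ 200 * Kc ^ 2 * k := by
    have h4 : 100 * Kc ^ 2 * (k + 1) = 100 * (Kc ^ 2 * k) + 100 * Kc ^ 2 := by ring
    have h5 : 200 * Kc ^ 2 * k = 200 * (Kc ^ 2 * k) := by ring
    have h6 : Kc ^ 2 ≤ Kc ^ 2 * k := Nat.le_mul_of_pos_right _ h2
    omega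
  have h4 : d ≤ 200 * (Kc : ℝ) ^ 2 * k := (Nat.le_ceil d).trans (by exact_mod_cast h3)
  rw [div_mul_eq_mul_div, one_mul, div_le_iff₀ (by positivity)]
  linarith

end Balanced
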